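/- Alexander's trick for complements of lines: let ℱ be a finite family of pairwise disjoint topological lines in ℝ² and let F be the union of the elements of ℱ. Let h and h′ be orientation preserving homeomorphisms of ℝ² that coincide on F. Then h is isotopic to h′ relative to F; that is, the space of orientation preserving homeomorphisms of ℝ² coinciding with a given one on F is arcwise connected. -/

import Mathlib

open Set

/-- The plane. -/
abbrev Plane : Type := ℝ × ℝ

/-- `f` is (the underlying function of) a homeomorphism of the plane. -/
def IsHomeoFun (f : Plane → Plane) : Prop :=
  ∃ e : Plane ≃ₜ Plane, ∀ x, e x = f x

/-- `g` and `g'` are isotopic relative to `O` : there is a continuous family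
`F (t, ·)`, `t ∈ [0,1]`, of homeomorphisms of the plane going from `g` to `g'`
and agreeing with `g` on `O` for all times. -/
def IsotopicRel (g g' : Plane → Plane) (O : Set Plane) : Prop :=
  ∃ F : ℝ × Plane → Plane, Continuous F ∧
    (∀ t ∈ Icc (0:ℝ) 1, IsHomeoFun fun x => F (t, x)) ∧
    (∀ x, F (0, x) = g x) ∧
    (∀ x, F (1, x) = g' x) ∧
    (∀ t ∈ Icc (0:ℝ) 1, ∀ x ∈ O, F (t, x) = g x)

/-- A homeomorphism of the plane is orientation preserving iff it is isotopic
to the identity. -/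
def OrientationPreserving (h : Plane ≃ₜ Plane) : Prop :=
  IsotopicRel id (⇑h) (∅ : Set Plane)

/-- A Brouwer homeomorphism: orientation preserving and fixed point free. -/
def IsBrouwer (h : Plane ≃ₜ Plane) : Prop :=
  OrientationPreserving h ∧ ∀ x, h x ≠ x

/-- The orbit of a point under a homeomorphism. -/
def horbit (h : Plane ≃ₜ Plane) (x : Plane) : Set Plane :=
  {y | ∃ n : ℤ, y = (h.toEquiv ^ n) x}

/-- `ℤ₁ = ℤ × {1}`. -/
def Z1 : Set Plane := {p | ∃ n : ℤ, p = ((n : ℝ), 1)}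

/-- `ℤ₂ = ℤ × {2}`. -/
def Z2 : Set Plane := {p | ∃ n : ℤ, p = ((n : ℝ), 2)}

/-- The shear homeomorphism `(x, y) ↦ (x + f y, y)`. -/
def shear (f : ℝ → ℝ) (hf : Continuous f) : Plane ≃ₜ Plane where
  toFun p := (p.1 + f p.2, p.2)
  invFun p := (p.1 - f p.2, p.2)
  left_inv p := by simp
  right_inv p := by simp
  continuous_toFun := (continuous_fst.add (hf.comp continuous_snd)).prodMk continuous_snd
  continuous_invFun := (continuous_fst.sub (hf.comp continuous_snd)).prodMk continuous_snd

/-- The translation `T (x, y) = (x + 1, y)`. -/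
def T : Plane ≃ₜ Plane := shear (fun _ => 1) continuous_const

/-- The twist `T₁ (x, y) = (x + 2 - y, y)`. -/
def T₁ : Plane ≃ₜ Plane := shear (fun y => 2 - y) (by continuity)

/-- The twist `T₂ (x, y) = (x + y - 1, y)`. -/
def T₂ : Plane ≃ₜ Plane := shear (fun y => y - 1) (by continuity)

/-- The model Reeb homeomorphism `R₀ = T₁ ∘ T₂⁻¹`, `R₀ (x, y) = (x + 3 - 2y, y)`. -/
def R₀ : Plane ≃ₜ Plane := shear (fun y => 3 - 2 * y) (by continuity)

/-- The Euclidean norm on the plane. -/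
noncomputable def planeNorm (p : Plane) : ℝ := Real.sqrt (p.1 ^ 2 + p.2 ^ 2)

/-- An angle function for a fixed point free map `h'` along a curve `γ`. -/
def IsAngleFunction (h' : Plane → Plane) (γ : ℝ → Plane) (θ : ℝ → ℝ) : Prop :=
  ContinuousOn θ (Icc 0 1) ∧
    ∀ t ∈ Icc (0:ℝ) 1,
      h' (γ t) - γ t =
        planeNorm (h' (γ t) - γ t) • (Real.cos (θ t), Real.sin (θ t))

/-- The conjugate `Φ ∘ h ∘ Φ⁻¹`. -/
def conjH (Φ h : Plane ≃ₜ Plane) : Plane ≃ₜ Plane := Φ.symm.trans (h.trans Φ)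

/-- An admissible straightening `Φ` for `(h, O₁, O₂)` : an orientation preserving
homeomorphism sending `O₁, O₂` to `ℤ₁, ℤ₂` such that `Φ ∘ h ∘ Φ⁻¹` is isotopic
relative to `ℤ₁ ∪ ℤ₂` to a homeomorphism translating each line `ℝ × {i}` by `±1`. -/
def AdmissibleStraightening (h : Plane ≃ₜ Plane) (O₁ O₂ : Set Plane)
    (Φ : Plane ≃ₜ Plane) : Prop :=
  OrientationPreserving Φ ∧ Φ '' O₁ = Z1 ∧ Φ '' O₂ = Z2 ∧
    ∃ ε₁ ε₂ : ℝ, (ε₁ = 1 ∨ ε₁ = -1) ∧ (ε₂ = 1 ∨ ε₂ = -1) ∧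
      ∃ g : Plane ≃ₜ Plane,
        (∀ x : ℝ, g (x, 1) = (x + ε₁, 1)) ∧
        (∀ x : ℝ, g (x, 2) = (x + ε₂, 2)) ∧
        IsotopicRel (⇑(conjH Φ h)) (⇑g) (Z1 ∪ Z2)

/-- A flow on the plane. -/
def IsFlow (φ : ℝ → Plane → Plane) : Prop :=
  Continuous (fun p : ℝ × Plane => φ p.1 p.2) ∧
    (∀ x, φ 0 x = x) ∧ ∀ s t x, φ (s + t) x = φ s (φ t x)

/-- A topological line in the plane: the image of a proper injective continuous
map from `ℝ` to the plane. -/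
def IsTopLine (L : Set Plane) : Prop :=
  ∃ f : ℝ → Plane, Continuous f ∧ Function.Injective f ∧ IsProperMap f ∧ range f = L


namespace LineAlexander
open Set Filter Topology

/-- `g` has a continuous logarithm on `X` which tends to `0` at infinity. -/
def NullLog (X : Set ℂ) (g : ℂ → ℂ) : Prop :=
  ∃ l : ℂ → ℂ, ContinuousOn l X ∧ (∀ z ∈ X, Complex.exp (l z) = g z) ∧
    Tendsto l (cocompact ℂ ⊓ 𝓟 X) (𝓝 0)

theorem sub_eq_sub_of_exp_eq {α : Type*} [TopologicalSpace α] {C : Set α}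
    (hC : IsPreconnected C) {l₁ l₂ : α → ℂ} (h₁ : ContinuousOn l₁ C) (h₂ : ContinuousOn l₂ C)
    (h : ∀ x ∈ C, Complex.exp (l₁ x) = Complex.exp (l₂ x)) {x y : α} (hx : x ∈ C) (hy : y ∈ C) :
    l₁ x - l₂ x = l₁ y - l₂ y := by
  have key : ∀ z ∈ C, ∃ n : ℤ, l₁ z - l₂ z = n * (2 * Real.pi * Complex.I) := by
    intro z hz
    rw [← Complex.exp_eq_one_iff, Complex.exp_sub, h z hz, div_self (Complex.exp_ne_zero _)]
  let f : α → ℝ := fun z => (l₁ z - l₂ z).im / (2 * Real.pi)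
  have hf : ContinuousOn f C :=
    (Complex.continuous_im.comp_continuousOn (h₁.sub h₂)).div_const _
  have hval : ∀ z ∈ C, ∃ n : ℤ, f z = n ∧ l₁ z - l₂ z = n * (2 * Real.pi * Complex.I) := by
    intro z hz
    obtain ⟨n, hn⟩ := key z hz
    refine ⟨n, ?_, hn⟩
    simp only [f, hn]
    have := Real.pi_ne_zero
    simp
  have : DiscreteTopology (range ((↑) : ℤ → ℝ)) :=
    (Int.isClosedEmbedding_coe_real.isEmbedding.toHomeomorph.symm.isEmbedding).discreteTopology
  have hxy : f x = f y := hC.constant_of_mapsTo ⟨this⟩ hf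
    (T := range ((↑) : ℤ → ℝ)) (fun z hz => by
      obtain ⟨n, hn, -⟩ := hval z hz
      exact ⟨n, hn.symm⟩) hx hy
  obtain ⟨n, hn, e⟩ := hval x hx
  obtain ⟨m, hm, e'⟩ := hval y hy
  have : n = m := by
    rw [hn, hm] at hxy
    exact_mod_cast hxy
  rw [e, e', this]

namespace NullLog
variable {X Y : Set ℂ} {g g' : ℂ → ℂ}

theorem congr (h : NullLog X g) (e : ∀ z ∈ X, g z = g' z) : NullLog X g' := by
  obtain ⟨l, h1, h2, h3⟩ := h
  exact ⟨l, h1, fun z hz => (h2 z hz).trans (e z hz), h3⟩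

theorem mul (h : NullLog X g) (h' : NullLog X g') : NullLog X (g * g') := by
  obtain ⟨l, h1, h2, h3⟩ := h
  obtain ⟨l', h1', h2', h3'⟩ := h'
  refine ⟨l + l', h1.add h1', fun z hz => ?_, by simpa [Pi.add_def] using h3.add h3'⟩
  simp [Complex.exp_add, h2 z hz, h2' z hz]

theorem inv (h : NullLog X g) : NullLog X g⁻¹ := by
  obtain ⟨l, h1, h2, h3⟩ := h
  refine ⟨-l, h1.neg, fun z hz => ?_, by simpa [Pi.neg_def] using h3.neg⟩
  simp [Complex.exp_neg, h2 z hz]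

/-- Logarithms on two closed sets glue when the intersection is a union of connected sets
going to infinity. -/
theorem union (hX : IsClosed X) (hY : IsClosed Y) (h : NullLog X g) (h' : NullLog Y g)
    (hc : ∀ z ∈ X ∩ Y, ∃ C ⊆ X ∩ Y, z ∈ C ∧ IsPreconnected C ∧ ¬ Bornology.IsBounded C) :
    NullLog (X ∪ Y) g := by
  classical
  obtain ⟨l, h1, h2, h3⟩ := h
  obtain ⟨l', h1', h2', h3'⟩ := h'
  have agree : ∀ z ∈ X ∩ Y, l z = l' z := by
    intro z hz
    obtain ⟨C, hCs, hzC, hC, hCb⟩ := hc z hz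
    have hconst : ∀ w ∈ C, l w - l' w = l z - l' z := fun w hw =>
      sub_eq_sub_of_exp_eq hC (h1.mono fun x hx => (hCs hx).1) (h1'.mono fun x hx => (hCs hx).2)
        (fun x hx => by rw [h2 x (hCs hx).1, h2' x (hCs hx).2]) hw hzC
    have hne : (cocompact ℂ ⊓ 𝓟 C).NeBot := by
      rw [← Metric.cobounded_eq_cocompact, inf_principal_neBot_iff]
      intro U hU
      by_contra hn
      rw [not_nonempty_iff_eq_empty] at hn
      apply hCb
      have : C ⊆ Uᶜ := fun x hx hxU => by
        have : x ∈ U ∩ C := ⟨hxU, hx⟩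
        simp [hn] at this
      exact Bornology.IsBounded.subset (Bornology.isBounded_def.2 (by simpa using hU)) this
    have t : Tendsto (fun w => l w - l' w) (cocompact ℂ ⊓ 𝓟 C) (𝓝 (0 - 0)) :=
      (h3.mono_left (inf_le_inf le_rfl (principal_mono.2 fun x hx => (hCs hx).1))).sub
        (h3'.mono_left (inf_le_inf le_rfl (principal_mono.2 fun x hx => (hCs hx).2)))
    have t' : Tendsto (fun w => l w - l' w) (cocompact ℂ ⊓ 𝓟 C) (𝓝 (l z - l' z)) := by
      refine tendsto_const_nhds.congr' ?_
      exact eventually_inf_principal.2 (Eventually.of_forall fun w hw => (hconst w hw).symm)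
    have := tendsto_nhds_unique t t'
    rw [sub_zero] at this
    exact (sub_eq_zero.1 this.symm)
  let L : ℂ → ℂ := fun z => if z ∈ X then l z else l' z
  have eX : EqOn L l X := fun z hz => if_pos hz
  have eY : EqOn L l' Y := fun z hz => by
    by_cases hx : z ∈ X
    · rw [eX hx, agree z ⟨hx, hz⟩]
    · exact if_neg hx
  refine ⟨L, (h1.congr eX).union_of_isClosed (h1'.congr eY) hX hY, ?_, ?_⟩
  · rintro z (hz | hz)
    · rw [eX hz, h2 z hz]
    · rw [eY hz, h2' z hz]
  · rw [← sup_principal, inf_sup_left]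
    refine Tendsto.sup (h3.congr' ?_) (h3'.congr' ?_)
    · exact eventually_inf_principal.2 (Eventually.of_forall fun w hw => (eX hw).symm)
    · exact eventually_inf_principal.2 (Eventually.of_forall fun w hw => (eY hw).symm)

end NullLog

theorem tendsto_sub_div_sub (p q : ℂ) :
    Tendsto (fun z : ℂ => (z - p) / (z - q)) (cocompact ℂ) (𝓝 1) := by
  have h : Tendsto (fun z : ℂ => (q - p) * (z - q)⁻¹ + 1) (cocompact ℂ) (𝓝 ((q - p) * 0 + 1)) := by
    refine ((Tendsto.comp tendsto_inv₀_cobounded ?_).const_mul _).add_const _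
    rw [← Metric.cobounded_eq_cocompact]
    simp [sub_eq_add_neg, tendsto_add_const_cobounded]
  simp only [mul_zero, zero_add] at h
  refine h.congr' ?_
  have : ∀ᶠ z in cocompact ℂ, z ≠ q := by
    filter_upwards [(isCompact_singleton (x := q)).compl_mem_cocompact] with z hz using hz
  filter_upwards [this] with z hz
  have := sub_ne_zero.2 hz
  field_simp
  ring

theorem tendsto_log_one : Tendsto Complex.log (𝓝 1) (𝓝 0) := by
  have := (continuousAt_clog (x := (1 : ℂ)) (by simp)).tendsto
  simpa using this

theorem re_pos_of_norm_sub_one_lt {w : ℂ} (h : ‖w - 1‖ < 1) : 0 < w.re := by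
  have := (Complex.abs_re_le_norm (w - 1)).trans_lt h
  rw [abs_lt] at this
  simp at this
  linarith [this.1]

theorem nullLog_of_ball {X : Set ℂ} {p q : ℂ} {r : ℝ} (hX : Disjoint (Metric.ball q r) X)
    (hp : p ∈ Metric.ball q r) : NullLog X (fun z => (z - p) / (z - q)) := by
  have hre : ∀ z ∈ X, 0 < ((z - p) / (z - q)).re ∧ z - q ≠ 0 ∧ z - p ≠ 0 := by
    intro z hz
    have h1 : r ≤ ‖z - q‖ := by
      by_contra h
      exact disjoint_left.1 hX (by simpa [dist_eq_norm] using h) hz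
    have h2 : ‖q - p‖ < r := by simpa [dist_eq_norm, norm_sub_rev] using hp
    have h3 : z - q ≠ 0 := by
      intro h
      rw [h, norm_zero] at h1
      linarith [norm_nonneg (q - p)]
    refine ⟨re_pos_of_norm_sub_one_lt ?_, h3, ?_⟩
    · have : (z - p) / (z - q) - 1 = (q - p) / (z - q) := by field_simp; ring
      rw [this, norm_div, div_lt_one (norm_pos_iff.2 h3)]
      linarith
    · intro h
      rw [sub_eq_zero.1 h, norm_sub_rev] at h1
      linarith
  refine ⟨fun z => Complex.log ((z - p) / (z - q)), ?_, ?_, ?_⟩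
  · intro z hz
    refine ContinuousWithinAt.clog ?_ (Or.inl (hre z hz).1)
    exact ContinuousAt.continuousWithinAt (by have := (hre z hz).2.1; fun_prop (disch := assumption))
  · intro z hz
    exact Complex.exp_log (div_ne_zero (hre z hz).2.2 (hre z hz).2.1)
  · exact tendsto_log_one.comp ((tendsto_sub_div_sub p q).mono_left inf_le_left)

theorem nullLog_of_isPreconnected {X C : Set ℂ} (hX : IsClosed X) (hC : IsPreconnected C)
    (hCX : Disjoint C X) {p q : ℂ} (hp : p ∈ C) (hq : q ∈ C) :
    NullLog X (fun z => (z - p) / (z - q)) := by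
  have key := hC.induction₂ (fun p q => p ∉ X ∧ q ∉ X ∧ NullLog X (fun z => (z - p) / (z - q)))
    ?_ ?_ ?_ hp hq
  · exact key.2.2
  · intro x hx
    have hxX := disjoint_left.1 hCX hx
    obtain ⟨r, hr, hb⟩ := Metric.isOpen_iff.1 hX.isOpen_compl x hxX
    filter_upwards [mem_nhdsWithin_of_mem_nhds (Metric.ball_mem_nhds x hr)] with y hy
    refine ⟨hxX, hb hy, ?_⟩
    have := (nullLog_of_ball (X := X) (disjoint_left.2 fun z hz => hb hz) hy).inv
    exact this.congr fun z _ => by simp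
  · intro x y z _ _ _ h1 h2
    refine ⟨h1.1, h2.2.1, (h1.2.2.mul h2.2.2).congr fun w hw => ?_⟩
    have : w - y ≠ 0 := sub_ne_zero.2 fun h => h1.2.1 (h ▸ hw)
    simp only [Pi.mul_apply]
    field_simp
  · intro x y _ _ h
    exact ⟨h.2.1, h.1, h.2.2.inv.congr fun z _ => by simp⟩


theorem exists_continuous_extension_small {X : Set ℂ} (hX : IsClosed X) {l : ℂ → ℂ}
    (hl : ContinuousOn l X) (hl0 : Tendsto l (cocompact ℂ ⊓ 𝓟 X) (𝓝 0)) {δ : ℝ} (hδ : 0 < δ) :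
    ∃ G : ℂ → ℂ, Continuous G ∧ EqOn G l X ∧ ∃ R₀ : ℝ, ∀ z, R₀ ≤ ‖z‖ → ‖G z‖ ≤ δ := by
  obtain ⟨G₀, hG₀⟩ := ContinuousMap.exists_restrict_eq hX ⟨X.domRestrict l, hl.domRestrict⟩
  have e₀ : EqOn G₀ l X := fun z hz => congrArg (fun f : C(X, ℂ) => f ⟨z, hz⟩) hG₀
  have hev : ∀ᶠ z in cocompact ℂ, z ∈ X → ‖l z‖ ≤ δ := by
    refine eventually_inf_principal.1 ?_
    filter_upwards [hl0 (Metric.closedBall_mem_nhds 0 hδ)] with z hz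
    simpa using hz
  rw [← Metric.cobounded_eq_cocompact, (hasBasis_cobounded_norm (E := ℂ)).eventually_iff] at hev
  obtain ⟨R, -, hR⟩ := hev
  obtain ⟨M, hM⟩ := (isCompact_closedBall (0 : ℂ) R).exists_bound_of_continuousOn
    G₀.continuous.continuousOn
  let c : ℂ → ℝ := fun z => δ + |M| * max 0 (R + 1 - ‖z‖)
  have hc : Continuous c := by fun_prop
  have hcδ : ∀ z, δ ≤ c z := fun z => by
    have : 0 ≤ |M| * max 0 (R + 1 - ‖z‖) := by positivity
    simp only [c]; linarith
  have hm : ∀ z, 0 < max (c z) ‖G₀ z‖ := fun z => lt_max_of_lt_left (hδ.trans_le (hcδ z))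
  refine ⟨fun z => ((c z / max (c z) ‖G₀ z‖ : ℝ) : ℂ) * G₀ z, ?_, ?_, R + 1, ?_⟩
  · refine (Complex.continuous_ofReal.comp (hc.div (by fun_prop) fun z => (hm z).ne')).mul
      G₀.continuous
  · intro z hz
    have hle : ‖G₀ z‖ ≤ c z := by
      by_cases h : ‖z‖ ≤ R
      · have h1 : ‖G₀ z‖ ≤ |M| := (hM z (by simpa using h)).trans (le_abs_self M)
        have h2 : |M| * 1 ≤ |M| * max 0 (R + 1 - ‖z‖) :=
          mul_le_mul_of_nonneg_left (le_max_of_le_right (by linarith)) (abs_nonneg M)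
        simp only [c]; linarith
      · rw [e₀ hz]
        exact (hR (by simpa using (not_le.1 h).le) hz).trans (hcδ z)
    simp only [max_eq_left hle, div_self (hδ.trans_le (hcδ z)).ne', Complex.ofReal_one, one_mul]
    exact e₀ hz
  · intro z hz
    have hcz : c z = δ := by
      simp only [c, max_eq_left (by linarith : R + 1 - ‖z‖ ≤ 0), mul_zero, add_zero]
    rw [norm_mul, Complex.norm_real, Real.norm_of_nonneg (by have := hm z; rw [hcz]; rw [hcz] at this; positivity),
      div_mul_eq_mul_div, div_le_iff₀ (hm z), hcz]
    exact mul_le_mul_of_nonneg_left (le_max_right _ _) hδ.le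

theorem exists_continuous_log {E : Type*} [NormedAddCommGroup E] [NormedSpace ℝ E]
    {f : E → ℂ} (hf : Continuous f) (h0 : ∀ z, f z ≠ 0) :
    ∃ L : E → ℂ, Continuous L ∧ ∀ z, Complex.exp (L z) = f z := by
  have hs : IsSimplyConnected (univ : Set E) := by
    have : ContractibleSpace (univ : Set E) := (Homeomorph.Set.univ E).contractibleSpace
    exact inferInstanceAs (SimplyConnectedSpace (univ : Set E))
  obtain ⟨L, h1, h2⟩ := Complex.exists_continuousOn_eqOn_exp_comp
    hs isOpen_univ hf.continuousOn (by simpa using h0)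
  exact ⟨L, continuousOn_univ.1 h1, fun z => h2 (mem_univ z)⟩

theorem exponent_eq_zero_of_re_pos {f : ℂ → ℂ} (hf : Continuous f) (h0 : ∀ z, f z ≠ 0) {a : ℤ}
    {R : ℝ} (hR : 0 < R) (h : ∀ z : ℂ, ‖z‖ = R → 0 < (f z / z ^ a).re) : a = 0 := by
  obtain ⟨L, hL, hLf⟩ := exists_continuous_log hf h0
  let γ : ℝ → ℂ := fun θ => Complex.exp (Real.log R + θ * Complex.I)
  have hγ : Continuous γ := by fun_prop
  have hn : ∀ θ, ‖γ θ‖ = R := fun θ => by simp [γ, Complex.norm_exp, Real.exp_log hR]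
  have hne : ∀ θ, γ θ ≠ 0 := fun θ => Complex.exp_ne_zero _
  have key := sub_eq_sub_of_exp_eq (isPreconnected_univ (α := ℝ))
    (l₁ := fun θ => L (γ θ) - Complex.log (f (γ θ) / γ θ ^ a))
    (l₂ := fun θ => a * (Real.log R + θ * Complex.I))
    (Continuous.continuousOn (by
      refine (hL.comp hγ).sub (Continuous.clog ?_ fun θ => Or.inl (h _ (hn θ)))
      exact (hf.comp hγ).div (hγ.zpow₀ a fun θ => Or.inl (hne θ)) fun θ => zpow_ne_zero _ (hne θ)))
    (Continuous.continuousOn (by fun_prop)) (fun θ _ => by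
      rw [Complex.exp_sub, hLf, Complex.exp_log (div_ne_zero (h0 _) (zpow_ne_zero _ (hne θ))),
        Complex.exp_int_mul]
      change _ = γ θ ^ a
      have := h0 (γ θ)
      field_simp) (mem_univ 0) (mem_univ (2 * Real.pi))
  have hper : γ (2 * Real.pi) = γ 0 := by
    simp only [γ, Complex.exp_eq_exp_iff_exists_int]
    exact ⟨1, by push_cast; ring⟩
  simp only [hper] at key
  have h2 : (a : ℂ) * (2 * Real.pi * Complex.I) = 0 := by
    push_cast at key
    linear_combination key
  simpa [Real.pi_ne_zero] using h2

theorem exponent_eq_zero_of_nullLog {X V : Set ℂ} (hX : IsClosed X) (hV : IsOpen V)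
    (hfr : frontier V ⊆ X) {p : ℂ} (hp : p ∈ V) {g : ℂ → ℂ} (hg : ContinuousOn g (closure V))
    (hg0 : ∀ z ∈ closure V, g z ≠ 0) {a : ℤ}
    (hga : Tendsto (fun z => g z / z ^ a) (cocompact ℂ) (𝓝 1))
    (hl : NullLog X (fun z => (z - p) ^ a / g z)) : a = 0 := by
  classical
  obtain ⟨l, hlc, hle, hl0⟩ := hl
  obtain ⟨G, hG, hGl, R₀, hGR⟩ :=
    exists_continuous_extension_small hX hlc hl0 (δ := 1 / 8) (by norm_num)
  have hpa : Tendsto (fun z : ℂ => (z - p) ^ a / z ^ a) (cocompact ℂ) (𝓝 1) := by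
    have := (tendsto_sub_div_sub p 0).zpow₀ a (Or.inl one_ne_zero)
    simpa [div_zpow] using this
  have near : ∀ u : ℂ → ℂ, Tendsto u (cocompact ℂ) (𝓝 1) →
      ∃ R : ℝ, ∀ z, R ≤ ‖z‖ → ‖u z - 1‖ < 1 / 8 := by
    intro u hu
    have := hu (Metric.ball_mem_nhds 1 (by norm_num : (0 : ℝ) < 1 / 8))
    rw [← Metric.cobounded_eq_cocompact, mem_map, (hasBasis_cobounded_norm (E := ℂ)).mem_iff] at this
    obtain ⟨R, -, hR⟩ := this
    exact ⟨R, fun z hz => by simpa [dist_eq_norm] using hR hz⟩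
  obtain ⟨R₁, hR₁⟩ := near _ hga
  obtain ⟨R₂, hR₂⟩ := near _ hpa
  have hcl : ∀ z, z ∈ closure (closure V)ᶜ → z ≠ p := by
    intro z hz h
    rw [closure_compl] at hz
    exact hz (h ▸ interior_maximal subset_closure hV hp)
  let f : ℂ → ℂ := fun z => if z ∈ closure V then Complex.exp (G z) * g z else (z - p) ^ a
  refine exponent_eq_zero_of_re_pos (f := f) ?_ ?_ (R := max 1 (max R₀ (max R₁ R₂)))
    (by positivity) ?_
  · rw [← continuousOn_univ]
    refine ContinuousOn.if ?_ ?_ ?_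
    · rintro z ⟨-, hz⟩
      have hz' : z ∈ frontier V := frontier_closure_subset hz
      have hzc : z ∈ closure V := frontier_subset_closure hz'
      rw [hGl (hfr hz'), hle z (hfr hz'), div_mul_cancel₀ _ (hg0 z hzc)]
    · simp only [univ_inter]
      have : closure {z | z ∈ closure V} = closure V := isClosed_closure.closure_eq
      rw [this]
      exact (Complex.continuous_exp.comp hG).continuousOn.mul hg
    · simp only [univ_inter]
      refine (continuous_id.sub continuous_const).continuousOn.zpow₀ a ?_
      intro z hz
      exact Or.inl (sub_ne_zero.2 (hcl z hz))
  · intro z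
    by_cases hz : z ∈ closure V
    · simp only [f, if_pos hz]
      exact mul_ne_zero (Complex.exp_ne_zero _) (hg0 z hz)
    · simp only [f, if_neg hz]
      exact zpow_ne_zero _ (sub_ne_zero.2 (hcl z (subset_closure hz)))
  · intro z hz
    have h0 : R₀ ≤ ‖z‖ := by rw [hz]; simp
    have h1 : R₁ ≤ ‖z‖ := by rw [hz]; simp
    have h2 : R₂ ≤ ‖z‖ := by rw [hz]; simp
    refine re_pos_of_norm_sub_one_lt ?_
    by_cases hzV : z ∈ closure V
    · simp only [f, if_pos hzV]
      have e1 : ‖Complex.exp (G z) - 1‖ ≤ 2 * ‖G z‖ :=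
        Complex.norm_exp_sub_one_le ((hGR z h0).trans (by norm_num))
      have e2 := hR₁ z h1
      have e3 := hGR z h0
      have : Complex.exp (G z) * g z / z ^ a - 1 =
          (Complex.exp (G z) - 1) * (g z / z ^ a - 1) + (Complex.exp (G z) - 1)
            + (g z / z ^ a - 1) := by ring
      rw [this]
      refine (norm_add_le _ _).trans_lt ?_
      refine (add_le_add (norm_add_le _ _) le_rfl).trans_lt ?_
      rw [norm_mul]
      have : ‖Complex.exp (G z) - 1‖ ≤ 1 / 4 := by linarith
      nlinarith [norm_nonneg (Complex.exp (G z) - 1), norm_nonneg (g z / z ^ a - 1)]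
    · simp only [f, if_neg hzV]
      linarith [hR₂ z h2]

theorem frontier_connectedComponentIn_subset {X : Set ℂ} (hX : IsClosed X) {p : ℂ} :
    frontier (connectedComponentIn Xᶜ p) ⊆ X := by
  intro z hz
  by_contra hzX
  have ho : IsOpen (connectedComponentIn Xᶜ z) := hX.isOpen_compl.connectedComponentIn
  have hzm : z ∈ connectedComponentIn Xᶜ z := mem_connectedComponentIn hzX
  obtain ⟨y, hy, hyp⟩ := mem_closure_iff.1 (frontier_subset_closure hz) _ ho hzm
  have e := connectedComponentIn_eq hy
  have e' := connectedComponentIn_eq hyp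
  rw [e, ← e'] at hzm
  have := hX.isOpen_compl.connectedComponentIn (x := p)
  rw [this.frontier_eq] at hz
  exact hz.2 hzm

theorem notMem_closure_of_isPreconnected {X V : Set ℂ} (hfr : frontier V ⊆ X) {q : ℂ}
    (hq : q ∉ V) (hqX : q ∉ X) : q ∉ closure V := fun h =>
  hqX (hfr ⟨h, fun h' => hq (interior_subset h')⟩)

theorem mem_connectedComponentIn_of_nullLog {X : Set ℂ} (hX : IsClosed X) {p q : ℂ} (hp : p ∉ X)
    (hq : q ∉ X) (h : NullLog X (fun z => (z - p) / (z - q))) :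
    q ∈ connectedComponentIn Xᶜ p := by
  by_contra hqV
  have hfr := frontier_connectedComponentIn_subset hX (p := p)
  have := exponent_eq_zero_of_nullLog (g := fun z => z - q) (a := 1) hX
    hX.isOpen_compl.connectedComponentIn hfr (mem_connectedComponentIn hp) (by fun_prop)
    (fun z hz e => notMem_closure_of_isPreconnected hfr hqV hq (sub_eq_zero.1 e ▸ hz))
    (by simpa using tendsto_sub_div_sub q 0) (by simpa using h)
  exact one_ne_zero this

end LineAlexander

namespace LineAlexander
open Set Filter Topology

/-- Every point of `X` lies in an unbounded connected subset of `X`. -/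
def ConnectedToInfinity (X : Set ℂ) : Prop :=
  ∀ z ∈ X, ∃ C ⊆ X, z ∈ C ∧ IsPreconnected C ∧ ¬ Bornology.IsBounded C

/-- `f` parametrizes a topological line. -/
structure IsLineMap (f : ℝ → ℂ) : Prop where
  continuous : Continuous f
  injective : Function.Injective f
  tendsto : Tendsto f (cocompact ℝ) (cocompact ℂ)

/-- A topological line. -/
def IsLine (L : Set ℂ) : Prop := ∃ f : ℝ → ℂ, IsLineMap f ∧ range f = L

namespace IsLineMap
variable {f : ℝ → ℂ}

theorem isClosedMap (hf : IsLineMap f) : IsClosedMap f :=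
  (isProperMap_iff_tendsto_cocompact.2 ⟨hf.continuous, hf.tendsto⟩).isClosedMap

theorem not_isBounded (hf : IsLineMap f) {S : Set ℝ} (hS : ¬ Bornology.IsBounded S) :
    ¬ Bornology.IsBounded (f '' S) := by
  intro h
  have h1 := hf.tendsto
  rw [← Metric.cobounded_eq_cocompact, ← Metric.cobounded_eq_cocompact] at h1
  have h2 := h1 (Bornology.isBounded_def.1 h)
  exact hS ((Bornology.isBounded_def.2 h2).subset fun s hs => by
    simpa using ⟨s, hs, rfl⟩)

theorem not_isBounded_range (hf : IsLineMap f) : ¬ Bornology.IsBounded (range f) := by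
  rw [← image_univ]
  refine hf.not_isBounded fun h => noncompact_univ ℝ ?_
  simpa using h.isCompact_closure

theorem not_isBounded_Ici (hf : IsLineMap f) (a : ℝ) : ¬ Bornology.IsBounded (f '' Ici a) :=
  hf.not_isBounded fun h => not_bddAbove_Ici a h.bddAbove

theorem not_isBounded_Iic (hf : IsLineMap f) (a : ℝ) : ¬ Bornology.IsBounded (f '' Iic a) :=
  hf.not_isBounded fun h => not_bddBelow_Iic a h.bddBelow

end IsLineMap

theorem IsLine.isClosed {L : Set ℂ} (h : IsLine L) : IsClosed L := by
  obtain ⟨f, hf, rfl⟩ := h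
  exact hf.isClosedMap.isClosed_range

theorem IsLine.isPreconnected {L : Set ℂ} (h : IsLine L) : IsPreconnected L := by
  obtain ⟨f, hf, rfl⟩ := h
  exact isPreconnected_range hf.continuous

theorem IsLine.not_isBounded {L : Set ℂ} (h : IsLine L) : ¬ Bornology.IsBounded L := by
  obtain ⟨f, hf, rfl⟩ := h
  exact hf.not_isBounded_range

/-- A finite family of disjoint topological lines. -/
structure IsLineFamily (𝓛 : Set (Set ℂ)) : Prop where
  finite : 𝓛.Finite
  isLine : ∀ L ∈ 𝓛, IsLine L
  disjoint : 𝓛.Pairwise Disjoint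

namespace IsLineFamily
variable {𝓛 : Set (Set ℂ)}

theorem isClosed (h : IsLineFamily 𝓛) : IsClosed (⋃₀ 𝓛) :=
  sUnion_eq_biUnion (s := 𝓛) ▸ h.finite.isClosed_biUnion fun L hL => (h.isLine L hL).isClosed

theorem subset (h : IsLineFamily 𝓛) {𝓜 : Set (Set ℂ)} (hM : 𝓜 ⊆ 𝓛) : IsLineFamily 𝓜 :=
  ⟨h.finite.subset hM, fun L hL => h.isLine L (hM hL), h.disjoint.mono hM⟩

theorem nullLog (h : IsLineFamily 𝓛) {g : ℂ → ℂ} (hg : ∀ L ∈ 𝓛, NullLog L g) :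
    NullLog (⋃₀ 𝓛) g := by
  obtain ⟨hfin, hl, hd⟩ := h
  induction 𝓛, hfin using Set.Finite.induction_on with
  | empty =>
    refine ⟨0, by simp, by simp, tendsto_const_nhds⟩
  | @insert L S hLS hS ih =>
    have hS' : IsLineFamily S := ⟨hS, fun M hM => hl M (mem_insert_of_mem _ hM),
      hd.mono (subset_insert _ _)⟩
    rw [sUnion_insert]
    refine NullLog.union (hl L (mem_insert _ _)).isClosed hS'.isClosed (hg L (mem_insert _ _))
      (ih (fun M hM => hg M (mem_insert_of_mem _ hM)) hS'.isLine hS'.disjoint) ?_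
    rintro z ⟨hz, M, hM, hzM⟩
    exact absurd hzM (disjoint_left.1 (hd (mem_insert _ _) (mem_insert_of_mem _ hM)
      (fun e => hLS (e ▸ hM))) hz)

theorem mem_connectedComponentIn (h : IsLineFamily 𝓛) {p q : ℂ} (hp : p ∉ ⋃₀ 𝓛)
    (hq : q ∉ ⋃₀ 𝓛) (hpq : ∀ L ∈ 𝓛, q ∈ connectedComponentIn Lᶜ p) :
    q ∈ connectedComponentIn (⋃₀ 𝓛)ᶜ p := by
  refine mem_connectedComponentIn_of_nullLog h.isClosed hp hq (h.nullLog fun L hL => ?_)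
  refine nullLog_of_isPreconnected (h.isLine L hL).isClosed isPreconnected_connectedComponentIn
    (disjoint_left.2 fun z hz => connectedComponentIn_subset _ _ hz) ?_ (hpq L hL)
  exact _root_.mem_connectedComponentIn fun hpL => hp ⟨L, hL, hpL⟩

end IsLineFamily

/-- Local connectedness of `U` at its frontier points. -/
def LocConnAtFrontier (U : Set ℂ) : Prop :=
  ∀ x₀ ∈ frontier U, ∀ ε > 0, ∃ δ > 0, ∀ x ∈ U ∩ Metric.ball x₀ δ, ∀ y ∈ U ∩ Metric.ball x₀ δ,
    ∃ T ⊆ U ∩ Metric.ball x₀ ε, IsPreconnected T ∧ x ∈ T ∧ y ∈ T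

theorem IsLineFamily.locConnAtFrontier {𝓛 : Set (Set ℂ)} (h : IsLineFamily 𝓛) (p : ℂ) :
    LocConnAtFrontier (connectedComponentIn (⋃₀ 𝓛)ᶜ p) := by
  intro x₀ hx₀ ε hε
  set F := ⋃₀ 𝓛 with hF
  have hx₀F : x₀ ∈ F := frontier_connectedComponentIn_subset h.isClosed hx₀
  obtain ⟨L, hL, hxL⟩ := hx₀F
  obtain ⟨f, hf, rfl⟩ := h.isLine L hL
  obtain ⟨s₀, rfl⟩ := hxL
  obtain ⟨a, ha, hJ⟩ := Metric.continuousAt_iff.1 (hf.continuous.continuousAt (x := s₀)) ε hε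
  have hFd : F = ⋃₀ (𝓛 \ {range f}) ∪ range f := by
    rw [hF, ← sUnion_singleton (range f), ← sUnion_union, sUnion_singleton,
      sdiff_union_of_subset (singleton_subset_iff.2 hL)]
  set E := ⋃₀ (𝓛 \ {range f}) ∪ (f '' Iic (s₀ - a) ∪ f '' Ici (s₀ + a)) with hE
  have hsub := h.subset (𝓜 := 𝓛 \ {range f}) sdiff_subset
  have hEc : IsClosed E := hsub.isClosed.union
    ((hf.isClosedMap _ isClosed_Iic).union (hf.isClosedMap _ isClosed_Ici))
  have hEF : E ⊆ F := by
    rw [hFd]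
    refine union_subset_union_right _ (union_subset (image_subset_range _ _) (image_subset_range _ _))
  have hFE : F \ Metric.ball (f s₀) ε ⊆ E := by
    rintro z ⟨hz, hzb⟩
    rw [hFd] at hz
    rcases hz with hz | ⟨s, rfl⟩
    · exact Or.inl hz
    · right
      have hs : a ≤ |s - s₀| := by
        by_contra hs
        exact hzb (hJ (by simpa [Real.dist_eq] using hs))
      rcases le_abs.1 hs with h | h
      · exact Or.inr ⟨s, by simp; linarith, rfl⟩
      · exact Or.inl ⟨s, by simp; linarith, rfl⟩
  have hxE : f s₀ ∉ E := by
    rintro (⟨M, hM, hzM⟩ | ⟨s, hs, e⟩ | ⟨s, hs, e⟩)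
    · exact disjoint_left.1 (h.disjoint hM.1 hL hM.2) hzM ⟨s₀, rfl⟩
    · have := hf.injective e; simp at hs; linarith
    · have := hf.injective e; simp at hs; linarith
  have hEinf : ConnectedToInfinity E := by
    rintro z (⟨M, hM, hzM⟩ | hz | hz)
    · exact ⟨M, fun w hw => Or.inl ⟨M, hM, hw⟩, hzM, (h.isLine M hM.1).isPreconnected,
        (h.isLine M hM.1).not_isBounded⟩
    · exact ⟨_, fun w hw => Or.inr (Or.inl hw), hz,
        isPreconnected_Iic.image _ hf.continuous.continuousOn, hf.not_isBounded_Iic _⟩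
    · exact ⟨_, fun w hw => Or.inr (Or.inr hw), hz,
        isPreconnected_Ici.image _ hf.continuous.continuousOn, hf.not_isBounded_Ici _⟩
  have hBc : IsClosed ((Metric.ball (f s₀) ε)ᶜ ∪ E) := Metric.isOpen_ball.isClosed_compl.union hEc
  obtain ⟨δ, hδ, hδB⟩ := Metric.isOpen_iff.1 hBc.isOpen_compl (f s₀) (by simp [hε, hxE])
  refine ⟨δ, hδ, fun x hx y hy => ?_⟩
  have hFc : IsClosed F := h.isClosed
  have n1 : NullLog F (fun z => (z - x) / (z - y)) :=
    nullLog_of_isPreconnected hFc isPreconnected_connectedComponentIn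
      (disjoint_left.2 fun z hz => connectedComponentIn_subset _ _ hz) hx.1 hy.1
  have n2 : NullLog ((Metric.ball (f s₀) ε)ᶜ ∪ E) (fun z => (z - x) / (z - y)) :=
    nullLog_of_isPreconnected hBc (convex_ball (f s₀) δ).isPreconnected
      (disjoint_left.2 fun z hz => hδB hz) hx.2 hy.2
  have h_inter : F ∩ ((Metric.ball (f s₀) ε)ᶜ ∪ E) = E := by
    ext z
    constructor
    · rintro ⟨h1, h2 | h2⟩
      · exact hFE ⟨h1, h2⟩
      · exact h2
    · exact fun hz => ⟨hEF hz, Or.inr hz⟩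
  have n3 := NullLog.union hFc hBc n1 n2 (by rw [h_inter]; exact hEinf)
  have hxn : ∀ x ∈ connectedComponentIn Fᶜ p ∩ Metric.ball (f s₀) δ,
      x ∉ F ∪ ((Metric.ball (f s₀) ε)ᶜ ∪ E) := fun x hx hx' =>
    hx'.elim (connectedComponentIn_subset _ _ hx.1) (hδB hx.2)
  have n4 := mem_connectedComponentIn_of_nullLog (hFc.union hBc) (hxn x hx) (hxn y hy) n3
  refine ⟨_, ?_, isPreconnected_connectedComponentIn, _root_.mem_connectedComponentIn (hxn x hx), n4⟩
  intro z hz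
  have hsubF := connectedComponentIn_subset (F ∪ ((Metric.ball (f s₀) ε)ᶜ ∪ E))ᶜ x
  refine ⟨?_, ?_⟩
  · rw [connectedComponentIn_eq hx.1]
    exact isPreconnected_connectedComponentIn.subset_connectedComponentIn
      (_root_.mem_connectedComponentIn (hxn x hx)) (fun w hw hw' => hsubF hw (Or.inl hw')) hz
  · by_contra hzb
    exact hsubF hz (Or.inr (Or.inl hzb))

theorem nullLog_range {f : ℝ → ℂ} (hf : IsLineMap f) {Λ : ℝ → ℂ} (hΛ : Continuous Λ)
    (h0 : Tendsto Λ (cocompact ℝ) (𝓝 0)) {g : ℂ → ℂ} (hg : ∀ s, Complex.exp (Λ s) = g (f s)) :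
    NullLog (range f) g := by
  have hce : IsClosedEmbedding f := .of_continuous_injective_isClosedMap hf.continuous hf.injective
    hf.isClosedMap
  have hinv : ∀ s, Function.invFun f (f s) = s := Function.leftInverse_invFun hf.injective
  refine ⟨Λ ∘ Function.invFun f, ?_, ?_, h0.comp ?_⟩
  · refine hΛ.comp_continuousOn ?_
    rintro _ ⟨s, rfl⟩
    have : Tendsto (Function.invFun f) (map f (𝓝 s)) (𝓝 s) := by
      rw [tendsto_map'_iff]
      exact tendsto_id.congr fun t => (hinv t).symm
    rw [ContinuousWithinAt, hinv, ← hce.isEmbedding.map_nhds_eq]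
    exact this
  · rintro _ ⟨s, rfl⟩
    simp [hinv, hg]
  · intro K hK
    obtain ⟨K', hK', hKK⟩ := mem_cocompact.1 hK
    rw [mem_map, mem_inf_principal]
    filter_upwards [(hK'.image hf.continuous).compl_mem_cocompact]
    rintro _ hz ⟨s, rfl⟩
    rw [mem_preimage, hinv]
    exact hKK fun hs => hz ⟨s, hs, rfl⟩

theorem eq_zero_of_exp_eq_one {e : ℂ} (h : Complex.exp e = 1) (hn : ‖e‖ < 6) : e = 0 := by
  obtain ⟨n, rfl⟩ := Complex.exp_eq_one_iff.1 h
  by_cases hz : n = 0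
  · simp [hz]
  · exfalso
    have h1 : (1 : ℝ) ≤ |(n : ℝ)| := by exact_mod_cast Int.one_le_abs hz
    have : ‖(n : ℂ) * (2 * Real.pi * Complex.I)‖ = |(n : ℝ)| * (2 * Real.pi) := by
      simp [abs_of_pos Real.pi_pos]
    rw [this] at hn
    nlinarith [Real.pi_gt_three]

theorem exists_tendsto_log_atTop {f : ℝ → ℂ} (hf : Continuous f)
    (hl : Tendsto f atTop (cocompact ℂ)) {p q : ℂ} (hp : p ∉ range f) (hq : q ∉ range f)
    {Λ : ℝ → ℂ} (hΛ : Continuous Λ) (he : ∀ s, Complex.exp (Λ s) = (f s - p) / (f s - q)) :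
    ∃ c : ℂ, Tendsto Λ atTop (𝓝 c) ∧ Complex.exp c = 1 := by
  have h1 : Tendsto (fun s => (f s - p) / (f s - q)) atTop (𝓝 1) := (tendsto_sub_div_sub p q).comp hl
  obtain ⟨S, hS⟩ := eventually_atTop.1 (h1 (Metric.ball_mem_nhds 1 one_pos))
  have hsl : ∀ s ∈ Ici S, (f s - p) / (f s - q) ∈ Complex.slitPlane := fun s hs =>
    Or.inl (re_pos_of_norm_sub_one_lt (by simpa [dist_eq_norm] using hS s hs))
  have hne : ∀ s, f s - p ≠ 0 ∧ f s - q ≠ 0 := fun s =>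
    ⟨sub_ne_zero.2 fun e => hp ⟨s, e⟩, sub_ne_zero.2 fun e => hq ⟨s, e⟩⟩
  have hcl : ContinuousOn (fun s => Complex.log ((f s - p) / (f s - q))) (Ici S) :=
    ContinuousOn.clog (Continuous.continuousOn ((hf.sub continuous_const).div
      (hf.sub continuous_const) fun s => (hne s).2)) hsl
  have hel : ∀ s, Complex.exp (Complex.log ((f s - p) / (f s - q))) = (f s - p) / (f s - q) :=
    fun s => Complex.exp_log (div_ne_zero (hne s).1 (hne s).2)
  have key : ∀ s ∈ Ici S, _ := fun s hs => sub_eq_sub_of_exp_eq (isPreconnected_Ici (a := S))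
    hΛ.continuousOn hcl (fun t _ => by rw [he, hel]) hs self_mem_Ici
  refine ⟨Λ S - Complex.log ((f S - p) / (f S - q)), ?_, ?_⟩
  · have := (tendsto_log_one.comp h1).add_const (Λ S - Complex.log ((f S - p) / (f S - q)))
    rw [zero_add] at this
    refine this.congr' ?_
    filter_upwards [Ici_mem_atTop S] with s hs
    rw [← key s hs]
    simp
  · rw [Complex.exp_sub, he, hel, div_self (div_ne_zero (hne S).1 (hne S).2)]

/-- A logarithm of `(z - p) / (z - q)` along a line, together with its total variation. -/
theorem IsLineMap.exists_log {f : ℝ → ℂ} (hf : IsLineMap f) {p q : ℂ} (hp : p ∉ range f)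
    (hq : q ∉ range f) : ∃ (Λ : ℝ → ℂ) (n : ℤ), Continuous Λ ∧
      (∀ s, Complex.exp (Λ s) = (f s - p) / (f s - q)) ∧ Tendsto Λ atTop (𝓝 0) ∧
      Tendsto Λ atBot (𝓝 (n * (2 * Real.pi * Complex.I))) := by
  have hne : ∀ s, f s - p ≠ 0 ∧ f s - q ≠ 0 := fun s =>
    ⟨sub_ne_zero.2 fun e => hp ⟨s, e⟩, sub_ne_zero.2 fun e => hq ⟨s, e⟩⟩
  obtain ⟨Λ, hΛ, he⟩ := exists_continuous_log (f := fun s => (f s - p) / (f s - q))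
    ((hf.continuous.sub continuous_const).div (hf.continuous.sub continuous_const)
      fun s => (hne s).2) (fun s => div_ne_zero (hne s).1 (hne s).2)
  have ht := hf.tendsto
  rw [cocompact_eq_atBot_atTop, tendsto_sup] at ht
  obtain ⟨c, hc, hc1⟩ := exists_tendsto_log_atTop hf.continuous ht.2 hp hq hΛ he
  have hneg : range (f ∘ Neg.neg) = range f := neg_surjective.range_comp f
  obtain ⟨d, hd, hd1⟩ := exists_tendsto_log_atTop (f := f ∘ Neg.neg) (Λ := Λ ∘ Neg.neg)
    (hf.continuous.comp continuous_neg)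
    (ht.1.comp tendsto_neg_atTop_atBot) (hneg ▸ hp) (hneg ▸ hq) (hΛ.comp continuous_neg)
    (fun s => he (-s))
  obtain ⟨n, hn⟩ := Complex.exp_eq_one_iff.1
    (show Complex.exp (d - c) = 1 by rw [Complex.exp_sub, hc1, hd1, div_one])
  refine ⟨fun s => Λ s - c, n, hΛ.sub continuous_const, fun s => ?_, ?_, ?_⟩
  · rw [Complex.exp_sub, he, hc1, div_one]
  · simpa using hc.sub_const c
  · rw [← hn]
    have := (hd.comp tendsto_neg_atBot_atTop).sub_const c
    refine this.congr fun s => ?_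
    simp

theorem IsLineMap.connectedComponentIn_trichotomy {f : ℝ → ℂ} (hf : IsLineMap f) {p₁ p₂ p₃ : ℂ}
    (h₁ : p₁ ∉ range f) (h₂ : p₂ ∉ range f) (h₃ : p₃ ∉ range f) :
    p₂ ∈ connectedComponentIn (range f)ᶜ p₁ ∨ p₁ ∈ connectedComponentIn (range f)ᶜ p₃ ∨
      p₂ ∈ connectedComponentIn (range f)ᶜ p₃ := by
  by_contra! hcon
  obtain ⟨c12, c31, c32⟩ := hcon
  have hcl : IsClosed (range f) := hf.isClosedMap.isClosed_range
  obtain ⟨Λ, n, hΛ, he, ht, hb⟩ := hf.exists_log h₁ h₂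
  obtain ⟨Λ', n', hΛ', he', ht', hb'⟩ := hf.exists_log h₃ h₁
  have hn : n = 0 := by
    have hfr := frontier_connectedComponentIn_subset hcl (p := p₃)
    have hz1 : ∀ z ∈ closure (connectedComponentIn (range f)ᶜ p₃), z - p₁ ≠ 0 := fun z hz e =>
      notMem_closure_of_isPreconnected hfr c31 h₁ (sub_eq_zero.1 e ▸ hz)
    have hz2 : ∀ z ∈ closure (connectedComponentIn (range f)ᶜ p₃), z - p₂ ≠ 0 := fun z hz e =>
      notMem_closure_of_isPreconnected hfr c32 h₂ (sub_eq_zero.1 e ▸ hz)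
    refine exponent_eq_zero_of_nullLog (g := fun z => (z - p₁) ^ (n + n') * (z - p₂) ^ (-n')) hcl
      hcl.isOpen_compl.connectedComponentIn hfr (mem_connectedComponentIn h₃) ?_ ?_ ?_ ?_
    · exact (ContinuousOn.zpow₀ (by fun_prop) _ fun z hz => Or.inl (hz1 z hz)).mul
        (ContinuousOn.zpow₀ (by fun_prop) _ fun z hz => Or.inl (hz2 z hz))
    · exact fun z hz => mul_ne_zero (zpow_ne_zero _ (hz1 z hz)) (zpow_ne_zero _ (hz2 z hz))
    · have := ((tendsto_sub_div_sub p₁ 0).zpow₀ (n + n') (Or.inl one_ne_zero)).mul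
        ((tendsto_sub_div_sub p₂ 0).zpow₀ (-n') (Or.inl one_ne_zero))
      simp only [one_zpow, mul_one] at this
      refine this.congr' ?_
      filter_upwards [(isCompact_singleton (x := (0 : ℂ))).compl_mem_cocompact] with z hz
      have hz : z ≠ 0 := hz
      have e : n = (n + n') + (-n') := by ring
      rw [sub_zero, div_zpow, div_zpow, div_mul_div_comm, ← zpow_add₀ hz, ← e]
    · refine nullLog_range hf (Λ := fun s => n * Λ' s - n' * Λ s) (by fun_prop) ?_ fun s => ?_
      · rw [cocompact_eq_atBot_atTop, tendsto_sup]
        refine ⟨?_, by simpa using (ht'.const_mul (n : ℂ)).sub (ht.const_mul (n' : ℂ))⟩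
        have := (hb'.const_mul (n : ℂ)).sub (hb.const_mul (n' : ℂ))
        rwa [show (n : ℂ) * (n' * (2 * Real.pi * Complex.I)) -
          n' * (n * (2 * Real.pi * Complex.I)) = 0 by ring] at this
      · have e1 : f s - p₁ ≠ 0 := sub_ne_zero.2 fun e => h₁ ⟨s, e⟩
        have e2 : f s - p₂ ≠ 0 := sub_ne_zero.2 fun e => h₂ ⟨s, e⟩
        have e3 : f s - p₃ ≠ 0 := sub_ne_zero.2 fun e => h₃ ⟨s, e⟩
        rw [Complex.exp_sub, Complex.exp_int_mul, Complex.exp_int_mul, he, he', div_zpow, div_zpow,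
          zpow_add₀ e1, zpow_neg]
        field_simp
  refine c12 (mem_connectedComponentIn_of_nullLog hcl h₁ h₂
    (nullLog_range hf hΛ ?_ he))
  rw [cocompact_eq_atBot_atTop, tendsto_sup]
  exact ⟨by simpa [hn] using hb, ht⟩

theorem IsLine.finite_components {L : Set ℂ} (hL : IsLine L) :
    ((fun p => connectedComponentIn Lᶜ p) '' Lᶜ).Finite := by
  obtain ⟨f, hf, rfl⟩ := hL
  by_cases h : ∃ p₁ ∉ range f, ∃ p₂ ∉ range f, p₂ ∉ connectedComponentIn (range f)ᶜ p₁
  · obtain ⟨p₁, h₁, p₂, h₂, h12⟩ := h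
    refine Set.Finite.subset (s := {connectedComponentIn (range f)ᶜ p₁,
      connectedComponentIn (range f)ᶜ p₂}) (by simp) ?_
    rintro _ ⟨p, hp, rfl⟩
    rcases hf.connectedComponentIn_trichotomy h₁ h₂ hp with h | h | h
    · exact absurd h h12
    · exact Or.inl (connectedComponentIn_eq h)
    · exact Or.inr (connectedComponentIn_eq h)
  · push Not at h
    refine Set.Subsingleton.finite ?_
    rintro _ ⟨p, hp, rfl⟩ _ ⟨q, hq, rfl⟩
    exact connectedComponentIn_eq (h p hp q hq)

theorem IsLineFamily.finite_components {𝓛 : Set (Set ℂ)} (h : IsLineFamily 𝓛) :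
    ((fun p => connectedComponentIn (⋃₀ 𝓛)ᶜ p) '' (⋃₀ 𝓛)ᶜ).Finite := by
  have : Finite 𝓛 := h.finite
  let φ : ℂ → 𝓛 → Set ℂ := fun p L => connectedComponentIn (L : Set ℂ)ᶜ p
  have hnot : ∀ p ∈ (⋃₀ 𝓛)ᶜ, ∀ L ∈ 𝓛, p ∈ Lᶜ := fun p hp L hL hpL => hp ⟨L, hL, hpL⟩
  have hφ : (φ '' (⋃₀ 𝓛)ᶜ).Finite := by
    refine (Set.Finite.pi' fun L : 𝓛 => (h.isLine L L.2).finite_components).subset ?_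
    rintro _ ⟨p, hp, rfl⟩ L
    exact ⟨p, hnot p hp L L.2, rfl⟩
  refine (hφ.image fun t => connectedComponentIn (⋃₀ 𝓛)ᶜ
    (Function.invFunOn φ (⋃₀ 𝓛)ᶜ t)).subset ?_
  rintro _ ⟨p, hp, rfl⟩
  refine ⟨φ p, ⟨p, hp, rfl⟩, ?_⟩
  have hm := Function.invFunOn_mem (f := φ) ⟨p, hp, rfl⟩
  have he := Function.invFunOn_eq (f := φ) ⟨p, hp, rfl⟩
  refine (connectedComponentIn_eq (h.mem_connectedComponentIn hp hm fun L hL => ?_)).symm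
  have e := congrFun he ⟨L, hL⟩
  simp only [φ] at e
  rw [← e]
  exact _root_.mem_connectedComponentIn (hnot _ hm L hL)

theorem IsLineFamily.connectedToInfinity_compl {𝓛 : Set (Set ℂ)} (h : IsLineFamily 𝓛)
    (hne : 𝓛.Nonempty) (p : ℂ) : ConnectedToInfinity (connectedComponentIn (⋃₀ 𝓛)ᶜ p)ᶜ := by
  set U := connectedComponentIn (⋃₀ 𝓛)ᶜ p
  have hUF : ∀ L ∈ 𝓛, L ⊆ Uᶜ := fun L hL z hz hzU =>
    connectedComponentIn_subset _ _ hzU ⟨L, hL, hz⟩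
  intro z hz
  by_cases hzF : z ∈ ⋃₀ 𝓛
  · obtain ⟨L, hL, hzL⟩ := hzF
    exact ⟨L, hUF L hL, hzL, (h.isLine L hL).isPreconnected, (h.isLine L hL).not_isBounded⟩
  · have hWo : IsOpen (connectedComponentIn (⋃₀ 𝓛)ᶜ z) :=
      h.isClosed.isOpen_compl.connectedComponentIn
    have hzW : z ∈ connectedComponentIn (⋃₀ 𝓛)ᶜ z := _root_.mem_connectedComponentIn hzF
    obtain ⟨L₀, hL₀⟩ := hne
    obtain ⟨f, hf, hfL⟩ := h.isLine L₀ hL₀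
    have hfrne : (frontier (connectedComponentIn (⋃₀ 𝓛)ᶜ z)).Nonempty :=
      nonempty_frontier_iff.2 ⟨⟨z, hzW⟩, fun e => by
        have : f 0 ∈ connectedComponentIn (⋃₀ 𝓛)ᶜ z := e ▸ mem_univ _
        exact connectedComponentIn_subset _ _ this ⟨L₀, hL₀, hfL ▸ mem_range_self 0⟩⟩
    obtain ⟨x, hx⟩ := hfrne
    obtain ⟨L, hL, hxL⟩ := frontier_connectedComponentIn_subset h.isClosed hx
    refine ⟨closure (connectedComponentIn (⋃₀ 𝓛)ᶜ z) ∪ L, union_subset ?_ (hUF L hL),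
      Or.inl (subset_closure hzW), ?_, fun hb => (h.isLine L hL).not_isBounded
        (hb.subset subset_union_right)⟩
    · refine closure_minimal ?_ h.isClosed.isOpen_compl.connectedComponentIn.isClosed_compl
      intro w hw hwU
      have := connectedComponentIn_eq hw
      rw [← connectedComponentIn_eq hwU] at this
      exact hz (show z ∈ connectedComponentIn (⋃₀ 𝓛)ᶜ p from this ▸ hzW)
    · exact isPreconnected_connectedComponentIn.closure.union x (frontier_subset_closure hx) hxL
        (h.isLine L hL).isPreconnected

end LineAlexander

namespace LineAlexander
open Set Filter Topology

/-- `k` is isotopic to the identity relative to `O`. -/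
def IsoRel (k : ℂ → ℂ) (O : Set ℂ) : Prop :=
  ∃ H : ℝ × ℂ → ℂ, Continuous H ∧ (∀ t ∈ Icc (0 : ℝ) 1, ∃ e : ℂ ≃ₜ ℂ, ∀ x, e x = H (t, x)) ∧
    (∀ x, H (0, x) = x) ∧ (∀ x, H (1, x) = k x) ∧ ∀ t ∈ Icc (0 : ℝ) 1, ∀ x ∈ O, H (t, x) = x

/-- A continuous logarithm of the slopes of `k`. -/
def HasPairLog (k : ℂ → ℂ) : Prop :=
  ∃ l : ℂ × ℂ → ℂ, ContinuousOn l {p | p.1 ≠ p.2} ∧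
    ∀ z w, z ≠ w → Complex.exp (l (z, w)) = (k z - k w) / (z - w)

theorem IsoRel.hasPairLog {k : ℂ → ℂ} {O : Set ℂ} (h : IsoRel k O) : HasPairLog k := by
  classical
  obtain ⟨H, hH, he, h0, h1, -⟩ := h
  let A := {p : ℂ × ℂ | p.1 ≠ p.2}
  have hinj : ∀ t ∈ Icc (0 : ℝ) 1, ∀ z w, z ≠ w → H (t, z) - H (t, w) ≠ 0 := by
    intro t ht z w hzw e
    obtain ⟨e', he'⟩ := he t ht
    rw [← he', ← he', sub_eq_zero] at e
    exact hzw (e'.injective e)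
  let Q : C(unitInterval × A, {z : ℂ // z ≠ 0}) :=
    { toFun := fun x => ⟨(H (x.1, x.2.1.1) - H (x.1, x.2.1.2)) / (x.2.1.1 - x.2.1.2),
        div_ne_zero (hinj _ x.1.2 _ _ x.2.2) (sub_ne_zero.2 x.2.2)⟩
      continuous_toFun := by
        refine Continuous.subtype_mk (Continuous.div ?_ ?_ fun x => sub_ne_zero.2 x.2.2) _
        · exact (hH.comp (by fun_prop)).sub (hH.comp (by fun_prop))
        · fun_prop }
  have hQ0 : ∀ a : A, Q (0, a) = ⟨Complex.exp ((0 : C(A, ℂ)) a), Complex.exp_ne_zero _⟩ := by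
    intro a
    apply Subtype.ext
    simp [Q, h0, div_self (sub_ne_zero.2 a.2)]
  let G := Complex.isCoveringMap_exp.liftHomotopy Q 0 hQ0
  have hG : ∀ t a, Complex.exp (G (t, a)) = (Q (t, a) : ℂ) := fun t a =>
    congrArg Subtype.val (congrFun (Complex.isCoveringMap_exp.liftHomotopy_lifts Q 0 hQ0) (t, a))
  refine ⟨fun p => if hp : p ∈ A then G (1, ⟨p, hp⟩) else 0, ?_, ?_⟩
  · rw [continuousOn_iff_continuous_domRestrict]
    have : Continuous fun a : A => G (1, a) := by fun_prop
    refine this.congr fun a => ?_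
    simp [Set.domRestrict]
  · intro z w hzw
    have : (z, w) ∈ A := hzw
    simp only [dif_pos this, hG]
    simp [Q, h1]

theorem HasPairLog.comp_symm {h h' : ℂ ≃ₜ ℂ} (hl : HasPairLog h) (hl' : HasPairLog h') :
    HasPairLog (h' ∘ h.symm) := by
  obtain ⟨l, hc, he⟩ := hl
  obtain ⟨l', hc', he'⟩ := hl'
  have hm : MapsTo (fun p : ℂ × ℂ => (h.symm p.1, h.symm p.2)) {p | p.1 ≠ p.2} {p | p.1 ≠ p.2} :=
    fun p hp e => hp (h.symm.injective e)
  have hcont : Continuous (fun p : ℂ × ℂ => (h.symm p.1, h.symm p.2)) := by fun_prop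
  refine ⟨fun p => l' (h.symm p.1, h.symm p.2) - l (h.symm p.1, h.symm p.2),
    (hc'.comp hcont.continuousOn hm).sub (hc.comp hcont.continuousOn hm), fun z w hzw => ?_⟩
  have hne : h.symm z ≠ h.symm w := fun e => hzw (h.symm.injective e)
  rw [Complex.exp_sub, he _ _ hne, he' _ _ hne, h.apply_symm_apply, h.apply_symm_apply]
  have e1 := sub_ne_zero.2 hne
  have e2 := sub_ne_zero.2 hzw
  simp only [Function.comp]
  field_simp

theorem isPreconnected_offDiag : IsPreconnected {p : ℂ × ℂ | p.1 ≠ p.2} := by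
  have h : IsPreconnected ((univ : Set ℂ) ×ˢ ({0}ᶜ : Set ℂ)) :=
    isPreconnected_univ.prod (isConnected_compl_singleton_of_one_lt_rank (by simp) 0).isPreconnected
  have := h.image (fun p : ℂ × ℂ => (p.1 + p.2, p.1)) (by fun_prop)
  convert this
  ext ⟨z, w⟩
  constructor
  · intro hzw
    exact ⟨(w, z - w), ⟨mem_univ _, sub_ne_zero.2 hzw⟩, by simp⟩
  · rintro ⟨⟨a, b⟩, ⟨-, hb⟩, e⟩
    simp at e hb
    rw [← e.1, ← e.2]
    simpa using hb

/-- The logarithm of slopes can be normalized to vanish on a line of fixed points. -/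
theorem HasPairLog.exists_eq_zero {k : ℂ → ℂ} (hk : HasPairLog k) {f : ℝ → ℂ} (hf : IsLineMap f)
    (hkf : ∀ s, k (f s) = f s) : ∃ l : ℂ × ℂ → ℂ, ContinuousOn l {p | p.1 ≠ p.2} ∧
    (∀ z w, z ≠ w → Complex.exp (l (z, w)) = (k z - k w) / (z - w)) ∧
    ∀ s t, s ≠ t → l (f s, f t) = 0 := by
  obtain ⟨l, hc, he⟩ := hk
  have hsw : ContinuousOn (l ∘ Prod.swap) {p : ℂ × ℂ | p.1 ≠ p.2} :=
    hc.comp continuous_swap.continuousOn fun p hp => Ne.symm hp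
  have hsymm : ∀ z w, z ≠ w → l (z, w) = l (w, z) := by
    intro z w hzw
    have := sub_eq_sub_of_exp_eq isPreconnected_offDiag hc hsw (fun p hp => by
      have e := he p.1 p.2 hp
      have e' := he p.2 p.1 (Ne.symm hp)
      have h1 : p.1 - p.2 ≠ 0 := sub_ne_zero.2 hp
      have h2 : p.2 - p.1 ≠ 0 := sub_ne_zero.2 (Ne.symm hp)
      simp only [Prod.mk.eta] at e
      simp only [Function.comp, Prod.swap]
      rw [e, e', div_eq_div_iff h1 h2]
      ring) (x := (z, w)) (y := (w, z)) hzw hzw.symm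
    simp only [Function.comp, Prod.swap] at this
    linear_combination this / 2
  have hne : ∀ s t, s ≠ t → f s ≠ f t := fun s t hst e => hst (hf.injective e)
  have h1 : ∀ s t, s ≠ t → Complex.exp (l (f s, f t)) = 1 := fun s t hst => by
    rw [he _ _ (hne s t hst), hkf, hkf, div_self (sub_ne_zero.2 (hne s t hst))]
  have hlt : ∀ s t, s < t → l (f s, f t) = l (f 0, f 1) := by
    intro s t hst
    have hpc : IsPreconnected {p : ℝ × ℝ | p.1 < p.2} := by
      refine Convex.isPreconnected ?_
      have : {p : ℝ × ℝ | p.1 < p.2} = {p | (LinearMap.fst ℝ ℝ ℝ - LinearMap.snd ℝ ℝ ℝ) p < 0} := by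
        ext p; simp
      rw [this]
      exact convex_halfSpace_lt (LinearMap.isLinear _) 0
    have := sub_eq_sub_of_exp_eq hpc (l₁ := fun p => l (f p.1, f p.2)) (l₂ := fun _ => 0)
      (hc.comp (Continuous.continuousOn (by have := hf.continuous; fun_prop))
        fun p hp => hne _ _ (ne_of_lt hp)) continuousOn_const
      (fun p hp => by rw [h1 _ _ (ne_of_lt hp), Complex.exp_zero])
      (x := (s, t)) (y := (0, 1)) hst (by simp)
    simpa using this
  refine ⟨fun p => l p - l (f 0, f 1), hc.sub continuousOn_const, fun z w hzw => ?_,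
    fun s t hst => ?_⟩
  · rw [Complex.exp_sub, h1 _ _ zero_ne_one, div_one, he z w hzw]
  · rcases lt_or_gt_of_ne hst with h | h
    · dsimp only
      rw [hlt s t h, sub_self]
    · dsimp only
      rw [hsymm _ _ (hne s t hst), hlt t s h, sub_self]

theorem HasPairLog.mem_connectedComponentIn {k : ℂ ≃ₜ ℂ} (hk : HasPairLog k) {f : ℝ → ℂ}
    (hf : IsLineMap f) (hkf : ∀ s, k (f s) = f s) {p : ℂ} (hp : p ∉ range f) :
    k p ∈ connectedComponentIn (range f)ᶜ p := by
  obtain ⟨l, hc, he, hl0⟩ := hk.exists_eq_zero hf hkf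
  have hcl : IsClosed (range f) := hf.isClosedMap.isClosed_range
  set U := connectedComponentIn (range f)ᶜ p with hU
  have hUo : IsOpen U := hcl.isOpen_compl.connectedComponentIn
  have hpU : p ∈ U := _root_.mem_connectedComponentIn hp
  have hUs : U ⊆ (range f)ᶜ := connectedComponentIn_subset _ _
  have hkc : ∀ z ∉ range f, k z ∉ range f := by
    rintro z hz ⟨s, hs⟩
    rw [← hkf s] at hs
    exact hz ⟨s, k.injective hs⟩
  suffices h : ∃ p' ∈ U, k p' ∈ U by
    obtain ⟨p', h1, h2⟩ := h
    have : k '' U ⊆ U := by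
      have e : U = connectedComponentIn (range f)ᶜ (k p') := connectedComponentIn_eq h2
      conv_rhs => rw [e]
      refine (isPreconnected_connectedComponentIn.image _ k.continuous.continuousOn)
        |>.subset_connectedComponentIn ⟨p', h1, rfl⟩ ?_
      rintro _ ⟨z, hz, rfl⟩
      exact hkc z (hUs hz)
    exact this ⟨p, hpU, rfl⟩
  obtain ⟨x, hx⟩ : (frontier U).Nonempty := nonempty_frontier_iff.2 ⟨⟨p, hpU⟩, fun e =>
    hUs (e ▸ mem_univ (f 0) : f 0 ∈ U) (mem_range_self 0)⟩
  obtain ⟨s₀, rfl⟩ := frontier_connectedComponentIn_subset hcl hx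
  set E := f '' (Iic (s₀ - 1) ∪ Ici (s₀ + 1)) with hE
  have hEc : IsClosed E := hf.isClosedMap _ (isClosed_Iic.union isClosed_Ici)
  have hxE : f s₀ ∉ E := by
    rintro ⟨s, hs | hs, e⟩ <;> have := hf.injective e <;> simp at hs <;> linarith
  obtain ⟨d, hd, hdE⟩ := Metric.isOpen_iff.1 hEc.isOpen_compl (f s₀) hxE
  have ev1 : ∀ᶠ z in 𝓝 (f s₀), ‖z - f s₀‖ < d / 4 := by
    filter_upwards [Metric.ball_mem_nhds (f s₀) (by positivity : 0 < d / 4)] with z hz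
    simpa [dist_eq_norm] using hz
  have evk : Tendsto k (𝓝 (f s₀)) (𝓝 (f s₀)) := by
    have := k.continuous.tendsto (f s₀)
    rwa [hkf] at this
  have hop : IsOpen {p : ℂ × ℂ | p.1 ≠ p.2} := isOpen_ne_fun continuous_fst continuous_snd
  have ev2 : ∀ s, s ≠ s₀ → ∀ᶠ z in 𝓝 (f s₀),
      ‖l (f s, z) - Complex.log ((f s - k z) / (f s - z))‖ < 6 := by
    intro s hs
    have hne : f s ≠ f s₀ := fun e => hs (hf.injective e)
    have hc1 : Tendsto (fun z => l (f s, z)) (𝓝 (f s₀)) (𝓝 0) := by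
      rw [← hl0 s s₀ hs]
      have : ContinuousAt l (f s, f s₀) := hc.continuousAt (hop.mem_nhds hne)
      exact this.tendsto.comp (Continuous.tendsto (by fun_prop) (f s₀))
    have hc2 : Tendsto (fun z => (f s - k z) / (f s - z)) (𝓝 (f s₀)) (𝓝 1) := by
      have h3 : Tendsto (fun z => (f s - k z) / (f s - z)) (𝓝 (f s₀))
        (𝓝 ((f s - f s₀) / (f s - f s₀))) :=
        (evk.const_sub _).div (tendsto_id.const_sub _) (sub_ne_zero.2 hne)
      rwa [div_self (sub_ne_zero.2 hne)] at h3
    have hc3 := hc1.sub (tendsto_log_one.comp hc2)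
    rw [sub_zero] at hc3
    filter_upwards [hc3 (Metric.ball_mem_nhds 0 (by norm_num : (0 : ℝ) < 6))] with z hz
    simpa using hz
  obtain ⟨p', hp'U, h1, h2, h3, h4⟩ := ((mem_closure_iff_frequently.1
    (frontier_subset_closure hx)).and_eventually (ev1.and ((evk.eventually ev1).and
      ((ev2 (s₀ + 1) (by simp)).and (ev2 (s₀ - 1) (by simp)))))).exists
  refine ⟨p', hp'U, ?_⟩
  have hp'f := hUs hp'U
  have hkp'f := hkc p' hp'f
  have hnep : ∀ s, f s ≠ p' := fun s e => hp'f ⟨s, e⟩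
  have hnek : ∀ s, f s ≠ k p' := fun s e => hkp'f ⟨s, e⟩
  have hel : ∀ s, Complex.exp (l (f s, p')) = (f s - k p') / (f s - p') := fun s => by
    rw [he _ _ (hnep s), hkf]
  have hlcont : Continuous fun s => l (f s, p') :=
    continuousOn_univ.1 (hc.comp (Continuous.continuousOn (by have := hf.continuous; fun_prop))
      fun s _ => hnep s)
  have hsl : ∀ s ∈ Iic (s₀ - 1) ∪ Ici (s₀ + 1),
      (f s - k p') / (f s - p') ∈ Complex.slitPlane := by
    intro s hs
    refine Or.inl (re_pos_of_norm_sub_one_lt ?_)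
    have hds : d ≤ ‖f s - f s₀‖ := by
      by_contra hlt
      exact hdE (by simpa [dist_eq_norm] using hlt) ⟨s, hs, rfl⟩
    have t1 : ‖f s - f s₀‖ ≤ ‖f s - p'‖ + ‖p' - f s₀‖ := norm_sub_le_norm_sub_add_norm_sub ..
    have t2 : ‖p' - k p'‖ ≤ ‖p' - f s₀‖ + ‖k p' - f s₀‖ := by
      have := norm_sub_le_norm_sub_add_norm_sub p' (f s₀) (k p')
      rwa [norm_sub_rev (f s₀)] at this
    have hn := sub_ne_zero.2 (hnep s)
    have e : (f s - k p') / (f s - p') - 1 = (p' - k p') / (f s - p') := by field_simp; ring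
    rw [e, norm_div, div_lt_one (norm_pos_iff.2 hn)]
    linarith
  have hlc : ContinuousOn (fun s => Complex.log ((f s - k p') / (f s - p')))
      (Iic (s₀ - 1) ∪ Ici (s₀ + 1)) :=
    ContinuousOn.clog (Continuous.continuousOn ((hf.continuous.sub continuous_const).div
      (hf.continuous.sub continuous_const) fun s => sub_ne_zero.2 (hnep s))) hsl
  have hee : ∀ s, Complex.exp (l (f s, p')) =
      Complex.exp (Complex.log ((f s - k p') / (f s - p'))) := fun s => by
    rw [hel, Complex.exp_log (div_ne_zero (sub_ne_zero.2 (hnek s)) (sub_ne_zero.2 (hnep s)))]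
  have hzero : ∀ s, ‖l (f s, p') - Complex.log ((f s - k p') / (f s - p'))‖ < 6 →
      l (f s, p') - Complex.log ((f s - k p') / (f s - p')) = 0 := fun s hs =>
    eq_zero_of_exp_eq_one (by rw [Complex.exp_sub, hee, div_self (Complex.exp_ne_zero _)]) hs
  have hEl : ∀ s ∈ Iic (s₀ - 1) ∪ Ici (s₀ + 1),
      l (f s, p') = Complex.log ((f s - k p') / (f s - p')) := by
    rintro s (hs | hs)
    · have := sub_eq_sub_of_exp_eq isPreconnected_Iic hlcont.continuousOn
        (hlc.mono subset_union_left) (fun t _ => hee t) hs self_mem_Iic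
      rw [hzero _ h4] at this
      exact sub_eq_zero.1 this
    · have := sub_eq_sub_of_exp_eq isPreconnected_Ici hlcont.continuousOn
        (hlc.mono subset_union_right) (fun t _ => hee t) hs self_mem_Ici
      rw [hzero _ h3] at this
      exact sub_eq_zero.1 this
  have hnull : NullLog (range f) (fun z => (z - k p') / (z - p')) := by
    refine ⟨fun z => l (z, p'), ?_, ?_, ?_⟩
    · refine hc.comp (by fun_prop) ?_
      rintro _ ⟨s, rfl⟩
      exact hnep s
    · rintro _ ⟨s, rfl⟩
      exact hel s
    · refine ((tendsto_log_one.comp (tendsto_sub_div_sub (k p') p')).mono_left inf_le_left).congr' ?_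
      refine eventually_inf_principal.2 ?_
      filter_upwards [((isCompact_Icc (a := s₀ - 1) (b := s₀ + 1)).image
        hf.continuous).compl_mem_cocompact]
      rintro _ hz ⟨s, rfl⟩
      refine (hEl s ?_).symm
      by_contra hs
      simp only [mem_union, mem_Iic, mem_Ici, not_or, not_le] at hs
      exact hz ⟨s, ⟨hs.1.le, hs.2.le⟩, rfl⟩
  have hmem := mem_connectedComponentIn_of_nullLog hcl hkp'f hp'f hnull
  rw [hU, connectedComponentIn_eq hp'U, ← connectedComponentIn_eq hmem]
  exact _root_.mem_connectedComponentIn hkp'f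

theorem IsLineFamily.map_mem_connectedComponentIn {𝓛 : Set (Set ℂ)} (h : IsLineFamily 𝓛)
    {k : ℂ ≃ₜ ℂ} (hk : HasPairLog k) (hkF : ∀ z ∈ ⋃₀ 𝓛, k z = z) {p : ℂ} (hp : p ∉ ⋃₀ 𝓛) :
    k p ∈ connectedComponentIn (⋃₀ 𝓛)ᶜ p := by
  refine h.mem_connectedComponentIn hp ?_ fun L hL => ?_
  · intro hkp
    have := hkF _ hkp
    exact hp (k.injective this ▸ hkp)
  · obtain ⟨f, hf, rfl⟩ := h.isLine L hL
    exact hk.mem_connectedComponentIn hf (fun s => hkF _ ⟨_, hL, mem_range_self s⟩)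
      fun hpL => hp ⟨_, hL, hpL⟩

end LineAlexander

namespace LineAlexander
open Set Filter Topology Polynomial

/-- `f` is a uniform limit of polynomials on `K`. -/
def PolyApprox (K : Set ℂ) (f : ℂ → ℂ) : Prop :=
  ∀ ε > 0, ∃ P : ℂ[X], ∀ z ∈ K, ‖f z - P.eval z‖ ≤ ε

namespace PolyApprox

variable {K : Set ℂ} {f g : ℂ → ℂ}

theorem polynomial (K : Set ℂ) (P : ℂ[X]) : PolyApprox K fun z => P.eval z :=
  fun ε hε => ⟨P, fun z _ => by simpa using hε.le⟩

theorem const (K : Set ℂ) (c : ℂ) : PolyApprox K fun _ => c := by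
  simpa using polynomial K (C c)

theorem congr (hf : PolyApprox K f) (h : ∀ z ∈ K, f z = g z) : PolyApprox K g := fun ε hε => by
  obtain ⟨P, hP⟩ := hf ε hε
  exact ⟨P, fun z hz => h z hz ▸ hP z hz⟩

theorem of_approx (h : ∀ ε > 0, ∃ g, PolyApprox K g ∧ ∀ z ∈ K, ‖f z - g z‖ ≤ ε) :
    PolyApprox K f := fun ε hε => by
  obtain ⟨g, hg, hfg⟩ := h (ε / 2) (by positivity)
  obtain ⟨P, hP⟩ := hg (ε / 2) (by positivity)
  refine ⟨P, fun z hz => ?_⟩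
  calc ‖f z - P.eval z‖ = ‖(f z - g z) + (g z - P.eval z)‖ := by ring_nf
    _ ≤ _ := norm_add_le _ _
    _ ≤ ε := by linarith [hP z hz, hfg z hz]

theorem add (hf : PolyApprox K f) (hg : PolyApprox K g) : PolyApprox K fun z => f z + g z :=
  fun ε hε => by
  obtain ⟨P, hP⟩ := hf (ε / 2) (by positivity)
  obtain ⟨Q, hQ⟩ := hg (ε / 2) (by positivity)
  refine ⟨P + Q, fun z hz => ?_⟩
  calc ‖f z + g z - (P + Q).eval z‖ = ‖(f z - P.eval z) + (g z - Q.eval z)‖ := by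
        rw [eval_add]; ring_nf
    _ ≤ _ := norm_add_le _ _
    _ ≤ ε := by linarith [hP z hz, hQ z hz]

theorem bounded (hK : IsCompact K) (hf : PolyApprox K f) : ∃ M > 0, ∀ z ∈ K, ‖f z‖ ≤ M := by
  obtain ⟨P, hP⟩ := hf 1 one_pos
  obtain ⟨C, hC⟩ := hK.exists_bound_of_continuousOn (P.continuous_aeval.continuousOn (s := K))
  refine ⟨|C| + 1, by positivity, fun z hz => ?_⟩
  have h1 := hP z hz
  have h2 : ‖P.eval z‖ ≤ C := by simpa using hC z hz
  calc ‖f z‖ = ‖(f z - P.eval z) + P.eval z‖ := by ring_nf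
    _ ≤ _ := norm_add_le _ _
    _ ≤ |C| + 1 := by linarith [le_abs_self C]

theorem mul (hK : IsCompact K) (hf : PolyApprox K f) (hg : PolyApprox K g) :
    PolyApprox K fun z => f z * g z := fun ε hε => by
  obtain ⟨M, hM0, hM⟩ := hf.bounded hK
  obtain ⟨N, hN0, hN⟩ := hg.bounded hK
  obtain ⟨Q, hQ⟩ := hg (min 1 (ε / (2 * M))) (by positivity)
  obtain ⟨P, hP⟩ := hf (ε / (2 * (N + 1))) (by positivity)
  refine ⟨P * Q, fun z hz => ?_⟩
  have h1 : ‖Q.eval z‖ ≤ N + 1 := by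
    calc ‖Q.eval z‖ = ‖g z - (g z - Q.eval z)‖ := by ring_nf
      _ ≤ _ := norm_sub_le _ _
      _ ≤ N + 1 := add_le_add (hN z hz) ((hQ z hz).trans (min_le_left _ _))
  have h2 := (hQ z hz).trans (min_le_right _ _)
  calc ‖f z * g z - (P * Q).eval z‖
      = ‖f z * (g z - Q.eval z) + (f z - P.eval z) * Q.eval z‖ := by rw [eval_mul]; ring_nf
    _ ≤ _ := norm_add_le _ _
    _ = ‖f z‖ * ‖g z - Q.eval z‖ + ‖f z - P.eval z‖ * ‖Q.eval z‖ := by simp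
    _ ≤ M * (ε / (2 * M)) + ε / (2 * (N + 1)) * (N + 1) := by
        gcongr
        · exact hM z hz
        · exact hP z hz
    _ = ε := by field_simp; ring

theorem const_mul (hK : IsCompact K) (c : ℂ) (hf : PolyApprox K f) :
    PolyApprox K fun z => c * f z := (const K c).mul hK hf

theorem neg (hK : IsCompact K) (hf : PolyApprox K f) : PolyApprox K fun z => -f z :=
  (hf.const_mul hK (-1)).congr fun z _ => by ring

theorem sub (hK : IsCompact K) (hf : PolyApprox K f) (hg : PolyApprox K g) :
    PolyApprox K fun z => f z - g z :=
  (hf.add (hg.neg hK)).congr fun z _ => by ring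

theorem pow (hK : IsCompact K) (hf : PolyApprox K f) (n : ℕ) : PolyApprox K fun z => f z ^ n := by
  induction n with
  | zero => simpa using const K 1
  | succ n ih => exact (ih.mul hK hf).congr fun z _ => (pow_succ _ _).symm

theorem sum (n : ℕ) (F : ℕ → ℂ → ℂ) (hF : ∀ i, PolyApprox K (F i)) :
    PolyApprox K fun z => ∑ i ∈ Finset.range n, F i z := by
  induction n with
  | zero => simpa using const K 0
  | succ n ih => exact (ih.add (hF n)).congr fun z _ => (Finset.sum_range_succ _ _).symm

theorem geometric (hK : IsCompact K) (hf : PolyApprox K f) {ρ : ℝ} (hρ : ρ < 1)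
    (h : ∀ z ∈ K, ‖f z‖ ≤ ρ) : PolyApprox K fun z => (1 - f z)⁻¹ := by
  rcases K.eq_empty_or_nonempty with rfl | ⟨z₀, hz₀⟩
  · exact fun ε _ => ⟨0, by simp⟩
  have hρ0 : 0 ≤ ρ := (norm_nonneg _).trans (h z₀ hz₀)
  refine of_approx fun ε hε => ?_
  have : Tendsto (fun n => ρ ^ n * (1 - ρ)⁻¹) atTop (𝓝 0) := by
    simpa using (tendsto_pow_atTop_nhds_zero_of_lt_one hρ0 hρ).mul_const ((1 - ρ)⁻¹)
  obtain ⟨n, hn⟩ := (this.eventually_le_const hε).exists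
  refine ⟨_, sum n _ fun i => hf.pow hK i, fun z hz => ?_⟩
  have hz1 : 1 - ρ ≤ ‖1 - f z‖ := by
    have := norm_sub_norm_le 1 (f z)
    rw [norm_one] at this
    linarith [h z hz]
  have hne : 1 - f z ≠ 0 := fun h0 => by rw [h0, norm_zero] at hz1; linarith
  have hne' : f z ≠ 1 := fun h0 => hne (by simp [h0])
  have : (1 - f z)⁻¹ - ∑ i ∈ Finset.range n, f z ^ i = f z ^ n * (1 - f z)⁻¹ := by
    have hs := geom_sum_mul (f z) n
    field_simp
    linear_combination hs
  rw [this, norm_mul, norm_pow, norm_inv]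
  refine le_trans ?_ hn
  have := h z hz
  gcongr

theorem exp (hK : IsCompact K) (hf : PolyApprox K f) : PolyApprox K fun z => Complex.exp (f z) := by
  obtain ⟨M, hM0, hM⟩ := hf.bounded hK
  refine of_approx fun ε hε => ?_
  have h1 : Tendsto (fun n : ℕ => M ^ n / n.factorial * 2) atTop (𝓝 0) := by
    simpa using (FloorSemiring.tendsto_pow_div_factorial_atTop M).mul_const 2
  obtain ⟨n, hn, hn'⟩ := ((h1.eventually_le_const hε).and
    (eventually_ge_atTop ⌈2 * M⌉₊)).exists
  refine ⟨fun z => ∑ m ∈ Finset.range n, f z ^ m / m.factorial, ?_, fun z hz => ?_⟩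
  · exact sum n (fun m z => f z ^ m / m.factorial) fun m =>
      ((hf.pow hK m).const_mul hK ((m.factorial : ℂ)⁻¹)).congr fun z _ => by
        rw [div_eq_inv_mul]
  · have hn2 : 2 * M ≤ n := (Nat.le_ceil _).trans (by exact_mod_cast hn')
    refine (Complex.exp_bound' (n := n) ?_).trans (le_trans ?_ hn)
    · rw [div_le_iff₀ (by positivity)]
      push_cast
      linarith [hM z hz]
    · have := hM z hz
      gcongr

end PolyApprox

/-- The set of `lam` such that the Cauchy kernel at `lam` is a uniform limit of polynomials on
`K` is stable under small perturbations. -/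
theorem PolyApprox.cauchyKernel_of_close {K : Set ℂ} (hK : IsCompact K) {a b : ℂ} {d : ℝ}
    (hd : 0 < d) (hda : ∀ z ∈ K, d ≤ ‖z - a‖) (hab : ‖b - a‖ ≤ d / 2)
    (h : PolyApprox K fun z => (z - a)⁻¹) : PolyApprox K fun z => (z - b)⁻¹ := by
  have h1 : PolyApprox K fun z => (1 - (b - a) * (z - a)⁻¹)⁻¹ := by
    refine (h.const_mul hK (b - a)).geometric hK (ρ := 1 / 2) (by norm_num) fun z hz => ?_
    rw [norm_mul, norm_inv]
    have := hda z hz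
    calc ‖b - a‖ * ‖z - a‖⁻¹ ≤ d / 2 * d⁻¹ := by gcongr
      _ = 1 / 2 := by field_simp
  refine (h.mul hK h1).congr fun z hz => ?_
  have hza : z - a ≠ 0 := fun h0 => by have := hda z hz; rw [h0, norm_zero] at this; linarith
  rw [← mul_inv, mul_sub, mul_one, mul_comm (b - a), ← mul_assoc, mul_inv_cancel₀ hza, one_mul]
  ring_nf

theorem PolyApprox.cauchyKernel_of_large {K : Set ℂ} (hK : IsCompact K) {b : ℂ} {r : ℝ}
    (hr : ∀ z ∈ K, ‖z‖ ≤ r) (hr0 : 0 < r) (hb : 2 * r ≤ ‖b‖) :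
    PolyApprox K fun z => (z - b)⁻¹ := by
  have hb0 : b ≠ 0 := fun h => by rw [h, norm_zero] at hb; linarith
  have hX : PolyApprox K fun z => z := by simpa using PolyApprox.polynomial K X
  have h1 : PolyApprox K fun z => (1 - b⁻¹ * z)⁻¹ := by
    refine (hX.const_mul hK b⁻¹).geometric hK (ρ := 1 / 2) (by norm_num) fun z hz => ?_
    rw [norm_mul, norm_inv]
    calc ‖b‖⁻¹ * ‖z‖ ≤ (2 * r)⁻¹ * r := by gcongr; exact hr z hz
      _ = 1 / 2 := by field_simp
  refine (h1.const_mul hK (-b⁻¹)).congr fun z hz => ?_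
  rw [neg_mul, ← mul_inv, mul_sub, mul_one, ← mul_assoc, mul_inv_cancel₀ hb0, one_mul, ← inv_neg]
  ring_nf

theorem PolyApprox.cauchyKernel {U K : Set ℂ} (hc : ConnectedToInfinity Uᶜ)
    (hK : IsCompact K) (hKU : K ⊆ U) {a : ℂ} (ha : a ∉ U) : PolyApprox K fun z => (z - a)⁻¹ := by
  obtain ⟨C, hCU, haC, hC, hCb⟩ := hc a ha
  obtain ⟨r, hr⟩ := hK.isBounded.exists_norm_le
  have hex : ∃ b ∈ C, 2 * (|r| + 1) ≤ ‖b‖ := by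
    by_contra! hcon
    exact hCb ((Metric.isBounded_ball (x := (0 : ℂ)) (r := 2 * (|r| + 1))).subset
      fun b hb => by simpa using hcon b hb)
  obtain ⟨b, hbC, hb⟩ := hex
  have hlarge : PolyApprox K fun z => (z - b)⁻¹ :=
    cauchyKernel_of_large hK (fun z hz => (hr z hz).trans (by linarith [le_abs_self r]))
      (by positivity) hb
  have key : PolyApprox K (fun z => (z - a)⁻¹) ↔ PolyApprox K fun z => (z - b)⁻¹ := by
    refine hC.induction₂ (fun x y => PolyApprox K (fun z => (z - x)⁻¹) ↔
      PolyApprox K fun z => (z - y)⁻¹) (fun x hx => ?_)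
      (fun x y z _ _ _ h1 h2 => h1.trans h2) (fun x y _ _ h => h.symm) haC hbC
    have hxU : x ∈ Kᶜ := fun h => hCU hx (hKU h)
    obtain ⟨d, hd, hball⟩ := Metric.isOpen_iff.1 hK.isClosed.isOpen_compl x hxU
    have hdK : ∀ z ∈ K, d ≤ ‖z - x‖ := fun z hz => by
      by_contra! hlt
      exact hball (by simpa [dist_eq_norm] using hlt) hz
    refine mem_nhdsWithin_of_mem_nhds ?_
    filter_upwards [Metric.closedBall_mem_nhds x (show 0 < d / 4 by positivity)] with y hy
    rw [mem_closedBall_iff_norm] at hy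
    refine ⟨fun h => h.cauchyKernel_of_close hK hd hdK (by linarith), fun h =>
      h.cauchyKernel_of_close hK (d := d / 2) (by positivity) (fun z hz => ?_) ?_⟩
    · have := norm_sub_le_norm_sub_add_norm_sub z y x
      linarith [hdK z hz]
    · rw [norm_sub_rev]; linarith
  exact key.2 hlarge

/-- The polynomially convex hull. -/
def polyHull (K : Set ℂ) : Set ℂ :=
  {x | ∀ (P : ℂ[X]) (M : ℝ), (∀ z ∈ K, ‖P.eval z‖ ≤ M) → ‖P.eval x‖ ≤ M}

theorem subset_polyHull (K : Set ℂ) : K ⊆ polyHull K := fun _ hz _ _ h => h _ hz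

theorem isCompact_polyHull {K : Set ℂ} (hK : IsCompact K) : IsCompact (polyHull K) := by
  refine Metric.isCompact_of_isClosed_isBounded ?_ ?_
  · have : polyHull K = ⋂ (P : ℂ[X]) (M : ℝ) (_ : ∀ z ∈ K, ‖P.eval z‖ ≤ M),
        {x | ‖P.eval x‖ ≤ M} := by
      ext x; simp [polyHull]
    rw [this]
    refine isClosed_iInter fun P => isClosed_iInter fun M => isClosed_iInter fun _ => ?_
    exact isClosed_le (P.continuous).norm continuous_const
  · obtain ⟨r, hr⟩ := hK.isBounded.exists_norm_le
    refine (Metric.isBounded_closedBall (x := (0 : ℂ)) (r := r)).subset fun x hx => ?_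
    simpa using hx X r (by simpa using hr)

theorem polyHull_subset {U K : Set ℂ} (hc : ConnectedToInfinity Uᶜ)
    (hK : IsCompact K) (hKU : K ⊆ U) : polyHull K ⊆ U := by
  intro a ha
  by_contra haU
  have hka := PolyApprox.cauchyKernel hc hK hKU haU
  obtain ⟨M, hM0, hM⟩ : ∃ M > 0, ∀ z ∈ K, ‖z - a‖ ≤ M :=
    ((PolyApprox.polynomial K (X - C a)).congr (g := fun z => z - a)
      fun z _ => by simp).bounded hK
  obtain ⟨P, hP⟩ := hka (1 / (2 * M)) (by positivity)
  have := ha (1 - (X - C a) * P) (1 / 2) fun z hz => by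
    have hza : z - a ≠ 0 := sub_ne_zero.2 fun h => haU (h ▸ hKU hz)
    calc ‖(1 - (X - C a) * P).eval z‖ = ‖(z - a) * ((z - a)⁻¹ - P.eval z)‖ := by
          rw [mul_sub, mul_inv_cancel₀ hza]; simp
      _ = ‖z - a‖ * ‖(z - a)⁻¹ - P.eval z‖ := norm_mul _ _
      _ ≤ M * (1 / (2 * M)) := mul_le_mul (hM z hz) (hP z hz) (norm_nonneg _) hM0.le
      _ = 1 / 2 := by field_simp
  norm_num at this

theorem PolyApprox.cauchyKernel_of_notMem_polyHull {K : Set ℂ} (hK : IsCompact K) {a : ℂ}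
    (ha : a ∉ polyHull K) : PolyApprox K fun z => (z - a)⁻¹ := by
  rw [polyHull, mem_ofPred_eq] at ha
  push Not at ha
  obtain ⟨q, M, hM, hqa⟩ := ha
  rcases K.eq_empty_or_nonempty with rfl | ⟨z₀, hz₀⟩
  · exact fun ε _ => ⟨0, by simp⟩
  have hM0 : 0 ≤ M := (norm_nonneg _).trans (hM z₀ hz₀)
  have hq0 : 0 < ‖q.eval a‖ := hM0.trans_lt hqa
  have hq0' : q.eval a ≠ 0 := norm_pos_iff.1 hq0
  obtain ⟨r, hr⟩ : X - C a ∣ C (q.eval a) - q := by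
    rw [dvd_iff_isRoot]; simp
  have h1 : PolyApprox K fun z => (1 - (q.eval a)⁻¹ * q.eval z)⁻¹ := by
    refine ((polynomial K q).const_mul hK _).geometric hK (ρ := M / ‖q.eval a‖)
      ((div_lt_one hq0).2 hqa) fun z hz => ?_
    rw [norm_mul, norm_inv, inv_mul_eq_div]
    exact div_le_div_of_nonneg_right (hM z hz) hq0.le
  refine ((h1.mul hK (polynomial K r)).const_mul hK (q.eval a)⁻¹).congr fun z hz => ?_
  have hrz := congrArg (fun P => P.eval z) hr
  simp only [eval_sub, eval_C, eval_mul, eval_X] at hrz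
  have hne : q.eval a - q.eval z ≠ 0 := sub_ne_zero.2 fun h => by
    have := hM z hz; rw [← h] at this; linarith
  have hza : z - a ≠ 0 := fun h => hne (by rw [hrz, h, zero_mul])
  have hrz' : r.eval z = (q.eval a - q.eval z) / (z - a) := by rw [hrz]; field_simp
  have hx : 1 - (q.eval a)⁻¹ * q.eval z = (q.eval a - q.eval z) / q.eval a := by field_simp
  rw [hrz', hx]
  field_simp

theorem PolyApprox.inv_polynomial {K : Set ℂ} (hK : IsCompact K) {P : ℂ[X]}
    (hP : ∀ a ∈ polyHull K, P.eval a ≠ 0) : PolyApprox K fun z => (P.eval z)⁻¹ := by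
  have hprod : ∀ s : Multiset ℂ, (∀ a ∈ s, a ∉ polyHull K) →
      PolyApprox K fun z => ((s.map fun a => X - C a).prod.eval z)⁻¹ := by
    intro s
    induction s using Multiset.induction with
    | empty => intro _; simpa using const K 1
    | cons a s ih =>
      intro hs
      refine ((cauchyKernel_of_notMem_polyHull hK (hs a (by simp))).mul hK
        (ih fun b hb => hs b (by simp [hb]))).congr fun z _ => ?_
      simp [mul_comm]
  by_cases hP0 : P = 0
  · subst hP0
    exact (const K 0).congr (by simp)
  have hsplit := (IsAlgClosed.splits P).eq_prod_roots
  refine ((hprod P.roots fun a ha hmem => hP a hmem (isRoot_of_mem_roots ha)).const_mul hK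
    (P.leadingCoeff)⁻¹).congr fun z _ => ?_
  conv_rhs => rw [hsplit]
  rw [eval_mul, eval_C, mul_inv]

theorem PolyApprox.inv {K : Set ℂ} {f : ℂ → ℂ} (hK : IsCompact K) (hf : PolyApprox (polyHull K) f)
    {m : ℝ} (hm : 0 < m) (h : ∀ z ∈ polyHull K, m ≤ ‖f z‖) : PolyApprox K fun z => (f z)⁻¹ := by
  refine of_approx fun ε hε => ?_
  obtain ⟨P, hP⟩ := hf (min (m / 2) (ε * (m * (m / 2)))) (by positivity)
  have hPm : ∀ z ∈ polyHull K, m / 2 ≤ ‖P.eval z‖ := fun z hz => by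
    have h1 := norm_sub_norm_le (f z) (P.eval z)
    linarith [h z hz, (hP z hz).trans (min_le_left _ _)]
  refine ⟨fun z => (P.eval z)⁻¹, inv_polynomial hK fun a ha h0 => ?_, fun z hz => ?_⟩
  · have := hPm a ha
    rw [h0, norm_zero] at this
    linarith
  · have hz' := subset_polyHull K hz
    have h1 := h z hz'
    have h2 := hPm z hz'
    have h3 := (hP z hz').trans (min_le_right _ _)
    have hf0 : f z ≠ 0 := norm_pos_iff.1 (by linarith)
    have hP0 : P.eval z ≠ 0 := norm_pos_iff.1 (by linarith)
    rw [inv_sub_inv hf0 hP0, norm_div, norm_mul, norm_sub_rev, div_le_iff₀ (by positivity)]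
    exact h3.trans (by gcongr)

end LineAlexander

namespace LineAlexander
open Set Filter Topology Polynomial

/-- `f` is a locally uniform limit of polynomials on `U`. -/
def PolyApproxOn (U : Set ℂ) (f : ℂ → ℂ) : Prop :=
  ∀ K ⊆ U, IsCompact K → PolyApprox K f

theorem exists_antiderivative (P : ℂ[X]) (x₀ : ℂ) :
    ∃ Q : ℂ[X], derivative Q = P ∧ Q.eval x₀ = 0 := by
  have : ∀ P : ℂ[X], ∃ Q : ℂ[X], derivative Q = P := by
    intro P
    induction P using Polynomial.induction_on' with
    | add p q hp hq =>
      obtain ⟨a, rfl⟩ := hp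
      obtain ⟨b, rfl⟩ := hq
      exact ⟨a + b, derivative_add⟩
    | monomial n a =>
      refine ⟨monomial (n + 1) (a / (n + 1)), ?_⟩
      have : (n : ℂ) + 1 ≠ 0 := by exact_mod_cast n.succ_ne_zero
      rw [derivative_monomial]
      push_cast
      rw [div_mul_cancel₀ _ this]
  obtain ⟨Q, hQ⟩ := this P
  exact ⟨Q - C (Q.eval x₀), by simp [hQ], by simp⟩

namespace PolyApproxOn

variable {U : Set ℂ} {f g : ℂ → ℂ}

theorem exists_filter (hU : IsOpen U) (hf : PolyApproxOn U f) :
    ∃ l : Filter ℂ[X], l.NeBot ∧ TendstoLocallyUniformlyOn (fun P z => P.eval z) f l U := by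
  let ι := {K : Set ℂ // K ⊆ U ∧ IsCompact K} × {ε : ℝ // 0 < ε}
  let B : ι → Set ℂ[X] := fun i => {P | ∀ z ∈ i.1.1, ‖f z - P.eval z‖ ≤ i.2.1}
  have hB : ∀ i, (𝓟 (B i)).NeBot := fun i => by
    rw [principal_neBot_iff]
    exact hf i.1.1 i.1.2.1 i.1.2.2 i.2.1 i.2.2
  have : Nonempty ι := ⟨⟨∅, empty_subset _, isCompact_empty⟩, ⟨1, one_pos⟩⟩
  refine ⟨⨅ i, 𝓟 (B i), iInf_neBot_of_directed' ?_ hB, ?_⟩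
  · intro i j
    refine ⟨⟨⟨i.1.1 ∪ j.1.1, union_subset i.1.2.1 j.1.2.1, i.1.2.2.union j.1.2.2⟩,
      ⟨min i.2.1 j.2.1, lt_min i.2.2 j.2.2⟩⟩, ?_, ?_⟩
    · exact principal_mono.2 fun P hP z hz => (hP z (.inl hz)).trans (min_le_left _ _)
    · exact principal_mono.2 fun P hP z hz => (hP z (.inr hz)).trans (min_le_right _ _)
  · rw [tendstoLocallyUniformlyOn_iff_forall_isCompact hU]
    intro K hK hKc
    rw [Metric.tendstoUniformlyOn_iff]
    intro ε hε
    refine mem_iInf_of_mem (⟨⟨K, hK, hKc⟩, ⟨ε / 2, by positivity⟩⟩ : ι) ?_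
    rw [mem_principal]
    intro P hP z hz
    rw [dist_eq_norm]
    exact (hP z hz).trans_lt (by dsimp only; linarith)

theorem of_tendsto {ι : Type*} {l : Filter ι} [l.NeBot] {F : ι → ℂ → ℂ} (hU : IsOpen U)
    (hF : ∀ᶠ i in l, PolyApproxOn U (F i)) (h : TendstoLocallyUniformlyOn F f l U) :
    PolyApproxOn U f := by
  intro K hK hKc
  rw [tendstoLocallyUniformlyOn_iff_forall_isCompact hU] at h
  have h := Metric.tendstoUniformlyOn_iff.1 (h K hK hKc)
  refine PolyApprox.of_approx fun ε hε => ?_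
  obtain ⟨i, hi, hi'⟩ := ((h ε hε).and hF).exists
  exact ⟨F i, hi' K hK hKc, fun z hz => by simpa [dist_eq_norm] using (hi z hz).le⟩

theorem polynomial (U : Set ℂ) (P : ℂ[X]) : PolyApproxOn U fun z => P.eval z :=
  fun _ _ _ => .polynomial _ _

theorem id (U : Set ℂ) : PolyApproxOn U fun z => z := by simpa using polynomial U X

theorem const (U : Set ℂ) (c : ℂ) : PolyApproxOn U fun _ => c := fun _ _ _ => .const _ _

theorem congr (hf : PolyApproxOn U f) (h : ∀ z ∈ U, f z = g z) : PolyApproxOn U g :=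
  fun K hK hKc => (hf K hK hKc).congr fun z hz => h z (hK hz)

theorem add (hf : PolyApproxOn U f) (hg : PolyApproxOn U g) : PolyApproxOn U fun z => f z + g z :=
  fun K hK hKc => (hf K hK hKc).add (hg K hK hKc)

theorem sub (hf : PolyApproxOn U f) (hg : PolyApproxOn U g) : PolyApproxOn U fun z => f z - g z :=
  fun K hK hKc => (hf K hK hKc).sub hKc (hg K hK hKc)

theorem mul (hf : PolyApproxOn U f) (hg : PolyApproxOn U g) : PolyApproxOn U fun z => f z * g z :=
  fun K hK hKc => (hf K hK hKc).mul hKc (hg K hK hKc)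

theorem exp (hf : PolyApproxOn U f) : PolyApproxOn U fun z => Complex.exp (f z) :=
  fun K hK hKc => (hf K hK hKc).exp hKc

theorem differentiableOn (hU : IsOpen U) (hf : PolyApproxOn U f) : DifferentiableOn ℂ f U := by
  obtain ⟨l, hl, h⟩ := hf.exists_filter hU
  exact h.differentiableOn (.of_forall fun P => P.differentiable.differentiableOn) hU

theorem inv (hU : IsOpen U) (hc : ConnectedToInfinity Uᶜ) (hf : PolyApproxOn U f)
    (h0 : ∀ z ∈ U, f z ≠ 0) : PolyApproxOn U fun z => (f z)⁻¹ := by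
  intro K hK hKc
  have hsub := polyHull_subset hc hKc hK
  have hcpt := isCompact_polyHull hKc
  have hcont : ContinuousOn (fun z => ‖f z‖) (polyHull K) :=
    ((hf.differentiableOn hU).continuousOn.mono hsub).norm
  rcases (polyHull K).eq_empty_or_nonempty with he | hne
  · have : K = ∅ := subset_empty_iff.1 (he ▸ subset_polyHull K)
    subst this
    exact fun ε _ => ⟨0, by simp⟩
  obtain ⟨x, hx, hmin⟩ := hcpt.exists_isMinOn hne hcont
  exact (hf _ hsub hcpt).inv hKc (norm_pos_iff.2 (h0 x (hsub hx))) fun z hz => hmin hz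

theorem deriv (hU : IsOpen U) (hf : PolyApproxOn U f) : PolyApproxOn U (deriv f) := by
  obtain ⟨l, hl, h⟩ := hf.exists_filter hU
  refine of_tendsto hU (.of_forall fun P => ?_)
    (h.deriv (.of_forall fun P => P.differentiable.differentiableOn) hU)
  simp only [Function.comp_apply]
  exact (polynomial U (derivative P)).congr fun z _ => P.deriv.symm

end PolyApproxOn

/-- Control of the oscillation of a polynomial by the size of its derivative. -/
theorem exists_oscillation_bound {U : Set ℂ} (hU : IsOpen U) (hUc : IsPreconnected U) {x y : ℂ}
    (hx : x ∈ U) (hy : y ∈ U) : ∃ K ⊆ U, IsCompact K ∧ ∃ B : ℝ, 0 ≤ B ∧ ∀ (Q : ℂ[X]) (M : ℝ),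
      (∀ z ∈ K, ‖(derivative Q).eval z‖ ≤ M) → ‖Q.eval x - Q.eval y‖ ≤ B * M := by
  refine hUc.induction₂ (fun x y => ∃ K ⊆ U, IsCompact K ∧ ∃ B : ℝ, 0 ≤ B ∧ ∀ (Q : ℂ[X]) (M : ℝ),
      (∀ z ∈ K, ‖(derivative Q).eval z‖ ≤ M) → ‖Q.eval x - Q.eval y‖ ≤ B * M) ?_ ?_ ?_ hx hy
  · intro x hx
    obtain ⟨r, hr, hb⟩ := Metric.nhds_basis_closedBall.mem_iff.1 (hU.mem_nhds hx)
    filter_upwards [mem_nhdsWithin_of_mem_nhds (Metric.closedBall_mem_nhds x hr)] with y hy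
    refine ⟨_, hb, isCompact_closedBall x r, ‖x - y‖, norm_nonneg _, fun Q M hM => ?_⟩
    have := (convex_closedBall x r).norm_image_sub_le_of_norm_deriv_le (f := fun z => Q.eval z)
      (fun z _ => Q.differentiable z) (C := M) (fun z hz => by rw [Q.deriv]; exact hM z hz)
      hy (Metric.mem_closedBall_self hr.le)
    simpa [mul_comm] using this
  · rintro x y z - - - ⟨K, hK, hKc, B, hB, h⟩ ⟨K', hK', hKc', B', hB', h'⟩
    refine ⟨_, union_subset hK hK', hKc.union hKc', _, add_nonneg hB hB', fun Q M hM => ?_⟩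
    have h1 := h Q M fun z hz => hM z (.inl hz)
    have h2 := h' Q M fun z hz => hM z (.inr hz)
    have := norm_sub_le_norm_sub_add_norm_sub (Q.eval x) (Q.eval y) (Q.eval z)
    rw [add_mul]
    linarith
  · rintro x y - - ⟨K, hK, hKc, B, hB, h⟩
    exact ⟨K, hK, hKc, B, hB, fun Q M hM => by rw [norm_sub_rev]; exact h Q M hM⟩

theorem PolyApproxOn.exists_primitive {U : Set ℂ} {f : ℂ → ℂ} (hU : IsOpen U)
    (hUc : IsPreconnected U) (hf : PolyApproxOn U f) :
    ∃ g, PolyApproxOn U g ∧ ∀ z ∈ U, HasDerivAt g (f z) z := by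
  rcases U.eq_empty_or_nonempty with rfl | ⟨x₀, hx₀⟩
  · exact ⟨0, fun K hK _ ε _ => ⟨0, fun z hz => (hK hz).elim⟩, by simp⟩
  obtain ⟨l, hl, h⟩ := hf.exists_filter hU
  choose A hA hA0 using fun P => exists_antiderivative P x₀
  have hcpt := (tendstoLocallyUniformlyOn_iff_forall_isCompact hU).1 h
  -- local uniform Cauchy estimates for the antiderivatives
  have key : ∀ y ∈ U, ∃ r > 0, Metric.closedBall y r ⊆ U ∧
      UniformCauchySeqOn (fun P z => (A P).eval z) l (Metric.closedBall y r) := by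
    intro y hy
    obtain ⟨r, hr, hb⟩ := Metric.nhds_basis_closedBall.mem_iff.1 (hU.mem_nhds hy)
    obtain ⟨K, hK, hKc, B, hB, hosc⟩ := exists_oscillation_bound hU hUc hy hx₀
    refine ⟨r, hr, hb, ?_⟩
    have hC := (hcpt _ (union_subset hK hb) (hKc.union (isCompact_closedBall y r))).uniformCauchySeqOn
    intro u hu
    obtain ⟨ε, hε, hεu⟩ := Metric.mem_uniformity_dist.1 hu
    filter_upwards [hC _ (Metric.dist_mem_uniformity (show 0 < ε / (2 * (B + r)) by positivity))]
      with ⟨P, Q⟩ hPQ z hz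
    refine hεu ?_
    rw [dist_eq_norm, ← eval_sub]
    have hder : ∀ w ∈ K ∪ Metric.closedBall y r,
        ‖(derivative (A P - A Q)).eval w‖ ≤ ε / (2 * (B + r)) := fun w hw => by
      rw [derivative_sub, hA, hA, eval_sub, ← dist_eq_norm]
      exact le_of_lt (hPQ w hw)
    have h1 := hosc _ _ fun w hw => hder w (.inl hw)
    have h2 := (convex_closedBall y r).norm_image_sub_le_of_norm_deriv_le
      (f := fun z => (A P - A Q).eval z) (fun z _ => (A P - A Q).differentiable z)
      (C := ε / (2 * (B + r))) (fun z hz => by rw [(A P - A Q).deriv]; exact hder z (.inr hz))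
      (Metric.mem_closedBall_self hr.le) hz
    rw [eval_sub _ _ x₀, hA0, hA0, sub_zero, sub_zero] at h1
    have h3 : ‖z - y‖ ≤ r := mem_closedBall_iff_norm.1 hz
    calc ‖(A P - A Q).eval z‖ = ‖((A P - A Q).eval z - (A P - A Q).eval y)
          + (A P - A Q).eval y‖ := by ring_nf
      _ ≤ _ := norm_add_le _ _
      _ ≤ ε / (2 * (B + r)) * r + B * (ε / (2 * (B + r))) :=
          add_le_add (h2.trans (by gcongr)) h1
      _ = ε / 2 := by field_simp; ring
      _ < ε := by linarith
  let g : ℂ → ℂ := fun z => limUnder l fun P => (A P).eval z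
  have hg : TendstoLocallyUniformlyOn (fun P z => (A P).eval z) g l U := by
    have hpt : ∀ z ∈ U, Tendsto (fun P => (A P).eval z) l (𝓝 (g z)) := fun z hz => by
      obtain ⟨r, hr, -, hC⟩ := key z hz
      obtain ⟨a, ha⟩ := cauchy_map_iff_exists_tendsto.1
        (hC.cauchy_map (Metric.mem_closedBall_self hr.le))
      exact tendsto_nhds_limUnder ⟨a, ha⟩
    intro u hu y hy
    obtain ⟨r, hr, hb, hC⟩ := key y hy
    exact ⟨_, mem_nhdsWithin_of_mem_nhds (Metric.closedBall_mem_nhds y hr),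
      hC.tendstoUniformlyOn_of_tendsto (fun z hz => hpt z (hb hz)) u hu⟩
  have hdiff := hg.differentiableOn (.of_forall fun P => (A P).differentiable.differentiableOn) hU
  have hderiv := hg.deriv (.of_forall fun P => (A P).differentiable.differentiableOn) hU
  refine ⟨g, of_tendsto hU (.of_forall fun P => polynomial U (A P)) hg, fun z hz => ?_⟩
  have : _root_.deriv g z = f z := by
    refine tendsto_nhds_unique (hderiv.tendsto_at hz) ?_
    simpa [Function.comp_def, hA] using h.tendsto_at hz
  rw [← this]
  exact (hdiff.differentiableAt (hU.mem_nhds hz)).hasDerivAt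

/-- A nonvanishing locally uniform limit of polynomials on a domain with complement connected to
infinity has a logarithm in the same class. -/
theorem PolyApproxOn.exists_log {U : Set ℂ} {f : ℂ → ℂ} (hU : IsOpen U) (hUc : IsPreconnected U)
    (hc : ConnectedToInfinity Uᶜ) (hf : PolyApproxOn U f) (h0 : ∀ z ∈ U, f z ≠ 0) :
    ∃ g, PolyApproxOn U g ∧ ∀ z ∈ U, Complex.exp (g z) = f z := by
  rcases U.eq_empty_or_nonempty with rfl | ⟨x₀, hx₀⟩
  · exact ⟨0, fun K hK _ ε _ => ⟨0, fun z hz => (hK hz).elim⟩, by simp⟩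
  obtain ⟨g, hg, hg'⟩ := ((hf.deriv hU).mul (hf.inv hU hc h0)).exists_primitive hU hUc
  have hF : ∀ z ∈ U, HasDerivAt (fun z => f z * Complex.exp (-g z)) 0 z := fun z hz => by
    have h1 := ((hf.differentiableOn hU).differentiableAt (hU.mem_nhds hz)).hasDerivAt
    have := h1.mul (hg' z hz).neg.cexp
    refine HasDerivAt.congr_deriv (f' := _) this ?_
    linear_combination (-(_root_.deriv f z) * Complex.exp ((-g) z)) * mul_inv_cancel₀ (h0 z hz)
  have hconst : ∀ z ∈ U, f z * Complex.exp (-g z) = f x₀ * Complex.exp (-g x₀) := fun z hz =>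
    hU.is_const_of_deriv_eq_zero hUc (fun w hw => (hF w hw).differentiableAt.differentiableWithinAt)
      (fun w hw => (hF w hw).deriv) hz hx₀
  refine ⟨fun z => g z + Complex.log (f x₀ * Complex.exp (-g x₀)), hg.add (const U _),
    fun z hz => ?_⟩
  rw [Complex.exp_add, Complex.exp_log (mul_ne_zero (h0 _ hx₀) (Complex.exp_ne_zero _)),
    ← hconst z hz, mul_comm, mul_assoc, ← Complex.exp_add, neg_add_cancel, Complex.exp_zero,
    mul_one]

theorem PolyApproxOn.exists_sqrt {U : Set ℂ} {f : ℂ → ℂ} (hU : IsOpen U) (hUc : IsPreconnected U)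
    (hc : ConnectedToInfinity Uᶜ) (hf : PolyApproxOn U f) (h0 : ∀ z ∈ U, f z ≠ 0) :
    ∃ g, PolyApproxOn U g ∧ ∀ z ∈ U, g z * g z = f z := by
  obtain ⟨g, hg, hgf⟩ := hf.exists_log hU hUc hc h0
  refine ⟨_, ((const U (1 / 2)).mul hg).exp, fun z hz => ?_⟩
  rw [← Complex.exp_add, ← hgf z hz]
  ring_nf

end LineAlexander

namespace LineAlexander
open Set Filter Topology Metric

/-- Hurwitz's theorem for zeros. -/
theorem eqOn_zero_of_tendsto_ne_zero {ι : Type*} {l : Filter ι} [l.NeBot] {U : Set ℂ}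
    (hU : IsOpen U) (hUc : IsPreconnected U) {F : ι → ℂ → ℂ} {g : ℂ → ℂ}
    (hF : ∀ i, DifferentiableOn ℂ (F i) U) (h0 : ∀ i, ∀ z ∈ U, F i z ≠ 0)
    (h : TendstoLocallyUniformlyOn F g l U) {z₀ : ℂ} (hz₀ : z₀ ∈ U) (hg0 : g z₀ = 0) :
    ∀ z ∈ U, g z = 0 := by
  have hg : DifferentiableOn ℂ g U := h.differentiableOn (.of_forall hF) hU
  have hga : AnalyticOnNhd ℂ g U := hg.analyticOnNhd hU
  rcases (hga z₀ hz₀).eventually_eq_zero_or_eventually_ne_zero with hev | hev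
  · exact hga.eqOn_zero_of_preconnected_of_eventuallyEq_zero hUc hz₀ hev
  exfalso
  rw [eventually_nhdsWithin_iff] at hev
  obtain ⟨r, hr, hb⟩ := nhds_basis_closedBall.mem_iff.1 (hev.and (hU.mem_nhds hz₀))
  have hbU : closedBall z₀ r ⊆ U := fun z hz => (hb hz).2
  have hsph : sphere z₀ r ⊆ closedBall z₀ r := sphere_subset_closedBall
  obtain ⟨x, hx, hmin⟩ := (isCompact_sphere z₀ r).exists_isMinOn
    (NormedSpace.sphere_nonempty.2 hr.le) (hg.continuousOn.mono (hsph.trans hbU)).norm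
  have hm : 0 < ‖g x‖ := by
    refine norm_pos_iff.2 ((hb (hsph hx)).1 ?_)
    rintro rfl
    simp [hr.ne] at hx
  have hu := tendstoUniformlyOn_iff.1 ((tendstoLocallyUniformlyOn_iff_forall_isCompact hU).1 h _ hbU
    (isCompact_closedBall _ _)) (‖g x‖ / 4) (by positivity)
  obtain ⟨i, hi⟩ := hu.exists
  have hlow : ∀ z ∈ sphere z₀ r, ‖g x‖ / 2 ≤ ‖F i z‖ := fun z hz => by
    have h1 := hi z (hsph hz)
    rw [dist_eq_norm] at h1
    have h2 : ‖g x‖ ≤ ‖g z‖ := hmin hz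
    have h3 := norm_sub_norm_le (g z) (F i z)
    linarith
  have hmax : ‖(F i z₀)⁻¹‖ ≤ (‖g x‖ / 2)⁻¹ := by
    refine Complex.norm_le_of_forall_mem_frontier_norm_le (f := fun z => (F i z)⁻¹) (U := ball z₀ r)
      isBounded_ball ⟨?_, ?_⟩ ?_ (subset_closure (mem_ball_self hr))
    · exact ((hF i).mono (ball_subset_closedBall.trans hbU)).inv
        fun z hz => h0 i z (hbU (ball_subset_closedBall hz))
    · rw [closure_ball _ hr.ne']
      exact ((hF i).continuousOn.mono hbU).inv₀ fun z hz => h0 i z (hbU hz)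
    · rw [frontier_ball _ hr.ne']
      intro z hz
      rw [norm_inv]
      exact inv_anti₀ (by positivity) (hlow z hz)
  rw [norm_inv] at hmax
  have h1 := hi z₀ (mem_closedBall_self hr.le)
  rw [hg0, dist_zero_left] at h1
  have h2 : 0 < ‖F i z₀‖ := norm_pos_iff.2 (h0 i z₀ hz₀)
  have h3 := (inv_le_inv₀ h2 (by positivity)).1 hmax
  linarith

/-- Hurwitz's theorem for injective functions. -/
theorem injOn_of_tendsto_injOn {ι : Type*} {l : Filter ι} [l.NeBot] {U : Set ℂ}
    (hU : IsOpen U) (hUc : IsPreconnected U) {F : ι → ℂ → ℂ} {g : ℂ → ℂ}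
    (hF : ∀ i, DifferentiableOn ℂ (F i) U) (hinj : ∀ i, InjOn (F i) U)
    (h : TendstoLocallyUniformlyOn F g l U) {p : ℂ} (hp : p ∈ U) (hgp : deriv g p ≠ 0) :
    InjOn g U := by
  intro a ha b hb hab
  by_contra hne
  have hg : DifferentiableOn ℂ g U := h.differentiableOn (.of_forall hF) hU
  obtain ⟨r, hr, hball⟩ := nhds_basis_ball.mem_iff.1
    ((hU.sdiff isClosed_singleton).mem_nhds (show b ∈ U \ {a} from ⟨hb, fun h => hne h.symm⟩))
  have hbU : ball b r ⊆ U := fun z hz => (hball hz).1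
  have hzero := eqOn_zero_of_tendsto_ne_zero (l := l) isOpen_ball (convex_ball b r).isPreconnected
    (F := fun i z => F i z - F i a) (g := fun z => g z - g a)
    (fun i => ((hF i).mono hbU).sub_const _)
    (fun i z hz h0 => (hball hz).2 (hinj i (hbU hz) ha (sub_eq_zero.1 h0)))
    (by
      have h1 := h.mono hbU
      rw [tendstoLocallyUniformlyOn_iff] at h1 ⊢
      intro ε hε x hx
      obtain ⟨t, ht, hev⟩ := h1 (ε / 2) (by positivity) x hx
      have h2 := Metric.tendsto_nhds.1 (h.tendsto_at ha) (ε / 2) (by positivity)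
      refine ⟨t, ht, ?_⟩
      filter_upwards [hev, h2] with i hi hi2 y hy
      have := hi y hy
      rw [dist_eq_norm] at *
      calc ‖g y - g a - (F i y - F i a)‖ = ‖(g y - F i y) + (F i a - g a)‖ := by ring_nf
        _ ≤ _ := norm_add_le _ _
        _ < ε := by linarith)
    (mem_ball_self hr) (sub_eq_zero.2 hab.symm)
  have hev : g =ᶠ[𝓝 b] fun _ => g a := by
    filter_upwards [ball_mem_nhds b hr] with z hz using sub_eq_zero.1 (hzero z hz)
  have hconst := (hg.analyticOnNhd hU).eqOn_of_preconnected_of_eventuallyEq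
    (fun _ _ => analyticAt_const) hUc hb hev
  refine hgp ?_
  have hp' : g =ᶠ[𝓝 p] fun _ => g a := eventually_of_mem (hU.mem_nhds hp) hconst
  rw [hp'.deriv_eq]
  simp

/-- A form of Montel's theorem. -/
theorem exists_tendstoLocallyUniformlyOn_of_bounded {ι : Type*} (l : Ultrafilter ι) {U : Set ℂ}
    (hU : IsOpen U) {F : ι → ℂ → ℂ} (hF : ∀ i, DifferentiableOn ℂ (F i) U)
    (hb : ∀ i, ∀ z ∈ U, ‖F i z‖ ≤ 1) :
    ∃ g, TendstoLocallyUniformlyOn F g l U := by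
  have hlim : ∀ z, ∃ y, z ∈ U → Tendsto (fun i => F i z) l (𝓝 y) := fun z => by
    by_cases hz : z ∈ U
    · obtain ⟨y, -, hy⟩ := (isCompact_closedBall (0 : ℂ) 1).ultrafilter_le_nhds (l.map fun i => F i z)
        (by
          rw [le_principal_iff]
          exact Eventually.of_forall (f := (l : Filter ι)) fun i => by simpa using hb i z hz)
      exact ⟨y, fun _ => hy⟩
    · exact ⟨0, fun h => (hz h).elim⟩
  choose g hg using hlim
  refine ⟨g, tendstoLocallyUniformlyOn_iff.2 fun ε hε y hy => ?_⟩
  obtain ⟨R, hR, hbU⟩ := nhds_basis_closedBall.mem_iff.1 (hU.mem_nhds hy)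
  obtain ⟨r, hr, hrR⟩ : ∃ r > 0, 2 * r ≤ R := ⟨R / 2, by positivity, by linarith⟩
  have hsub : ∀ z ∈ closedBall y r, closedBall z r ⊆ U := fun z hz =>
    (closedBall_subset_closedBall' (by have := mem_closedBall.1 hz; linarith)).trans hbU
  have hsub' : closedBall y r ⊆ U := hsub y (mem_closedBall_self hr.le)
  have hLip : ∀ i, ∀ z ∈ closedBall y r, ∀ w ∈ closedBall y r, ‖F i z - F i w‖ ≤ 1 / r * ‖z - w‖ := by
    intro i z hz w hw
    refine (convex_closedBall y r).norm_image_sub_le_of_norm_deriv_le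
      (fun x hx => (hF i).differentiableAt (hU.mem_nhds (hsub' hx))) (fun x hx => ?_) hw hz
    refine Complex.norm_deriv_le_of_forall_mem_sphere_norm_le hr ⟨?_, ?_⟩
      fun w hw => hb i w (hsub x hx (sphere_subset_closedBall hw))
    · exact (hF i).mono (ball_subset_closedBall.trans (hsub x hx))
    · rw [closure_ball _ hr.ne']
      exact (hF i).continuousOn.mono (hsub x hx)
  have hLip' : ∀ z ∈ closedBall y r, ∀ w ∈ closedBall y r, ‖g z - g w‖ ≤ 1 / r * ‖z - w‖ :=
    fun z hz w hw => le_of_tendsto ((hg z (hsub' hz)).sub (hg w (hsub' hw))).norm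
      (.of_forall fun i => hLip i z hz w hw)
  obtain ⟨t, hts, htf, htc⟩ := (isCompact_closedBall y r).finite_cover_balls
    (show 0 < ε * r / 4 by positivity)
  refine ⟨closedBall y r, mem_nhdsWithin_of_mem_nhds (closedBall_mem_nhds y hr), ?_⟩
  have hev : ∀ᶠ i in l, ∀ c ∈ t, dist (F i c) (g c) < ε / 4 :=
    (eventually_all_finite htf).2 fun c hc => Metric.tendsto_nhds.1 (hg c (hsub' (hts hc))) _ (by positivity)
  filter_upwards [hev] with i hi z hz
  obtain ⟨c, hc, hzc⟩ := mem_iUnion₂.1 (htc hz)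
  have h1 := hLip i z hz c (hts hc)
  have h2 := hLip' z hz c (hts hc)
  have h3 := hi c hc
  rw [mem_ball, dist_eq_norm] at hzc
  have h4 : 1 / r * ‖z - c‖ ≤ ε / 4 := by
    calc 1 / r * ‖z - c‖ ≤ 1 / r * (ε * r / 4) := by gcongr
      _ = ε / 4 := by field_simp
  rw [dist_eq_norm] at h3 ⊢
  calc ‖g z - F i z‖ = ‖(g z - g c) - (F i c - g c) - (F i z - F i c)‖ := by ring_nf
    _ ≤ ‖(g z - g c) - (F i c - g c)‖ + ‖F i z - F i c‖ := norm_sub_le _ _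
    _ ≤ ‖g z - g c‖ + ‖F i c - g c‖ + ‖F i z - F i c‖ := by gcongr; exact norm_sub_le _ _
    _ < ε := by linarith

end LineAlexander

namespace LineAlexander
open Set Filter Topology Metric

/-- Injective locally uniform limits of polynomials from `U` to the unit disk. -/
structure IsDiskEmbedding (U : Set ℂ) (f : ℂ → ℂ) : Prop where
  approx : PolyApproxOn U f
  injOn : InjOn f U
  mapsTo : ∀ z ∈ U, ‖f z‖ < 1
  deriv_ne_zero : ∀ z ∈ U, deriv f z ≠ 0

theorem one_sub_conj_mul_ne_zero {a w : ℂ} (ha : ‖a‖ < 1) (hw : ‖w‖ < 1) :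
    1 - starRingEnd ℂ a * w ≠ 0 := by
  intro h
  have h1 : starRingEnd ℂ a * w = 1 := (sub_eq_zero.1 h).symm
  have h2 : ‖a‖ * ‖w‖ = 1 := by simpa using congrArg norm h1
  nlinarith [norm_nonneg a, norm_nonneg w]

theorem norm_moebius_lt_one {a w : ℂ} (ha : ‖a‖ < 1) (hw : ‖w‖ < 1) :
    ‖(w - a) * (1 - starRingEnd ℂ a * w)⁻¹‖ < 1 := by
  have hne := one_sub_conj_mul_ne_zero ha hw
  rw [norm_mul, norm_inv, mul_inv_lt_iff₀ (norm_pos_iff.2 hne), one_mul]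
  refine lt_of_pow_lt_pow_left₀ 2 (norm_nonneg _) ?_
  have key : ‖1 - starRingEnd ℂ a * w‖ ^ 2 - ‖w - a‖ ^ 2 = (1 - ‖a‖ ^ 2) * (1 - ‖w‖ ^ 2) := by
    simp only [Complex.sq_norm, Complex.normSq_apply, Complex.sub_re, Complex.sub_im, Complex.mul_re,
      Complex.mul_im, Complex.conj_re, Complex.conj_im, Complex.one_re, Complex.one_im]
    ring
  have h1 : 0 < (1 - ‖a‖ ^ 2) * (1 - ‖w‖ ^ 2) := by
    apply mul_pos <;> nlinarith [norm_nonneg a, norm_nonneg w]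
  linarith

theorem one_sub_conj_mul_self_ne_zero {a : ℂ} (ha : ‖a‖ < 1) : 1 - starRingEnd ℂ a * a ≠ 0 :=
  one_sub_conj_mul_ne_zero ha ha

theorem IsDiskEmbedding.hasDerivAt {U : Set ℂ} (hU : IsOpen U) {f : ℂ → ℂ}
    (hf : IsDiskEmbedding U f) {z : ℂ} (hz : z ∈ U) : HasDerivAt f (deriv f z) z :=
  ((hf.approx.differentiableOn hU).differentiableAt (hU.mem_nhds hz)).hasDerivAt

theorem IsDiskEmbedding.hasDerivAt_moebius {U : Set ℂ} (hU : IsOpen U) {f : ℂ → ℂ}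
    (hf : IsDiskEmbedding U f) {a : ℂ} (ha : ‖a‖ < 1) {z : ℂ} (hz : z ∈ U) :
    HasDerivAt (fun z => (f z - a) * (1 - starRingEnd ℂ a * f z)⁻¹)
      (deriv f z * (1 - starRingEnd ℂ a * a) / (1 - starRingEnd ℂ a * f z) ^ 2) z := by
  have hne := one_sub_conj_mul_ne_zero ha (hf.mapsTo z hz)
  have h1 := hf.hasDerivAt hU hz
  have h2 := (h1.sub_const a).mul (((h1.const_mul (starRingEnd ℂ a)).const_sub 1).inv hne)
  refine HasDerivAt.congr_deriv (f' := _) h2 ?_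
  simp only [Pi.inv_apply]
  field_simp
  ring

theorem IsDiskEmbedding.moebius {U : Set ℂ} (hU : IsOpen U) (hc : ConnectedToInfinity Uᶜ)
    {f : ℂ → ℂ} (hf : IsDiskEmbedding U f) {a : ℂ} (ha : ‖a‖ < 1) :
    IsDiskEmbedding U fun z => (f z - a) * (1 - starRingEnd ℂ a * f z)⁻¹ where
  approx := (hf.approx.sub (.const U a)).mul
    (((PolyApproxOn.const U 1).sub ((PolyApproxOn.const U _).mul hf.approx)).inv hU hc
      fun z hz => one_sub_conj_mul_ne_zero ha (hf.mapsTo z hz))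
  injOn z hz w hw h := by
    have h1 := one_sub_conj_mul_ne_zero ha (hf.mapsTo z hz)
    have h2 := one_sub_conj_mul_ne_zero ha (hf.mapsTo w hw)
    have h3 := one_sub_conj_mul_self_ne_zero ha
    refine hf.injOn hz hw ?_
    simp only at h
    rw [← div_eq_mul_inv, ← div_eq_mul_inv, div_eq_div_iff h1 h2] at h
    have : (f z - f w) * (1 - starRingEnd ℂ a * a) = 0 := by linear_combination h
    exact sub_eq_zero.1 ((mul_eq_zero.1 this).resolve_right h3)
  mapsTo z hz := norm_moebius_lt_one ha (hf.mapsTo z hz)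
  deriv_ne_zero z hz := by
    rw [(hf.hasDerivAt_moebius hU ha hz).deriv]
    exact div_ne_zero (mul_ne_zero (hf.deriv_ne_zero z hz) (one_sub_conj_mul_self_ne_zero ha))
      (pow_ne_zero _ (one_sub_conj_mul_ne_zero ha (hf.mapsTo z hz)))

theorem deriv_eq_of_mul_self_eq {U : Set ℂ} (hU : IsOpen U) {f s : ℂ → ℂ}
    (hs : DifferentiableOn ℂ s U) (h : ∀ z ∈ U, s z * s z = f z) {z : ℂ} (hz : z ∈ U) :
    deriv f z = 2 * s z * deriv s z := by
  have h1 := (hs.differentiableAt (hU.mem_nhds hz)).hasDerivAt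
  have h2 : f =ᶠ[𝓝 z] s * s := by
    filter_upwards [hU.mem_nhds hz] with w hw using (h w hw).symm
  rw [h2.deriv_eq, (h1.mul h1).deriv]
  ring

theorem IsDiskEmbedding.sqrt {U : Set ℂ} (hU : IsOpen U)
    {f s : ℂ → ℂ} (hf : IsDiskEmbedding U f) (hs : PolyApproxOn U s)
    (h : ∀ z ∈ U, s z * s z = f z) : IsDiskEmbedding U s where
  approx := hs
  injOn z hz w hw hzw := hf.injOn hz hw (by rw [← h z hz, ← h w hw, hzw])
  mapsTo z hz := by
    have h1 := hf.mapsTo z hz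
    rw [← h z hz, norm_mul] at h1
    nlinarith [norm_nonneg (s z)]
  deriv_ne_zero z hz h0 := hf.deriv_ne_zero z hz (by
    rw [deriv_eq_of_mul_self_eq hU (hs.differentiableOn hU) h hz, h0, mul_zero])

theorem exists_isDiskEmbedding {U : Set ℂ} (hU : IsOpen U) (hUc : IsConnected U)
    (hne : U ≠ univ) (hc : ConnectedToInfinity Uᶜ) : ∃ f, IsDiskEmbedding U f := by
  obtain ⟨a, ha⟩ := (ne_univ_iff_exists_notMem U).1 hne
  obtain ⟨z₀, hz₀⟩ := hUc.nonempty
  have h0 : ∀ z ∈ U, z - a ≠ 0 := fun z hz h => ha (sub_eq_zero.1 h ▸ hz)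
  obtain ⟨s, hs, hs2⟩ := ((PolyApproxOn.id U).sub (.const U a)).exists_sqrt hU hUc.isPreconnected hc h0
  have hsd := hs.differentiableOn hU
  have hs0 : ∀ z ∈ U, s z ≠ 0 := fun z hz h => h0 z hz (by rw [← hs2 z hz, h, zero_mul])
  have hder : ∀ z ∈ U, deriv s z ≠ 0 := fun z hz h => by
    have := deriv_eq_of_mul_self_eq hU hsd hs2 hz
    rw [h, mul_zero] at this
    simp at this
  have hsn : ∀ z ∈ U, ∀ w ∈ U, s z = s w ∨ s z = -s w → z = w := fun z hz w hw h => by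
    have : s z * s z = s w * s w := by rcases h with h | h <;> simp [h]
    rw [hs2 z hz, hs2 w hw] at this
    exact sub_left_injective this
  have himg : s '' U ∈ 𝓝 (s z₀) := by
    rw [← ((hsd.analyticAt (hU.mem_nhds hz₀)).hasStrictDerivAt).map_nhds_eq (hder z₀ hz₀)]
    exact image_mem_map (hU.mem_nhds hz₀)
  obtain ⟨ε, hε, hball⟩ := nhds_basis_ball.mem_iff.1 himg
  have hfar : ∀ z ∈ U, ε ≤ ‖s z + s z₀‖ := fun z hz => by
    by_contra! hlt
    obtain ⟨w, hw, hwz⟩ := hball (show -s z ∈ ball (s z₀) ε by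
      rwa [mem_ball_iff_norm, ← neg_add', norm_neg])
    have := hsn w hw z hz (.inr hwz)
    subst this
    exact hs0 w hw (by linear_combination hwz / 2)
  have hne0 : ∀ z ∈ U, s z + s z₀ ≠ 0 := fun z hz => norm_pos_iff.1 (hε.trans_le (hfar z hz))
  have hε' : ((ε / 2 : ℝ) : ℂ) ≠ 0 := by exact_mod_cast (by positivity : ε / 2 ≠ 0)
  refine ⟨fun z => ((ε / 2 : ℝ) : ℂ) * (s z + s z₀)⁻¹, (PolyApproxOn.const U _).mul
    ((hs.add (.const U _)).inv hU hc hne0), fun z hz w hw h => ?_, fun z hz => ?_, fun z hz => ?_⟩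
  · exact hsn z hz w hw (.inl (add_left_injective _ (inv_injective (mul_left_cancel₀ hε' h))))
  · rw [norm_mul, norm_inv, mul_inv_lt_iff₀ (norm_pos_iff.2 (hne0 z hz)), one_mul, Complex.norm_real,
      Real.norm_of_nonneg (by positivity)]
    linarith [hfar z hz]
  · have h1 := (hsd.differentiableAt (hU.mem_nhds hz)).hasDerivAt
    have h2 := ((h1.add_const (s z₀)).inv (hne0 z hz)).const_mul ((ε / 2 : ℝ) : ℂ)
    have h3 : deriv (fun z => ((ε / 2 : ℝ) : ℂ) * (s z + s z₀)⁻¹) z = _ := h2.deriv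
    rw [h3]
    exact mul_ne_zero hε' (div_ne_zero (neg_ne_zero.2 (hder z hz)) (pow_ne_zero _ (hne0 z hz)))

theorem exists_isDiskEmbedding_maximal {U : Set ℂ} (hU : IsOpen U) (hUc : IsConnected U)
    (hne : U ≠ univ) (hc : ConnectedToInfinity Uᶜ) {p : ℂ} (hp : p ∈ U) :
    ∃ f, IsDiskEmbedding U f ∧ ∀ g, IsDiskEmbedding U g → ‖deriv g p‖ ≤ ‖deriv f p‖ := by
  let S : Set ℝ := (fun f => ‖deriv f p‖) '' {f | IsDiskEmbedding U f}
  obtain ⟨f₀, hf₀⟩ := exists_isDiskEmbedding hU hUc hne hc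
  have hS : S.Nonempty := ⟨_, f₀, hf₀, rfl⟩
  obtain ⟨r, hr, hb⟩ := nhds_basis_closedBall.mem_iff.1 (hU.mem_nhds hp)
  have hbdd : BddAbove S := by
    refine ⟨1 / r, ?_⟩
    rintro _ ⟨f, hf, rfl⟩
    have hd := (hf.approx.differentiableOn hU)
    refine Complex.norm_deriv_le_of_forall_mem_sphere_norm_le hr ⟨?_, ?_⟩
      fun w hw => (hf.mapsTo w (hb (sphere_subset_closedBall hw))).le
    · exact hd.mono (ball_subset_closedBall.trans hb)
    · rw [closure_ball _ hr.ne']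
      exact hd.continuousOn.mono hb
  obtain ⟨u, -, hu, huS⟩ := exists_seq_tendsto_sSup hS hbdd
  choose F hF hFu using huS
  let l : Ultrafilter ℕ := Ultrafilter.of atTop
  have hFd : ∀ n, DifferentiableOn ℂ (F n) U := fun n => (hF n).approx.differentiableOn hU
  obtain ⟨f, hf⟩ := exists_tendstoLocallyUniformlyOn_of_bounded l hU hFd
    fun n z hz => ((hF n).mapsTo z hz).le
  have hfd : DifferentiableOn ℂ f U := hf.differentiableOn (.of_forall hFd) hU
  have hderiv := hf.deriv (.of_forall hFd) hU
  have hM : ‖deriv f p‖ = sSup S := by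
    refine tendsto_nhds_unique (hderiv.tendsto_at hp).norm ?_
    simp only [Function.comp_apply]
    exact (hu.mono_left (Ultrafilter.of_le atTop)).congr fun n => (hFu n).symm
  have hM0 : deriv f p ≠ 0 := norm_pos_iff.1 (by
    rw [hM]
    exact (norm_pos_iff.2 (hf₀.deriv_ne_zero p hp)).trans_le (le_csSup hbdd ⟨f₀, hf₀, rfl⟩))
  have hd0 : ∀ z ∈ U, deriv f z ≠ 0 := fun z hz h0 =>
    hM0 (eqOn_zero_of_tendsto_ne_zero hU hUc.isPreconnected (fun n => (hFd n).deriv hU)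
      (fun n => (hF n).deriv_ne_zero) hderiv hz h0 p hp)
  have hle : ∀ z ∈ U, ‖f z‖ ≤ 1 := fun z hz => le_of_tendsto (hf.tendsto_at hz).norm
    (.of_forall fun n => ((hF n).mapsTo z hz).le)
  refine ⟨f, ⟨.of_tendsto hU (.of_forall fun n => (hF n).approx) hf,
    injOn_of_tendsto_injOn hU hUc.isPreconnected hFd (fun n => (hF n).injOn) hf hp hM0,
    fun z hz => (hle z hz).lt_of_ne fun h1 => ?_, hd0⟩,
    fun g hg => hM ▸ le_csSup hbdd ⟨g, hg, rfl⟩⟩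
  have hconst := Complex.eqOn_of_isPreconnected_of_isMaxOn_norm hUc.isPreconnected hU hfd hz
    fun w hw => (by simpa [h1] using hle w hw)
  refine hd0 z hz ?_
  have : f =ᶠ[𝓝 z] fun _ => f z := eventually_of_mem (hU.mem_nhds hz) hconst
  rw [this.deriv_eq]
  simp

theorem exists_isDiskEmbedding_surjOn {U : Set ℂ} (hU : IsOpen U) (hUc : IsConnected U)
    (hne : U ≠ univ) (hc : ConnectedToInfinity Uᶜ) :
    ∃ f, IsDiskEmbedding U f ∧ ∀ w, ‖w‖ < 1 → ∃ z ∈ U, f z = w := by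
  obtain ⟨p, hp⟩ := hUc.nonempty
  obtain ⟨f, hf, hmax⟩ := exists_isDiskEmbedding_maximal hU hUc hne hc hp
  have hfp : f p = 0 := by
    by_contra h0
    have ha := hf.mapsTo p hp
    have hm := hmax _ (hf.moebius hU hc ha)
    rw [(hf.hasDerivAt_moebius hU ha hp).deriv, sq, ← div_div, mul_div_assoc,
      div_self (one_sub_conj_mul_self_ne_zero ha), mul_one, norm_div] at hm
    have h1 : ‖1 - starRingEnd ℂ (f p) * f p‖ = 1 - ‖f p‖ ^ 2 := by
      rw [Complex.conj_mul', ← Complex.ofReal_pow, ← Complex.ofReal_one, ← Complex.ofReal_sub,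
        Complex.norm_real, Real.norm_of_nonneg]
      nlinarith [norm_nonneg (f p)]
    have h2 : 0 < ‖f p‖ := norm_pos_iff.2 h0
    have h3 : 0 < ‖deriv f p‖ := norm_pos_iff.2 (hf.deriv_ne_zero p hp)
    rw [h1, div_le_iff₀ (by nlinarith)] at hm
    nlinarith [mul_pos h3 (pow_pos h2 2)]
  refine ⟨f, hf, fun a ha => ?_⟩
  by_contra! hna
  have hg := hf.moebius hU hc ha
  have hg0 : ∀ z ∈ U, (f z - a) * (1 - starRingEnd ℂ a * f z)⁻¹ ≠ 0 := fun z hz =>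
    mul_ne_zero (sub_ne_zero.2 (hna z hz))
      (inv_ne_zero (one_sub_conj_mul_ne_zero ha (hf.mapsTo z hz)))
  obtain ⟨s, hs, hs2⟩ := hg.approx.exists_sqrt hU hUc.isPreconnected hc hg0
  have hse := hg.sqrt hU hs hs2
  have hb := hse.mapsTo p hp
  have hm := hmax _ (hse.moebius hU hc hb)
  rw [(hse.hasDerivAt_moebius hU hb hp).deriv] at hm
  have hd := deriv_eq_of_mul_self_eq hU (hs.differentiableOn hU) hs2 hp
  rw [(hf.hasDerivAt_moebius hU ha hp).deriv] at hd
  have hsp := hs2 p hp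
  simp only [hfp, mul_zero, sub_zero, inv_one, mul_one, zero_sub, one_pow, div_one] at hd hsp
  have hconj : ∀ w : ℂ, ‖w‖ < 1 → ‖1 - starRingEnd ℂ w * w‖ = 1 - ‖w‖ ^ 2 := fun w hw => by
    rw [Complex.conj_mul', ← Complex.ofReal_pow, ← Complex.ofReal_one, ← Complex.ofReal_sub,
      Complex.norm_real, Real.norm_of_nonneg]
    nlinarith [norm_nonneg w]
  have hna' : ‖s p‖ ^ 2 = ‖a‖ := by
    rw [sq, ← norm_mul, hsp, norm_neg]
  have hd' := congrArg norm hd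
  rw [norm_mul, hconj a ha, norm_mul, norm_mul, Complex.norm_ofNat, ← hna'] at hd'
  rw [norm_div, norm_mul, norm_pow, hconj _ hb] at hm
  have hb0 : 0 < ‖s p‖ := norm_pos_iff.2 fun h => hg0 p hp (by rw [← hs2 p hp, h, zero_mul])
  have hD : 0 < ‖deriv f p‖ := norm_pos_iff.2 (hf.deriv_ne_zero p hp)
  generalize ‖s p‖ = b at *
  generalize ‖deriv f p‖ = D at *
  generalize ‖deriv s p‖ = E at *
  have h1 : 0 < 1 - b ^ 2 := by nlinarith
  rw [sq (1 - b ^ 2), ← div_div, mul_div_assoc, div_self h1.ne', mul_one, div_le_iff₀ h1] at hm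
  have h2 : D * (1 + b ^ 2) * (1 - b ^ 2) ≤ 2 * b * D * (1 - b ^ 2) := by nlinarith
  have h3 := le_of_mul_le_mul_right h2 h1
  have h4 : 0 < D * (1 - b) ^ 2 := mul_pos hD (pow_pos (by linarith) 2)
  nlinarith

/-- The Riemann mapping theorem for domains whose complement is connected to infinity. -/
theorem exists_riemann_map {U : Set ℂ} (hU : IsOpen U) (hUc : IsConnected U)
    (hne : U ≠ univ) (hc : ConnectedToInfinity Uᶜ) :
    ∃ ψ φ : ℂ → ℂ, DifferentiableOn ℂ ψ U ∧ DifferentiableOn ℂ φ (ball 0 1) ∧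
      MapsTo ψ U (ball 0 1) ∧ MapsTo φ (ball 0 1) U ∧ (∀ z ∈ U, φ (ψ z) = z) ∧
      ∀ w ∈ ball (0 : ℂ) 1, ψ (φ w) = w := by
  obtain ⟨ψ, hψ, hsurj⟩ := exists_isDiskEmbedding_surjOn hU hUc hne hc
  have hd := hψ.approx.differentiableOn hU
  have hsurj' : ∀ w, ∃ z, w ∈ ball (0 : ℂ) 1 → z ∈ U ∧ ψ z = w := fun w => by
    by_cases hw : w ∈ ball (0 : ℂ) 1
    · obtain ⟨z, hz, h⟩ := hsurj w (by simpa using hw)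
      exact ⟨z, fun _ => ⟨hz, h⟩⟩
    · exact ⟨0, fun h => (hw h).elim⟩
  choose φ hφ using hsurj'
  have hψm : MapsTo ψ U (ball 0 1) := fun z hz => by simpa using hψ.mapsTo z hz
  have hφψ : ∀ z ∈ U, φ (ψ z) = z := fun z hz =>
    hψ.injOn (hφ _ (hψm hz)).1 hz (hφ _ (hψm hz)).2
  refine ⟨ψ, φ, hd, fun w hw => ?_, hψm, fun w hw => (hφ w hw).1, hφψ, fun w hw => (hφ w hw).2⟩
  obtain ⟨hz, hzw⟩ := hφ w hw
  have hstr := (hd.analyticAt (hU.mem_nhds hz)).hasStrictDerivAt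
  have hcont : ContinuousAt φ w := by
    intro N hN
    have h1 : ψ '' (N ∩ U) ∈ 𝓝 w := by
      conv => rw [← hzw]
      rw [← hstr.map_nhds_eq (hψ.deriv_ne_zero _ hz)]
      exact image_mem_map (inter_mem hN (hU.mem_nhds hz))
    rw [mem_map]
    refine mem_of_superset h1 ?_
    rintro _ ⟨z, ⟨hzN, hzU⟩, rfl⟩
    rwa [mem_preimage, hφψ z hzU]
  refine (HasDerivAt.of_local_left_inverse hcont hstr.hasDerivAt (hψ.deriv_ne_zero _ hz)
    ?_).differentiableAt.differentiableWithinAt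
  filter_upwards [isOpen_ball.mem_nhds hw] with v hv using (hφ v hv).2

end LineAlexander

namespace LineAlexander
open Set Filter Topology Metric MeasureTheory

/-- A density on the plane of finite total mass. -/
noncomputable def logDensity (w : ℂ) : ℝ := (‖w‖ ^ 2 * (1 + Real.log ‖w‖ ^ 2))⁻¹

/-- Distance to the origin in the singular metric of density `logDensity`. -/
noncomputable def logHeight (w : ℂ) : ℝ := Real.arsinh (Real.log ‖w‖)

theorem logDensity_nonneg (w : ℂ) : 0 ≤ logDensity w := by
  unfold logDensity; positivity

theorem lintegral_logDensity_lt_top : ∫⁻ w : ℂ, ENNReal.ofReal (logDensity w) < ⊤ := by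
  rw [← Complex.lintegral_comp_polarCoord_symm]
  set G : ℝ → ENNReal := fun r => ENNReal.ofReal r * ENNReal.ofReal ((r ^ 2 * (1 + Real.log r ^ 2))⁻¹)
    with hG
  have hGm : Measurable G := by rw [hG]; fun_prop
  have h1 : ∀ p ∈ polarCoord.target, ENNReal.ofReal p.1 •
      ENNReal.ofReal (logDensity (Complex.polarCoord.symm p)) = G p.1 * 1 := by
    intro p hp
    have hp1 : 0 < p.1 := hp.1
    simp only [logDensity, Complex.norm_polarCoord_symm, abs_of_pos hp1, hG, smul_eq_mul, mul_one]
  rw [setLIntegral_congr_fun polarCoord.open_target.measurableSet h1]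
  change ∫⁻ p in Ioi (0 : ℝ) ×ˢ Ioo (-Real.pi) Real.pi, G p.1 * 1 < ⊤
  rw [Measure.volume_eq_prod, ← Measure.prod_restrict,
    lintegral_prod_mul (f := G) (g := fun _ => (1 : ENNReal)) hGm.aemeasurable aemeasurable_const]
  refine ENNReal.mul_lt_top ?_ ?_
  · have hexp : Real.exp '' univ = Ioi 0 := by rw [image_univ, Real.range_exp]
    rw [← hexp, lintegral_image_eq_lintegral_abs_deriv_mul MeasurableSet.univ
      (fun x _ => (Real.hasDerivAt_exp x).hasDerivWithinAt) Real.exp_injective.injOn]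
    have h2 : ∀ x : ℝ, ENNReal.ofReal |Real.exp x| * G (Real.exp x)
        = ENNReal.ofReal ((1 + x ^ 2)⁻¹) := by
      intro x
      have := Real.exp_pos x
      simp only [hG, Real.log_exp, abs_of_pos this]
      rw [← ENNReal.ofReal_mul this.le, ← ENNReal.ofReal_mul this.le]
      congr 1
      field_simp
    simp only [h2, Measure.restrict_univ]
    exact integrable_inv_one_add_sq.lintegral_lt_top
  · simp

theorem ofReal_le_lintegral_sq {γ γ' g : ℝ → ℝ} {a b M : ℝ}
    (hγ : ∀ θ ∈ Ioo a b, HasDerivAt γ (γ' θ) θ) (hle : ∀ θ ∈ Ioo a b, |γ' θ| ≤ g θ)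
    (hg : ContinuousOn g (Ioo a b)) (hM : 0 < M)
    (hex : ∃ x ∈ Ioo a b, ∃ y ∈ Ioo a b, M ≤ |γ x - γ y|) :
    ENNReal.ofReal (M ^ 2 / (b - a)) ≤ ∫⁻ θ in Ioo a b, ENNReal.ofReal (g θ ^ 2) := by
  obtain ⟨x, hx, y, hy, hxy⟩ := hex
  wlog hlt : x ≤ y generalizing x y
  · exact this y hy x hx (by rwa [abs_sub_comm]) (le_of_not_ge hlt)
  have hab : a < b := hx.1.trans hx.2
  have hsub : Icc x y ⊆ Ioo a b := fun z hz => ⟨hx.1.trans_le hz.1, hz.2.trans_lt hy.2⟩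
  set c := M / (b - a) with hc
  have hc0 : 0 < c := div_pos hM (sub_pos.2 hab)
  have hg2 : ContinuousOn (fun θ => g θ ^ 2) (Icc x y) := (hg.mono hsub).pow 2
  have h_inter : IntegrableOn (fun θ => g θ ^ 2) (Icc x y) := hg2.integrableOn_Icc
  have hφ : ContinuousOn (fun θ => c / 2 + g θ ^ 2 / (2 * c)) (Icc x y) :=
    continuousOn_const.add (hg2.div_const _)
  have amgm : ∀ θ ∈ Ioo x y, |γ' θ| ≤ c / 2 + g θ ^ 2 / (2 * c) := by
    intro θ hθ
    refine (hle θ (hsub (Ioo_subset_Icc_self hθ))).trans ?_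
    have : c / 2 + g θ ^ 2 / (2 * c) - g θ = (g θ - c) ^ 2 / (2 * c) := by field_simp; ring
    have : 0 ≤ (g θ - c) ^ 2 / (2 * c) := by positivity
    linarith
  have hγc : ContinuousOn γ (Icc x y) := fun z hz => (hγ z (hsub hz)).continuousAt.continuousWithinAt
  have up : γ y - γ x ≤ ∫ θ in x..y, (c / 2 + g θ ^ 2 / (2 * c)) :=
    intervalIntegral.sub_le_integral_of_hasDeriv_right_of_le hlt hγc
      (fun z hz => (hγ z (hsub (Ioo_subset_Icc_self hz))).hasDerivWithinAt) hφ.integrableOn_Icc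
      (fun z hz => (le_abs_self _).trans (amgm z hz))
  have dn : -γ y - -γ x ≤ ∫ θ in x..y, (c / 2 + g θ ^ 2 / (2 * c)) :=
    intervalIntegral.sub_le_integral_of_hasDeriv_right_of_le (g := fun z => - γ z) hlt hγc.neg
      (fun z hz => (hγ z (hsub (Ioo_subset_Icc_self hz))).neg.hasDerivWithinAt) hφ.integrableOn_Icc
      (fun z hz => (neg_le_abs _).trans (amgm z hz))
  have hMle : M ≤ ∫ θ in x..y, (c / 2 + g θ ^ 2 / (2 * c)) :=
    hxy.trans (abs_le.2 ⟨by linarith, by linarith⟩)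
  rw [intervalIntegral.integral_add (by simp)
    ((hg2.div_const _).intervalIntegrable_of_Icc hlt), intervalIntegral.integral_const,
    intervalIntegral.integral_div, smul_eq_mul] at hMle
  set I := ∫ θ in x..y, g θ ^ 2 with hI
  have h1 : (y - x) * (c / 2) ≤ M / 2 := by
    have : M / 2 = (b - a) * (c / 2) := by
      rw [hc]; field_simp [(sub_pos.2 hab).ne']
    rw [this]
    exact mul_le_mul_of_nonneg_right (by linarith [hx.1, hy.2]) (by positivity)
  have h2 : M ^ 2 / (b - a) ≤ I := by
    have h3 : M / 2 ≤ I / (2 * c) := by linarith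
    rw [le_div_iff₀ (by positivity)] at h3
    calc M ^ 2 / (b - a) = M / 2 * (2 * c) := by rw [hc]; ring
      _ ≤ I := h3
  refine (ENNReal.ofReal_le_ofReal h2).trans ?_
  rw [hI, intervalIntegral.integral_of_le hlt, ofReal_integral_eq_lintegral_ofReal
    (h_inter.mono_set Ioc_subset_Icc_self) (Eventually.of_forall fun _ => sq_nonneg _)]
  exact lintegral_mono_set (Ioc_subset_Icc_self.trans hsub)

theorem abs_deriv_logHeight_le {f : ℝ → ℂ} {f' : ℂ} {t : ℝ} (hf : HasDerivAt f f' t)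
    (h0 : f t ≠ 0) : ∃ d, HasDerivAt (fun s => logHeight (f s)) d t ∧
      |d| ≤ ‖f'‖ * √(logDensity (f t)) := by
  have hn : 0 < ‖f t‖ := norm_pos_iff.2 h0
  have h1 : HasDerivAt (fun s => ‖f s‖ ^ 2) (2 * inner ℝ (f t) f') t := hf.norm_sq
  have h2 := (h1.log (by positivity)).div_const 2
  have h3 : HasDerivAt (fun s => Real.log ‖f s‖) (2 * inner ℝ (f t) f' / ‖f t‖ ^ 2 / 2) t := by
    refine h2.congr_of_eventuallyEq (Eventually.of_forall fun s => ?_)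
    simp [Real.log_pow]
  refine ⟨_, h3.arsinh, ?_⟩
  have hs : √(logDensity (f t)) = ‖f t‖⁻¹ * (√(1 + Real.log ‖f t‖ ^ 2))⁻¹ := by
    rw [logDensity, Real.sqrt_inv, Real.sqrt_mul (by positivity), Real.sqrt_sq hn.le, mul_inv]
  rw [hs, smul_eq_mul, abs_mul, abs_of_nonneg (by positivity : (0:ℝ) ≤ (√(1 + Real.log ‖f t‖ ^ 2))⁻¹)]
  have h4 : |2 * inner ℝ (f t) f' / ‖f t‖ ^ 2 / 2| ≤ ‖f'‖ * ‖f t‖⁻¹ := by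
    have : 2 * inner ℝ (f t) f' / ‖f t‖ ^ 2 / 2 = inner ℝ (f t) f' / ‖f t‖ ^ 2 := by ring
    rw [this, abs_div, abs_of_pos (by positivity : 0 < ‖f t‖ ^ 2), div_le_iff₀ (by positivity)]
    calc |inner ℝ (f t) f'| ≤ ‖f t‖ * ‖f'‖ := abs_real_inner_le_norm _ _
      _ = ‖f'‖ * ‖f t‖⁻¹ * ‖f t‖ ^ 2 := by field_simp
  calc _ ≤ (√(1 + Real.log ‖f t‖ ^ 2))⁻¹ * (‖f'‖ * ‖f t‖⁻¹) :=
        mul_le_mul_of_nonneg_left h4 (by positivity)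
    _ = _ := by ring

theorem det_restrictScalars_toSpanSingleton (c : ℂ) :
    ((ContinuousLinearMap.toSpanSingleton ℂ c).restrictScalars ℝ).det = ‖c‖ ^ 2 := by
  simp [ContinuousLinearMap.det, LinearMap.det_restrictScalars, Algebra.norm_complex_eq,
    Complex.normSq_eq_norm_sq]

theorem length_area_strip {Φ : ℂ → ℂ} {a b M : ℝ}
    (hΦ : DifferentiableOn ℂ Φ (Ioo a b ×ℂ Ioo 0 Real.pi))
    (hinj : InjOn Φ (Ioo a b ×ℂ Ioo 0 Real.pi))
    (h0 : ∀ w ∈ Ioo a b ×ℂ Ioo 0 Real.pi, Φ w ≠ 0) (hM : 0 < M)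
    (hex : ∀ s ∈ Ioo a b, ∃ x ∈ Ioo 0 Real.pi, ∃ y ∈ Ioo 0 Real.pi,
      M ≤ |logHeight (Φ ⟨s, x⟩) - logHeight (Φ ⟨s, y⟩)|) :
    ENNReal.ofReal (M ^ 2 / Real.pi) * ENNReal.ofReal (b - a) ≤
      ∫⁻ w : ℂ, ENNReal.ofReal (logDensity w) := by
  set S := Ioo a b ×ℂ Ioo 0 Real.pi with hS
  have hSo : IsOpen S := isOpen_Ioo.reProdIm isOpen_Ioo
  have hd : ∀ w ∈ S, HasDerivAt Φ (deriv Φ w) w := fun w hw =>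
    ((hΦ w hw).differentiableAt (hSo.mem_nhds hw)).hasDerivAt
  set g : ℂ → ℝ := fun w => ‖deriv Φ w‖ * √(logDensity (Φ w)) with hg
  have hgc : ContinuousOn g S := by
    have hdc : ContinuousOn (deriv Φ) S := (hΦ.deriv hSo).continuousOn
    have hn : ∀ w ∈ S, ‖Φ w‖ ≠ 0 := fun w hw => norm_ne_zero_iff.2 (h0 w hw)
    refine hdc.norm.mul (ContinuousOn.sqrt ?_)
    unfold logDensity
    refine ContinuousOn.inv₀ ((hΦ.continuousOn.norm.pow 2).mul
      (continuousOn_const.add ((hΦ.continuousOn.norm.log hn).pow 2))) fun w hw => ?_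
    have := hn w hw
    positivity
  have step1 : ∫⁻ w in Φ '' S, ENNReal.ofReal (logDensity w) =
      ∫⁻ w in S, ENNReal.ofReal (g w ^ 2) := by
    rw [lintegral_image_eq_lintegral_abs_det_fderiv_mul volume hSo.measurableSet
      (fun w hw => ((hd w hw).hasFDerivAt.restrictScalars ℝ).hasFDerivWithinAt) hinj]
    refine setLIntegral_congr_fun hSo.measurableSet fun w hw => ?_
    rw [det_restrictScalars_toSpanSingleton, abs_of_nonneg (by positivity),
      ← ENNReal.ofReal_mul (by positivity), hg]
    simp only []
    rw [mul_pow, Real.sq_sqrt (logDensity_nonneg _)]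
  have step2 : ∫⁻ w in S, ENNReal.ofReal (g w ^ 2) =
      ∫⁻ p in Ioo a b ×ˢ Ioo 0 Real.pi, ENNReal.ofReal (g ⟨p.1, p.2⟩ ^ 2) := by
    rw [← Complex.volume_preserving_equiv_real_prod.symm.setLIntegral_comp_preimage_emb
      Complex.measurableEquivRealProd.symm.measurableEmbedding]
    rfl
  have hmk : Continuous (fun p : ℝ × ℝ => (⟨p.1, p.2⟩ : ℂ)) :=
    Complex.equivRealProdCLM.symm.continuous
  have hcont : ContinuousOn (fun p : ℝ × ℝ => g ⟨p.1, p.2⟩ ^ 2) (Ioo a b ×ˢ Ioo 0 Real.pi) :=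
    (hgc.comp hmk.continuousOn (fun p hp => hp)).pow 2
  calc ENNReal.ofReal (M ^ 2 / Real.pi) * ENNReal.ofReal (b - a)
      = ∫⁻ s in Ioo a b, ENNReal.ofReal (M ^ 2 / Real.pi) := by simp
    _ ≤ ∫⁻ s in Ioo a b, ∫⁻ θ in Ioo 0 Real.pi, ENNReal.ofReal (g ⟨s, θ⟩ ^ 2) := by
      refine setLIntegral_mono' measurableSet_Ioo fun s hs => ?_
      have hline : ∀ θ : ℝ, HasDerivAt (fun θ : ℝ => (⟨s, θ⟩ : ℂ)) Complex.I θ := by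
        intro θ
        have h := ((Complex.ofRealCLM.hasDerivAt (x := θ)).mul_const Complex.I).const_add (s : ℂ)
        refine HasDerivAt.congr_deriv (f' := _) (h.congr_of_eventuallyEq
          (Eventually.of_forall fun θ => ?_)) (by simp)
        apply Complex.ext <;> simp
      have key : ∀ θ ∈ Ioo 0 Real.pi, ∃ d, HasDerivAt (fun θ : ℝ => logHeight (Φ ⟨s, θ⟩)) d θ ∧
          |d| ≤ g ⟨s, θ⟩ := by
        intro θ hθ
        have hw : (⟨s, θ⟩ : ℂ) ∈ S := ⟨hs, hθ⟩
        have h := (hd _ hw).comp_of_eq θ (hline θ) rfl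
        obtain ⟨d, hd1, hd2⟩ := abs_deriv_logHeight_le h (h0 _ hw)
        refine ⟨d, hd1, hd2.trans (le_of_eq ?_)⟩
        simp [hg]
      choose! d hd1 hd2 using key
      have := ofReal_le_lintegral_sq hd1 hd2 (hgc.comp
        (hmk.comp (Continuous.prodMk_right s)).continuousOn fun θ hθ => ⟨hs, hθ⟩) hM (hex s hs)
      simpa using this
    _ = ∫⁻ p in Ioo a b ×ˢ Ioo 0 Real.pi, ENNReal.ofReal (g ⟨p.1, p.2⟩ ^ 2) := by
      rw [Measure.volume_eq_prod, ← Measure.prod_restrict, lintegral_prod]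
      rw [Measure.prod_restrict]
      exact (hcont.aemeasurable (measurableSet_Ioo.prod measurableSet_Ioo)).ennreal_ofReal
    _ = ∫⁻ w in Φ '' S, ENNReal.ofReal (logDensity w) := by rw [step1, step2]
    _ ≤ _ := setLIntegral_le_lintegral _ _

end LineAlexander

namespace LineAlexander
open Set Filter Topology Metric MeasureTheory

/-- The Cayley transform from the upper half plane to the unit disk sending `0` to `ω`. -/
noncomputable def cayley (ω τ : ℂ) : ℂ := ω * (Complex.I - τ) / (Complex.I + τ)

theorem I_add_ne_zero {τ : ℂ} (h : 0 ≤ τ.im) : Complex.I + τ ≠ 0 := by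
  intro h0
  have := congrArg Complex.im h0
  simp at this
  linarith

theorem cayley_sub {ω τ : ℂ} (h : 0 ≤ τ.im) : cayley ω τ - ω = -2 * ω * τ / (Complex.I + τ) := by
  have := I_add_ne_zero h
  unfold cayley; field_simp; ring

theorem cayley_add {ω τ : ℂ} (h : 0 ≤ τ.im) :
    cayley ω τ + ω = 2 * ω * Complex.I / (Complex.I + τ) := by
  have := I_add_ne_zero h
  unfold cayley; field_simp; ring

theorem norm_cayley_sub {ω τ : ℂ} (h : 0 ≤ τ.im) :
    ‖cayley ω τ - ω‖ = ‖τ‖ * ‖cayley ω τ + ω‖ := by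
  rw [cayley_sub h, cayley_add h]
  simp
  ring

theorem norm_cayley_lt_one {ω τ : ℂ} (hω : ‖ω‖ = 1) (h : 0 < τ.im) : ‖cayley ω τ‖ < 1 := by
  have h1 := norm_pos_iff.2 (I_add_ne_zero h.le)
  rw [cayley, norm_div, norm_mul, hω, one_mul, div_lt_one h1]
  refine lt_of_pow_lt_pow_left₀ 2 h1.le ?_
  simp only [Complex.sq_norm, Complex.normSq_apply, Complex.sub_re, Complex.sub_im, Complex.add_re,
    Complex.add_im, Complex.I_re, Complex.I_im]
  nlinarith

theorem cayley_injOn {ω τ τ' : ℂ} (hω : ‖ω‖ = 1) (h : 0 ≤ τ.im) (h' : 0 ≤ τ'.im)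
    (heq : cayley ω τ = cayley ω τ') : τ = τ' := by
  have h0 : ω ≠ 0 := norm_ne_zero_iff.1 (by rw [hω]; exact one_ne_zero)
  have h1 := I_add_ne_zero h
  have h2 := I_add_ne_zero h'
  unfold cayley at heq
  rw [div_eq_div_iff h1 h2, mul_assoc, mul_assoc] at heq
  have h3 := mul_left_cancel₀ h0 heq
  have h4 : 2 * Complex.I * (τ - τ') = 0 := by linear_combination -h3
  rcases mul_eq_zero.1 h4 with h5 | h5
  · simp at h5
  · exact sub_eq_zero.1 h5

/-- The inverse Cayley transform. -/
noncomputable def cayleyInv (ω z : ℂ) : ℂ := -Complex.I * (z - ω) / (z + ω)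

theorem cayley_cayleyInv {ω z : ℂ} (hω : ‖ω‖ = 1) (hz : z + ω ≠ 0) :
    cayley ω (cayleyInv ω z) = z := by
  have h0 : ω ≠ 0 := norm_ne_zero_iff.1 (by rw [hω]; exact one_ne_zero)
  have h1 : Complex.I - cayleyInv ω z = 2 * Complex.I * z / (z + ω) := by
    unfold cayleyInv; field_simp; ring
  have h2 : Complex.I + cayleyInv ω z = 2 * Complex.I * ω / (z + ω) := by
    unfold cayleyInv; field_simp; ring
  rw [cayley, h1, h2]
  have := Complex.I_ne_zero
  field_simp

theorem cayleyInv_im {ω z : ℂ} (hω : ‖ω‖ = 1) (hz : z + ω ≠ 0) :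
    (cayleyInv ω z).im = (1 - ‖z‖ ^ 2) / ‖z + ω‖ ^ 2 := by
  have h1 : 1 = ω.re * ω.re + ω.im * ω.im := by
    rw [← Complex.normSq_apply, Complex.normSq_eq_norm_sq, hω]; norm_num
  have h2 : Complex.normSq (z + ω) ≠ 0 := (Complex.normSq_pos.2 hz).ne'
  rw [cayleyInv, Complex.div_im, Complex.sq_norm, Complex.sq_norm, ← sub_div]
  congr 1
  simp only [Complex.normSq_apply z, Complex.mul_im, Complex.mul_re, Complex.neg_re, Complex.neg_im, Complex.I_re, Complex.I_im,
    Complex.sub_re, Complex.sub_im, Complex.add_re, Complex.add_im]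
  linear_combination -h1

theorem norm_cayleyInv {ω z : ℂ} : ‖cayleyInv ω z‖ = ‖z - ω‖ / ‖z + ω‖ := by
  simp [cayleyInv]

/-- The point of the closed disk on the circle arc of Apollonius of ratio `exp s` around `ω`, at
angle `θ`. -/
noncomputable def arcPoint (ω : ℂ) (s θ : ℝ) : ℂ := cayley ω (Complex.exp ⟨s, θ⟩)

theorem exp_im_pos {s θ : ℝ} (h : θ ∈ Ioo 0 Real.pi) : 0 < (Complex.exp ⟨s, θ⟩).im := by
  rw [Complex.exp_im]
  exact mul_pos (Real.exp_pos _) (Real.sin_pos_of_mem_Ioo h)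

theorem exp_im_nonneg {s θ : ℝ} (h : θ ∈ Icc 0 Real.pi) : 0 ≤ (Complex.exp ⟨s, θ⟩).im := by
  rw [Complex.exp_im]
  exact mul_nonneg (Real.exp_pos _).le (Real.sin_nonneg_of_mem_Icc h)

theorem arcPoint_mem_ball {ω : ℂ} (hω : ‖ω‖ = 1) {s θ : ℝ} (h : θ ∈ Ioo 0 Real.pi) :
    arcPoint ω s θ ∈ ball (0 : ℂ) 1 := by
  rw [mem_ball_zero_iff]
  exact norm_cayley_lt_one hω (exp_im_pos h)

theorem norm_arcPoint_sub {ω : ℂ} {s θ : ℝ} (h : θ ∈ Icc 0 Real.pi) :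
    ‖arcPoint ω s θ - ω‖ = Real.exp s * ‖arcPoint ω s θ + ω‖ := by
  rw [arcPoint, norm_cayley_sub (exp_im_nonneg h), Complex.norm_exp]

theorem add_ne_zero_of_norm_sub_eq {ω z : ℂ} (hω : ‖ω‖ = 1) {r : ℝ}
    (h : ‖z - ω‖ = r * ‖z + ω‖) : z + ω ≠ 0 := by
  intro h0
  rw [h0, norm_zero, mul_zero, norm_eq_zero, sub_eq_zero] at h
  rw [h, ← two_mul, mul_eq_zero] at h0
  rcases h0 with h0 | h0
  · norm_num at h0
  · rw [h0, norm_zero] at hω; norm_num at hω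

theorem exists_arcPoint_eq {ω z : ℂ} (hω : ‖ω‖ = 1) {r : ℝ} (hr : 0 < r)
    (h : ‖z - ω‖ = r * ‖z + ω‖) (hz : ‖z‖ ≤ 1) :
    ∃ θ ∈ Icc 0 Real.pi, arcPoint ω (Real.log r) θ = z ∧ (‖z‖ < 1 → θ ∈ Ioo 0 Real.pi) := by
  have hne := add_ne_zero_of_norm_sub_eq hω h
  have hn := norm_pos_iff.2 hne
  have him := cayleyInv_im hω hne
  have hnorm : ‖cayleyInv ω z‖ = r := by
    rw [norm_cayleyInv, h]; field_simp
  have h0 : cayleyInv ω z ≠ 0 := norm_ne_zero_iff.1 (by rw [hnorm]; exact hr.ne')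
  have him0 : 0 ≤ (cayleyInv ω z).im := by
    rw [him]; exact div_nonneg (by nlinarith [norm_nonneg z]) (by positivity)
  refine ⟨(cayleyInv ω z).arg, ⟨Complex.arg_nonneg_iff.2 him0, Complex.arg_le_pi _⟩, ?_, fun hz1 => ?_⟩
  · rw [arcPoint]
    have : (⟨Real.log r, (cayleyInv ω z).arg⟩ : ℂ) = Complex.log (cayleyInv ω z) := by
      apply Complex.ext
      · rw [Complex.log_re, hnorm]
      · rw [Complex.log_im]
    rw [this, Complex.exp_log h0, cayley_cayleyInv hω hne]
  · have him1 : 0 < (cayleyInv ω z).im := by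
      rw [him]; exact div_pos (by nlinarith [norm_nonneg z]) (by positivity)
    refine ⟨lt_of_le_of_ne (Complex.arg_nonneg_iff.2 him0) fun h => ?_,
      lt_of_le_of_ne (Complex.arg_le_pi _) fun h => ?_⟩
    · exact him1.ne ((Complex.arg_eq_zero_iff.1 h.symm).2).symm
    · exact him1.ne ((Complex.arg_eq_pi_iff.1 h).2).symm

theorem continuousAt_arcPoint {ω : ℂ} {s θ : ℝ} (h : θ ∈ Icc 0 Real.pi) :
    ContinuousAt (fun p : ℝ × ℝ => arcPoint ω p.1 p.2) (s, θ) := by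
  have hmk : Continuous (fun p : ℝ × ℝ => (⟨p.1, p.2⟩ : ℂ)) :=
    Complex.equivRealProdCLM.symm.continuous
  have h1 : ContinuousAt (fun p : ℝ × ℝ => Complex.exp ⟨p.1, p.2⟩) (s, θ) :=
    (Complex.continuous_exp.comp hmk).continuousAt
  unfold arcPoint cayley
  exact (continuousAt_const.mul (continuousAt_const.sub h1)).div (continuousAt_const.add h1)
    (I_add_ne_zero (exp_im_nonneg h))

/-- Upper bound in the length-area inequality. -/
noncomputable def areaConst : ℝ :=
  Real.pi * (∫⁻ w : ℂ, ENNReal.ofReal (logDensity w)).toReal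

theorem length_area_disk {φ : ℂ → ℂ} (hφ : DifferentiableOn ℂ φ (ball 0 1))
    (hinj : InjOn φ (ball 0 1)) {x₀ : ℂ} (h0 : ∀ z ∈ ball (0 : ℂ) 1, φ z ≠ x₀) {ω : ℂ}
    (hω : ‖ω‖ = 1) {r₁ r₂ M : ℝ} (hr₁ : 0 < r₁) (hr : r₁ < r₂) (hM : 0 < M)
    (hex : ∀ r ∈ Ioo r₁ r₂, ∃ z₁ ∈ ball (0 : ℂ) 1, ∃ z₂ ∈ ball (0 : ℂ) 1,
      ‖z₁ - ω‖ = r * ‖z₁ + ω‖ ∧ ‖z₂ - ω‖ = r * ‖z₂ + ω‖ ∧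
      M ≤ |logHeight (φ z₁ - x₀) - logHeight (φ z₂ - x₀)|) :
    M ^ 2 * (Real.log r₂ - Real.log r₁) ≤ areaConst := by
  set S := Ioo (Real.log r₁) (Real.log r₂) ×ℂ Ioo 0 Real.pi with hS
  have hpos : ∀ w ∈ S, 0 < (Complex.exp w).im := fun w hw => exp_im_pos hw.2
  have hmaps : MapsTo (fun w => cayley ω (Complex.exp w)) S (ball 0 1) := fun w hw =>
    mem_ball_zero_iff.2 (norm_cayley_lt_one hω (hpos w hw))
  have hd : DifferentiableOn ℂ (fun w => cayley ω (Complex.exp w)) S := by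
    intro w hw
    unfold cayley
    have : DifferentiableAt ℂ Complex.exp w := Complex.differentiable_exp w
    exact (((this.const_sub Complex.I).const_mul ω).fun_div (this.const_add Complex.I)
      (I_add_ne_zero (hpos w hw).le)).differentiableWithinAt
  have hlt := Real.log_lt_log hr₁ hr
  have := length_area_strip (Φ := fun w => φ (cayley ω (Complex.exp w)) - x₀) (M := M)
    ((hφ.comp hd hmaps).sub_const _) (by
      intro w hw w' hw' heq
      have h1 := hinj (hmaps hw) (hmaps hw') (sub_left_injective heq)
      have h2 := cayley_injOn hω (hpos w hw).le (hpos w' hw').le h1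
      refine Complex.exp_inj_of_neg_pi_lt_of_le_pi ?_ ?_ ?_ ?_ h2
      · have : 0 < w.im := hw.2.1; linarith [Real.pi_pos]
      · exact hw.2.2.le
      · have : 0 < w'.im := hw'.2.1; linarith [Real.pi_pos]
      · exact hw'.2.2.le) (fun w hw => sub_ne_zero.2 (h0 _ (hmaps hw))) hM (by
      intro s hs
      have hs' : Real.exp s ∈ Ioo r₁ r₂ :=
        ⟨(Real.log_lt_iff_lt_exp hr₁).1 hs.1, (Real.lt_log_iff_exp_lt (hr₁.trans hr)).1 hs.2⟩
      obtain ⟨z₁, hz₁, z₂, hz₂, h1, h2, h3⟩ := hex _ hs'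
      rw [mem_ball_zero_iff] at hz₁ hz₂
      obtain ⟨x, -, hx, hx'⟩ := exists_arcPoint_eq hω (Real.exp_pos s) h1 hz₁.le
      obtain ⟨y, -, hy, hy'⟩ := exists_arcPoint_eq hω (Real.exp_pos s) h2 hz₂.le
      rw [Real.log_exp] at hx hy
      rw [arcPoint] at hx hy
      exact ⟨x, hx' hz₁, y, hy' hz₂, by simpa only [hx, hy] using h3⟩)
  rw [← ENNReal.ofReal_mul (by positivity),
    ENNReal.ofReal_le_iff_le_toReal lintegral_logDensity_lt_top.ne] at this
  unfold areaConst
  calc M ^ 2 * (Real.log r₂ - Real.log r₁)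
      = Real.pi * (M ^ 2 / Real.pi * (Real.log r₂ - Real.log r₁)) := by
        field_simp
    _ ≤ _ := mul_le_mul_of_nonneg_left this Real.pi_pos.le

end LineAlexander

namespace LineAlexander
open Set Filter Topology Metric

/-- A biholomorphism `ψ` from `U` to the unit disk with inverse `φ`, where `U` is a proper open set
which is uniformly locally connected at its frontier. -/
structure DiskChart (U : Set ℂ) (ψ φ : ℂ → ℂ) : Prop where
  isOpen : IsOpen U
  ne_univ : U ≠ univ
  locConn : LocConnAtFrontier U
  dψ : DifferentiableOn ℂ ψ U
  dφ : DifferentiableOn ℂ φ (ball 0 1)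
  mapsψ : MapsTo ψ U (ball 0 1)
  mapsφ : MapsTo φ (ball 0 1) U
  left : ∀ z ∈ U, φ (ψ z) = z
  right : ∀ w ∈ ball (0 : ℂ) 1, ψ (φ w) = w

variable {U : Set ℂ} {ψ φ : ℂ → ℂ}

theorem DiskChart.injOn (h : DiskChart U ψ φ) : InjOn φ (ball 0 1) := fun x hx y hy hxy => by
  rw [← h.right x hx, hxy, h.right y hy]

theorem DiskChart.continuousAt_φ (h : DiskChart U ψ φ) {w : ℂ} (hw : ‖w‖ < 1) :
    ContinuousAt φ w :=
  h.dφ.continuousOn.continuousAt (isOpen_ball.mem_nhds (mem_ball_zero_iff.2 hw))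

theorem DiskChart.continuousAt_ψ (h : DiskChart U ψ φ) {z : ℂ} (hz : z ∈ U) :
    ContinuousAt ψ z :=
  h.dψ.continuousOn.continuousAt (h.isOpen.mem_nhds hz)

theorem DiskChart.notMem_frontier (h : DiskChart U ψ φ) {x : ℂ} (hx : x ∈ U) : x ∉ frontier U := by
  rw [h.isOpen.frontier_eq]; exact fun hf => hf.2 hx

theorem DiskChart.norm_lim_eq_one (h : DiskChart U ψ φ) {x₀ ζ : ℂ} (hx₀ : x₀ ∉ U) {l : Filter ℂ}
    [l.NeBot] (hl : l ≤ 𝓝[U] x₀) (hψ : Tendsto ψ l (𝓝 ζ)) : ‖ζ‖ = 1 := by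
  have hU : ∀ᶠ z in l, z ∈ U := hl self_mem_nhdsWithin
  have hle : ‖ζ‖ ≤ 1 := le_of_tendsto hψ.norm
    (hU.mono fun z hz => (mem_ball_zero_iff.1 (h.mapsψ hz)).le)
  by_contra hne
  have hlt := lt_of_le_of_ne hle hne
  have h1 : Tendsto (fun z => φ (ψ z)) l (𝓝 (φ ζ)) := (h.continuousAt_φ hlt).tendsto.comp hψ
  have h2 : Tendsto (fun z => φ (ψ z)) l (𝓝 x₀) :=
    (tendsto_id'.2 (hl.trans nhdsWithin_le_nhds)).congr' (hU.mono fun z hz => (h.left z hz).symm)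
  rw [tendsto_nhds_unique h2 h1] at hx₀
  exact hx₀ (h.mapsφ (mem_ball_zero_iff.2 hlt))

theorem DiskChart.lim_mem_frontier (h : DiskChart U ψ φ) {x₁ ζ : ℂ} (hζ : ‖ζ‖ = 1) {l : Filter ℂ}
    [l.NeBot] (hl : l ≤ 𝓝[ball 0 1] ζ) (hφ : Tendsto φ l (𝓝 x₁)) : x₁ ∈ frontier U := by
  have hB : ∀ᶠ z in l, z ∈ ball (0 : ℂ) 1 := hl self_mem_nhdsWithin
  rw [h.isOpen.frontier_eq]
  refine ⟨mem_closure_of_tendsto hφ (hB.mono fun z hz => h.mapsφ hz), fun hx => ?_⟩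
  have h1 : Tendsto (fun z => ψ (φ z)) l (𝓝 (ψ x₁)) := (h.continuousAt_ψ hx).tendsto.comp hφ
  have h2 : Tendsto (fun z => ψ (φ z)) l (𝓝 ζ) :=
    (tendsto_id'.2 (hl.trans nhdsWithin_le_nhds)).congr' (hB.mono fun z hz => (h.right z hz).symm)
  have := mem_ball_zero_iff.1 (h.mapsψ hx)
  rw [tendsto_nhds_unique h1 h2, hζ] at this
  exact lt_irrefl _ this

theorem exists_mem_arc_of_isPreconnected {T : Set ℂ} (hT : IsPreconnected T) {f : ℂ → ℂ}
    (hf : ContinuousOn f T) {ω : ℂ} {r : ℝ} {x y : ℂ} (hx : x ∈ T) (hy : y ∈ T)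
    (hxr : ‖f x - ω‖ ≤ r * ‖f x + ω‖) (hyr : r * ‖f y + ω‖ ≤ ‖f y - ω‖) :
    ∃ t ∈ T, ‖f t - ω‖ = r * ‖f t + ω‖ := by
  have hc : ContinuousOn (fun z => ‖f z - ω‖ - r * ‖f z + ω‖) T :=
    (hf.sub continuousOn_const).norm.sub
      (continuousOn_const.mul (hf.add continuousOn_const).norm)
  obtain ⟨t, ht, h0⟩ := hT.intermediate_value hx hy hc
    (show (0 : ℝ) ∈ Icc _ _ from ⟨by linarith, by linarith⟩)
  exact ⟨t, ht, sub_eq_zero.1 h0⟩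

theorem logHeight_le {w : ℂ} {ε : ℝ} (hw : w ≠ 0) (h : ‖w‖ ≤ ε) :
    logHeight w ≤ Real.arsinh (Real.log ε) :=
  Real.arsinh_le_arsinh.2 (Real.log_le_log (norm_pos_iff.2 hw) h)

theorem le_logHeight {w : ℂ} {ε : ℝ} (hε : 0 < ε) (h : ε ≤ ‖w‖) :
    Real.arsinh (Real.log ε) ≤ logHeight w :=
  Real.arsinh_le_arsinh.2 (Real.log_le_log hε h)

theorem exists_arcPoint_bound {x₀ : ℂ} (hφ : ContinuousOn φ (ball 0 1))
    (h0 : ∀ z ∈ ball (0 : ℂ) 1, φ z ≠ x₀) {ω : ℂ} (hω : ‖ω‖ = 1) {r₁ r₂ : ℝ} :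
    ∃ B, ∀ r ∈ Ioo r₁ r₂, 0 < r₁ → ∃ z ∈ ball (0 : ℂ) 1, ‖z - ω‖ = r * ‖z + ω‖ ∧
      |logHeight (φ z - x₀)| ≤ B := by
  have hm : Real.pi / 2 ∈ Ioo 0 Real.pi := ⟨by positivity, by linarith [Real.pi_pos]⟩
  have hc : Continuous fun s => arcPoint ω s (Real.pi / 2) := continuous_iff_continuousAt.2
    fun s => (continuousAt_arcPoint (Ioo_subset_Icc_self hm)).comp
      (f := fun s => (s, Real.pi / 2)) (by fun_prop)
  have hb : ∀ s, arcPoint ω s (Real.pi / 2) ∈ ball (0 : ℂ) 1 := fun s => arcPoint_mem_ball hω hm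
  have hc2 : Continuous fun s => logHeight (φ (arcPoint ω s (Real.pi / 2)) - x₀) := by
    have h1 := (hφ.comp_continuous hc hb).sub (continuous_const (y := x₀))
    exact (h1.norm.log fun s => norm_ne_zero_iff.2 (sub_ne_zero.2 (h0 _ (hb s)))).arsinh
  obtain ⟨B, hB⟩ := isCompact_Icc.exists_bound_of_continuousOn
    (s := Icc (Real.log r₁) (Real.log r₂)) hc2.continuousOn
  refine ⟨B, fun r hr hr₁ => ⟨_, hb (Real.log r), ?_, ?_⟩⟩
  · rw [norm_arcPoint_sub (Ioo_subset_Icc_self hm), Real.exp_log (hr₁.trans hr.1)]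
  · have hr0 := hr₁.trans hr.1
    exact hB _ ⟨Real.log_le_log hr₁ hr.1.le, Real.log_le_log hr0 hr.2.le⟩

theorem DiskChart.eq_of_mapClusterPt (h : DiskChart U ψ φ) {x₀ ζ₁ ζ₂ : ℂ} (hx₀ : x₀ ∈ frontier U)
    (h1 : MapClusterPt ζ₁ (𝓝[U] x₀) ψ) (h2 : MapClusterPt ζ₂ (𝓝[U] x₀) ψ) : ζ₁ = ζ₂ := by
  by_contra hne
  have hxU : x₀ ∉ U := fun hx => h.notMem_frontier hx hx₀
  have h0 : ∀ z ∈ ball (0 : ℂ) 1, φ z ≠ x₀ := fun z hz he => hxU (he ▸ h.mapsφ hz)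
  have nrm : ∀ ζ, MapClusterPt ζ (𝓝[U] x₀) ψ → ‖ζ‖ = 1 := by
    intro ζ hc
    obtain ⟨l, hl, hlt⟩ := mapClusterPt_iff_ultrafilter.1 hc
    exact h.norm_lim_eq_one hxU hl hlt
  have hn1 := nrm _ h1
  have hn2 := nrm _ h2
  set d := ‖ζ₂ - ζ₁‖ / 4 with hd
  have hd0 : 0 < d := by
    have := norm_pos_iff.2 (sub_ne_zero.2 (Ne.symm hne))
    positivity
  have hd2 : d * ‖ζ₂ + ζ₁‖ < ‖ζ₂ - ζ₁‖ := by
    have : ‖ζ₂ + ζ₁‖ ≤ 2 := (norm_add_le _ _).trans (by rw [hn1, hn2]; norm_num)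
    nlinarith
  obtain ⟨B, hB⟩ := exists_arcPoint_bound h.dφ.continuousOn h0 hn1 (r₁ := d / 2) (r₂ := d)
  have hlog : Real.log d - Real.log (d / 2) = Real.log 2 := by
    rw [Real.log_div hd0.ne' two_ne_zero]; ring
  have hl2 : 0 < Real.log 2 := Real.log_pos one_lt_two
  obtain ⟨M, hM, hMC⟩ : ∃ M : ℝ, 0 < M ∧ areaConst < M ^ 2 * Real.log 2 := by
    refine ⟨1 + |areaConst| / Real.log 2, by positivity, ?_⟩
    have : 0 ≤ |areaConst| / Real.log 2 := by positivity
    calc areaConst ≤ |areaConst| / Real.log 2 * Real.log 2 := by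
          rw [div_mul_cancel₀ _ hl2.ne']; exact le_abs_self _
      _ < (1 + |areaConst| / Real.log 2) ^ 2 * Real.log 2 := by
          apply mul_lt_mul_of_pos_right _ hl2; nlinarith
  set ε := Real.exp (Real.sinh (-B - M)) with hε
  have hεv : Real.arsinh (Real.log ε) = -B - M := by rw [hε, Real.log_exp, Real.arsinh_sinh]
  obtain ⟨δ, hδ, hconn⟩ := h.locConn x₀ hx₀ ε (Real.exp_pos _)
  have hnb : U ∩ ball x₀ δ ∈ 𝓝[U] x₀ :=
    inter_mem self_mem_nhdsWithin (mem_nhdsWithin_of_mem_nhds (ball_mem_nhds _ hδ))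
  have hN1 : {w | ‖w - ζ₁‖ < d / 2 * ‖w + ζ₁‖} ∈ 𝓝 ζ₁ := by
    refine (isOpen_lt (by fun_prop) (by fun_prop)).mem_nhds ?_
    rw [mem_ofPred_eq, sub_self, norm_zero, ← two_mul, norm_mul, hn1]
    simp [hd0]
  have hN2 : {w | d * ‖w + ζ₁‖ < ‖w - ζ₁‖} ∈ 𝓝 ζ₂ :=
    (isOpen_lt (by fun_prop) (by fun_prop)).mem_nhds hd2
  obtain ⟨x, hx1, hxs⟩ := ((mapClusterPt_iff_frequently.1 h1 _ hN1).and_eventually hnb).exists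
  obtain ⟨y, hy1, hys⟩ := ((mapClusterPt_iff_frequently.1 h2 _ hN2).and_eventually hnb).exists
  obtain ⟨T, hTs, hT, hxT, hyT⟩ := hconn x hxs y hys
  have := length_area_disk h.dφ h.injOn h0 hn1 (half_pos hd0) (half_lt_self hd0) hM (by
    intro r hr
    obtain ⟨t, ht, htr⟩ := exists_mem_arc_of_isPreconnected hT
      (h.dψ.continuousOn.mono fun z hz => (hTs hz).1) hxT hyT (ω := ζ₁) (r := r)
      (hx1.le.trans (mul_le_mul_of_nonneg_right hr.1.le (norm_nonneg _)))
      ((mul_le_mul_of_nonneg_right hr.2.le (norm_nonneg _)).trans hy1.le)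
    obtain ⟨z, hz, hzr, hzB⟩ := hB r hr (half_pos hd0)
    have htU := (hTs ht).1
    refine ⟨ψ t, h.mapsψ htU, z, hz, htr, hzr, ?_⟩
    rw [h.left t htU]
    have h3 : logHeight (t - x₀) ≤ -B - M := by
      rw [← hεv]
      refine logHeight_le (sub_ne_zero.2 fun he => hxU (he ▸ htU)) ?_
      rw [← dist_eq_norm]; exact (hTs ht).2.le
    have h4 := (abs_le.1 hzB).1
    rw [abs_sub_comm]
    exact le_trans (by linarith) (le_abs_self _))
  rw [hlog] at this
  linarith

theorem DiskChart.exists_tendsto (h : DiskChart U ψ φ) {x₀ : ℂ} (hx₀ : x₀ ∈ frontier U) :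
    ∃ ζ, ‖ζ‖ = 1 ∧ Tendsto ψ (𝓝[U] x₀) (𝓝 ζ) := by
  have hxU : x₀ ∉ U := fun hx => h.notMem_frontier hx hx₀
  have : (𝓝[U] x₀).NeBot := mem_closure_iff_nhdsWithin_neBot.1 (frontier_subset_closure hx₀)
  have hmem : ∀ᶠ z in 𝓝[U] x₀, ψ z ∈ closedBall (0 : ℂ) 1 :=
    eventually_of_mem self_mem_nhdsWithin fun z hz => ball_subset_closedBall (h.mapsψ hz)
  obtain ⟨ζ, -, hζ⟩ := (isCompact_closedBall (0 : ℂ) 1).exists_mapClusterPt_of_frequently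
    hmem.frequently
  have ht := (isCompact_closedBall (0 : ℂ) 1).tendsto_nhds_of_unique_mapClusterPt hmem
    fun y _ hy => h.eq_of_mapClusterPt hx₀ hy hζ
  exact ⟨ζ, h.norm_lim_eq_one hxU le_rfl ht, ht⟩

end LineAlexander

namespace LineAlexander
open Set Filter Topology Metric

variable {U : Set ℂ} {ψ φ : ℂ → ℂ}

theorem DiskChart.notMem_of_mem_frontier (h : DiskChart U ψ φ) {x : ℂ} (hx : x ∈ frontier U) :
    x ∉ U := fun hU => h.notMem_frontier hU hx

theorem nhdsWithin_neBot_of_mem_frontier {x : ℂ} (hx : x ∈ frontier U) : (𝓝[U] x).NeBot :=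
  mem_closure_iff_nhdsWithin_neBot.1 (frontier_subset_closure hx)

theorem mem_nhds_small_arc {ζ : ℂ} (hζ : ‖ζ‖ = 1) {r : ℝ} (hr : 0 < r) :
    {w | ‖w - ζ‖ < r * ‖w + ζ‖} ∈ 𝓝 ζ := by
  refine (isOpen_lt (by fun_prop) (by fun_prop)).mem_nhds ?_
  rw [mem_ofPred_eq, sub_self, norm_zero, ← two_mul, norm_mul, hζ]
  simp [hr]

theorem DiskChart.small_arcs_meet (h : DiskChart U ψ φ) {x₀ ζ : ℂ} (hx₀ : x₀ ∈ frontier U)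
    (hζ : ‖ζ‖ = 1) (ht : Tendsto ψ (𝓝[U] x₀) (𝓝 ζ)) {ε : ℝ} (hε : 0 < ε) :
    ∃ r₀ > 0, ∀ r ∈ Ioo 0 r₀, ∃ t ∈ U ∩ ball x₀ ε, ‖ψ t - ζ‖ = r * ‖ψ t + ζ‖ := by
  have := nhdsWithin_neBot_of_mem_frontier hx₀
  obtain ⟨δ, hδ, hconn⟩ := h.locConn x₀ hx₀ ε hε
  have hnb : U ∩ ball x₀ δ ∈ 𝓝[U] x₀ :=
    inter_mem self_mem_nhdsWithin (mem_nhdsWithin_of_mem_nhds (ball_mem_nhds _ hδ))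
  obtain ⟨y, hy⟩ := Filter.nonempty_of_mem hnb
  have hyb := mem_ball_zero_iff.1 (h.mapsψ hy.1)
  have hy1 : 0 < ‖ψ y - ζ‖ := by
    refine norm_pos_iff.2 (sub_ne_zero.2 fun he => ?_)
    rw [he, hζ] at hyb; exact lt_irrefl _ hyb
  have hy2 : 0 < ‖ψ y + ζ‖ := by
    refine norm_pos_iff.2 fun he => ?_
    rw [eq_neg_of_add_eq_zero_left he, norm_neg, hζ] at hyb; exact lt_irrefl _ hyb
  refine ⟨‖ψ y - ζ‖ / ‖ψ y + ζ‖, div_pos hy1 hy2, fun r hr => ?_⟩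
  obtain ⟨x, hx1, hx⟩ := Filter.nonempty_of_mem (inter_mem (ht.eventually (mem_nhds_small_arc hζ hr.1)) hnb)
  obtain ⟨T, hTs, hT, hxT, hyT⟩ := hconn x hx y hy
  obtain ⟨t, htT, htr⟩ := exists_mem_arc_of_isPreconnected hT
      (h.dψ.continuousOn.mono fun z hz => (hTs hz).1) hxT hyT (ω := ζ) (r := r) (le_of_lt hx1)
      ((lt_div_iff₀ hy2).1 hr.2).le
  exact ⟨t, hTs htT, htr⟩

theorem DiskChart.eq_of_tendsto (h : DiskChart U ψ φ) {x₀ x₁ ζ : ℂ} (hx₀ : x₀ ∈ frontier U)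
    (hx₁ : x₁ ∈ frontier U) (h0 : Tendsto ψ (𝓝[U] x₀) (𝓝 ζ)) (h1 : Tendsto ψ (𝓝[U] x₁) (𝓝 ζ)) :
    x₀ = x₁ := by
  by_contra hne
  have := nhdsWithin_neBot_of_mem_frontier hx₀
  have hxU := h.notMem_of_mem_frontier hx₀
  have hζ := h.norm_lim_eq_one hxU le_rfl h0
  have hd : 0 < dist x₀ x₁ := dist_pos.2 hne
  set ε := dist x₀ x₁ / 3 with hε
  have hε0 : 0 < ε := by positivity
  obtain ⟨r₀, hr₀, hA⟩ := h.small_arcs_meet hx₀ hζ h0 hε0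
  obtain ⟨r₁, hr₁, hB⟩ := h.small_arcs_meet hx₁ hζ h1 hε0
  set M := Real.arsinh (Real.log (2 * ε)) - Real.arsinh (Real.log ε) with hM
  have hM0 : 0 < M := sub_pos.2 (Real.arsinh_lt_arsinh.2 (Real.log_lt_log hε0 (by linarith)))
  set R := min r₀ r₁ with hR
  have hR0 : 0 < R := lt_min hr₀ hr₁
  set K := 1 + |areaConst| / M ^ 2 with hK
  have hK0 : 0 < K := by positivity
  have hKC : areaConst < M ^ 2 * K := by
    rw [hK, mul_add, mul_div_cancel₀ _ (by positivity : M ^ 2 ≠ 0)]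
    have := le_abs_self areaConst
    nlinarith [sq_pos_of_pos hM0]
  have hlt : R * Real.exp (-K) < R := by
    have : Real.exp (-K) < 1 := Real.exp_zero ▸ Real.exp_lt_exp.2 (by linarith)
    nlinarith
  have := length_area_disk (x₀ := x₀) h.dφ h.injOn (fun z hz he => hxU (he ▸ h.mapsφ hz)) hζ
    (mul_pos hR0 (Real.exp_pos (-K))) hlt hM0 (by
    intro r hr
    have hrp : 0 < r := (mul_pos hR0 (Real.exp_pos (-K))).trans hr.1
    obtain ⟨t, ⟨htU, htb⟩, htr⟩ := hA r ⟨hrp, hr.2.trans_le (min_le_left _ _)⟩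
    obtain ⟨s, ⟨hsU, hsb⟩, hsr⟩ := hB r ⟨hrp, hr.2.trans_le (min_le_right _ _)⟩
    refine ⟨ψ s, h.mapsψ hsU, ψ t, h.mapsψ htU, hsr, htr, ?_⟩
    rw [h.left t htU, h.left s hsU]
    have h3 : logHeight (t - x₀) ≤ Real.arsinh (Real.log ε) := by
      refine logHeight_le (sub_ne_zero.2 fun he => hxU (he ▸ htU)) ?_
      rw [← dist_eq_norm]; exact (mem_ball.1 htb).le
    have h4 : Real.arsinh (Real.log (2 * ε)) ≤ logHeight (s - x₀) := by
      refine le_logHeight (by positivity) ?_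
      rw [← dist_eq_norm]
      have h5 := mem_ball.1 hsb
      have h6 := dist_triangle x₀ s x₁
      rw [dist_comm x₀ s] at h6
      have : dist x₀ x₁ = 3 * ε := by rw [hε]; ring
      linarith
    exact le_trans (by linarith) (le_abs_self _))
  rw [Real.log_mul hR0.ne' (Real.exp_pos _).ne', Real.log_exp] at this
  linarith

theorem DiskChart.tendsto_φ (h : DiskChart U ψ φ) {x₀ ζ : ℂ} (hx₀ : x₀ ∈ frontier U)
    (ht : Tendsto ψ (𝓝[U] x₀) (𝓝 ζ)) : Tendsto φ (𝓝[ball 0 1] ζ) (𝓝 x₀) := by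
  have := nhdsWithin_neBot_of_mem_frontier hx₀
  have hζ := h.norm_lim_eq_one (h.notMem_of_mem_frontier hx₀) le_rfl ht
  by_contra hnot
  rw [Metric.tendsto_nhds] at hnot
  push Not at hnot
  obtain ⟨ε, hε, hfr⟩ := hnot
  have hfr2 : ∃ᶠ z in 𝓝[ball 0 1] ζ, φ z ∈ sphere x₀ ε := by
    rw [Filter.frequently_iff]
    intro s hs
    obtain ⟨r, hr, hrs⟩ := Metric.mem_nhdsWithin_iff.1 hs
    have hC : Convex ℝ (ball ζ r ∩ ball (0 : ℂ) 1) := (convex_ball _ _).inter (convex_ball _ _)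
    have hmem : ball ζ r ∩ ball (0 : ℂ) 1 ∈ 𝓝[ball 0 1] ζ :=
      inter_mem (mem_nhdsWithin_of_mem_nhds (ball_mem_nhds _ hr)) self_mem_nhdsWithin
    obtain ⟨z, hz1, hz2⟩ := (hfr.and_eventually hmem).exists
    have hev : ∀ᶠ x in 𝓝[U] x₀, x ∈ U ∧ ψ x ∈ ball ζ r ∧ x ∈ ball x₀ ε :=
      (eventually_mem_nhdsWithin).and ((ht.eventually (ball_mem_nhds _ hr)).and
        (mem_nhdsWithin_of_mem_nhds (ball_mem_nhds _ hε)))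
    obtain ⟨x, hxU, hx1, hx2⟩ := hev.exists
    have hc : ContinuousOn (fun w => dist (φ w) x₀) (ball ζ r ∩ ball (0 : ℂ) 1) :=
      continuous_dist.comp_continuousOn
        ((h.dφ.continuousOn.mono inter_subset_right).prodMk continuousOn_const)
    obtain ⟨w, hw, hwe⟩ := hC.isPreconnected.intermediate_value
      (show ψ x ∈ _ from ⟨hx1, h.mapsψ hxU⟩) hz2 hc
      (show ε ∈ Icc _ _ from ⟨by rw [h.left x hxU]; exact (mem_ball.1 hx2).le, hz1⟩)
    exact ⟨w, hrs hw, hwe⟩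
  have hne : (𝓝[ball 0 1] ζ ⊓ 𝓟 {z | φ z ∈ sphere x₀ ε}).NeBot := frequently_mem_iff_neBot.1 hfr2
  obtain ⟨l, hl⟩ := Ultrafilter.exists_le (𝓝[ball 0 1] ζ ⊓ 𝓟 {z | φ z ∈ sphere x₀ ε})
  have hl1 : (l : Filter ℂ) ≤ 𝓝[ball 0 1] ζ := hl.trans inf_le_left
  have hl2 : ∀ᶠ z in (l : Filter ℂ), φ z ∈ sphere x₀ ε := le_principal_iff.1 (hl.trans inf_le_right)
  obtain ⟨x₁, hx₁s, hx₁⟩ := (isCompact_sphere x₀ ε).ultrafilter_le_nhds (l.map φ)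
    (le_principal_iff.2 hl2)
  have hx₁f := h.lim_mem_frontier hζ hl1 hx₁
  obtain ⟨ζ', hζ', ht'⟩ := h.exists_tendsto hx₁f
  have hB : ∀ᶠ z in (l : Filter ℂ), z ∈ ball (0 : ℂ) 1 := hl1 self_mem_nhdsWithin
  have h2 : Tendsto φ l (𝓝[U] x₁) := tendsto_nhdsWithin_iff.2
    ⟨hx₁, hB.mono fun z hz => h.mapsφ hz⟩
  have h3 : Tendsto (fun z => z) l (𝓝 ζ') :=
    (ht'.comp h2).congr' (hB.mono fun z hz => h.right z hz)
  have h4 : ζ' = ζ := tendsto_nhds_unique h3 (hl1.trans nhdsWithin_le_nhds)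
  have := h.eq_of_tendsto hx₀ hx₁f ht (h4 ▸ ht')
  rw [← this, mem_sphere, dist_self] at hx₁s
  exact hε.ne hx₁s

/-- The points of the circle which correspond to finite boundary points of `U`. -/
def Accessible (U : Set ℂ) (ψ : ℂ → ℂ) (ζ : ℂ) : Prop :=
  ∃ x₀ ∈ frontier U, Tendsto ψ (𝓝[U] x₀) (𝓝 ζ)

theorem DiskChart.exists_arc_accessible (h : DiskChart U ψ φ) {ω : ℂ} (hω : ‖ω‖ = 1) {r₁ r₂ : ℝ}
    (hr₁ : 0 < r₁) (hr : r₁ < r₂) :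
    ∃ r ∈ Ioo r₁ r₂, ∀ z, ‖z‖ = 1 → ‖z - ω‖ = r * ‖z + ω‖ → Accessible U ψ z := by
  obtain ⟨x₀, hxU⟩ := (ne_univ_iff_exists_notMem _).1 h.ne_univ
  have h0 : ∀ z ∈ ball (0 : ℂ) 1, φ z ≠ x₀ := fun z hz he => hxU (he ▸ h.mapsφ hz)
  obtain ⟨B, hB⟩ := exists_arcPoint_bound h.dφ.continuousOn h0 hω (r₁ := r₁) (r₂ := r₂)
  have hl2 : 0 < Real.log r₂ - Real.log r₁ := sub_pos.2 (Real.log_lt_log hr₁ hr)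
  set D := Real.log r₂ - Real.log r₁
  obtain ⟨M, hM, hMC⟩ : ∃ M : ℝ, 0 < M ∧ areaConst < M ^ 2 * D := by
    refine ⟨1 + |areaConst| / D, by positivity, ?_⟩
    have : 0 ≤ |areaConst| / D := by positivity
    calc areaConst ≤ |areaConst| / D * D := by
          rw [div_mul_cancel₀ _ hl2.ne']; exact le_abs_self _
      _ < (1 + |areaConst| / D) ^ 2 * D := by
          apply mul_lt_mul_of_pos_right _ hl2; nlinarith
  by_contra hcon
  push Not at hcon
  refine absurd (length_area_disk h.dφ h.injOn h0 hω hr₁ hr hM fun r hr' => ?_) (not_le.2 hMC)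
  by_contra hno
  push Not at hno
  obtain ⟨z, hz, hzr, hbad⟩ := hcon r hr'
  obtain ⟨z₀, hz₀, hz₀r, hz₀B⟩ := hB r hr' hr₁
  have hr0 := hr₁.trans hr'.1
  have hbound : ∀ w ∈ ball (0 : ℂ) 1, ‖w - ω‖ = r * ‖w + ω‖ →
      φ w ∈ closedBall x₀ (Real.exp (Real.sinh (B + M))) := by
    intro w hw hwr
    have h3 := hno w hw z₀ hz₀ hwr hz₀r
    have h4 : logHeight (φ w - x₀) ≤ B + M := by
      linarith [(abs_lt.1 h3).2, (abs_le.1 hz₀B).2]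
    rw [mem_closedBall, dist_eq_norm]
    have hn := norm_pos_iff.2 (sub_ne_zero.2 (h0 w hw))
    rw [← Real.log_le_iff_le_exp hn, ← Real.arsinh_le_arsinh, Real.arsinh_sinh]
    exact h4
  obtain ⟨θ, hθ, hθz, -⟩ := exists_arcPoint_eq hω hr0 hzr hz.le
  have hne : (𝓝[Ioo 0 Real.pi] θ).NeBot := by
    rw [← mem_closure_iff_nhdsWithin_neBot, closure_Ioo Real.pi_pos.ne]; exact hθ
  set f : ℝ → ℂ := fun t => arcPoint ω (Real.log r) t with hf
  have hft : Tendsto f (𝓝[Ioo 0 Real.pi] θ) (𝓝 z) := by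
    have := (continuousAt_arcPoint (ω := ω) (s := Real.log r) hθ).comp
      (f := fun t => (Real.log r, t)) (by fun_prop)
    rw [← hθz]
    exact this.tendsto.mono_left nhdsWithin_le_nhds
  have hfb : ∀ᶠ t in 𝓝[Ioo 0 Real.pi] θ, f t ∈ ball (0 : ℂ) 1 :=
    eventually_of_mem self_mem_nhdsWithin fun t ht => arcPoint_mem_ball hω ht
  have hfc : ∀ᶠ t in 𝓝[Ioo 0 Real.pi] θ, φ (f t) ∈ closedBall x₀ (Real.exp (Real.sinh (B + M))) :=
    eventually_of_mem self_mem_nhdsWithin fun t ht => hbound _ (arcPoint_mem_ball hω ht) (by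
      rw [hf, norm_arcPoint_sub (Ioo_subset_Icc_self ht), Real.exp_log hr0])
  obtain ⟨l, hl⟩ := Ultrafilter.exists_le (map f (𝓝[Ioo 0 Real.pi] θ))
  have hl1 : (l : Filter ℂ) ≤ 𝓝[ball 0 1] z := hl.trans (tendsto_nhdsWithin_iff.2 ⟨hft, hfb⟩)
  obtain ⟨x₁, -, hx₁⟩ := (isCompact_closedBall x₀ _).ultrafilter_le_nhds (l.map φ)
    (le_principal_iff.2 (hl (mem_map.2 hfc)))
  have hx₁f := h.lim_mem_frontier hz hl1 hx₁
  obtain ⟨ζ', hζ', ht'⟩ := h.exists_tendsto hx₁f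
  have hBl : ∀ᶠ z in (l : Filter ℂ), z ∈ ball (0 : ℂ) 1 := hl1 self_mem_nhdsWithin
  have h2 : Tendsto φ l (𝓝[U] x₁) := tendsto_nhdsWithin_iff.2
    ⟨hx₁, hBl.mono fun z hz => h.mapsφ hz⟩
  have h3 : Tendsto (fun z => z) l (𝓝 ζ') :=
    (ht'.comp h2).congr' (hBl.mono fun z hz => h.right z hz)
  exact hbad ⟨x₁, hx₁f, tendsto_nhds_unique h3 (hl1.trans nhdsWithin_le_nhds) ▸ ht'⟩

end LineAlexander

namespace LineAlexander
open Set Filter Topology Metric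

variable {U : Set ℂ} {ψ φ : ℂ → ℂ}

theorem mem_of_fix_compl {k : ℂ ≃ₜ ℂ} (hk : ∀ x ∉ U, k x = x) {x : ℂ} (hx : x ∈ U) : k x ∈ U := by
  by_contra h
  exact h (by rw [k.injective (hk _ h)]; exact hx)

theorem symm_fix_compl {k : ℂ ≃ₜ ℂ} (hk : ∀ x ∉ U, k x = x) : ∀ x ∉ U, k.symm x = x := fun x hx => by
  rw [Homeomorph.symm_apply_eq, hk x hx]

theorem DiskChart.conj_mem_ball (h : DiskChart U ψ φ) {k : ℂ ≃ₜ ℂ} (hk : ∀ x ∉ U, k x = x) {z : ℂ}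
    (hz : z ∈ ball (0 : ℂ) 1) : ψ (k (φ z)) ∈ ball (0 : ℂ) 1 :=
  h.mapsψ (mem_of_fix_compl hk (h.mapsφ hz))

theorem DiskChart.conj_symm_conj (h : DiskChart U ψ φ) {k : ℂ ≃ₜ ℂ} (hk : ∀ x ∉ U, k x = x) {z : ℂ}
    (hz : z ∈ ball (0 : ℂ) 1) : ψ (k.symm (φ (ψ (k (φ z))))) = z := by
  rw [h.left _ (mem_of_fix_compl hk (h.mapsφ hz)), k.symm_apply_apply, h.right z hz]

theorem DiskChart.continuousOn_conj (h : DiskChart U ψ φ) {k : ℂ ≃ₜ ℂ} (hk : ∀ x ∉ U, k x = x) :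
    ContinuousOn (fun z => ψ (k (φ z))) (ball 0 1) :=
  h.dψ.continuousOn.comp (k.continuous.comp_continuousOn h.dφ.continuousOn)
    fun _ hz => mem_of_fix_compl hk (h.mapsφ hz)

theorem DiskChart.tendsto_conj_of_accessible (h : DiskChart U ψ φ) {k : ℂ ≃ₜ ℂ}
    (hk : ∀ x ∉ U, k x = x) {ζ : ℂ} (hζ : Accessible U ψ ζ) :
    Tendsto (fun z => ψ (k (φ z))) (𝓝[ball 0 1] ζ) (𝓝 ζ) := by
  obtain ⟨x₀, hx₀, ht⟩ := hζ
  refine ht.comp (tendsto_nhdsWithin_iff.2 ⟨?_, eventually_of_mem self_mem_nhdsWithin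
    fun z hz => mem_of_fix_compl hk (h.mapsφ hz)⟩)
  have h1 := (k.continuous.tendsto x₀).comp (h.tendsto_φ hx₀ ht)
  rwa [hk x₀ (h.notMem_of_mem_frontier hx₀)] at h1

theorem DiskChart.norm_conj_lim (h : DiskChart U ψ φ) {k : ℂ ≃ₜ ℂ} (hk : ∀ x ∉ U, k x = x) {ζ ω : ℂ}
    (hζ : ‖ζ‖ = 1) {l : Filter ℂ} [l.NeBot] (hl : l ≤ 𝓝[ball 0 1] ζ)
    (hf : Tendsto (fun z => ψ (k (φ z))) l (𝓝 ω)) : ‖ω‖ = 1 := by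
  have hB : ∀ᶠ z in l, z ∈ ball (0 : ℂ) 1 := hl self_mem_nhdsWithin
  have hle : ‖ω‖ ≤ 1 := le_of_tendsto hf.norm
    (hB.mono fun z hz => (mem_ball_zero_iff.1 (h.conj_mem_ball hk hz)).le)
  by_contra hne
  have hlt : ω ∈ ball (0 : ℂ) 1 := mem_ball_zero_iff.2 (lt_of_le_of_ne hle hne)
  have hc := (h.continuousOn_conj (symm_fix_compl hk)).continuousAt (isOpen_ball.mem_nhds hlt)
  have h1 := (hc.tendsto.comp hf).congr' (hB.mono fun z hz => h.conj_symm_conj hk hz)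
  have h2 : Tendsto (fun z => z) l (𝓝 ζ) := hl.trans nhdsWithin_le_nhds
  have h3 := mem_ball_zero_iff.1 (h.conj_mem_ball (symm_fix_compl hk) hlt)
  rw [tendsto_nhds_unique h1 h2, hζ] at h3
  exact lt_irrefl _ h3

theorem nhdsWithin_ball_neBot {ζ : ℂ} (hζ : ‖ζ‖ = 1) : (𝓝[ball 0 1] ζ).NeBot := by
  rw [← mem_closure_iff_nhdsWithin_neBot, closure_ball _ one_ne_zero, mem_closedBall_zero_iff]
  exact hζ.le

theorem norm_arcPoint_zero {ω : ℂ} (hω : ‖ω‖ = 1) (s : ℝ) : ‖arcPoint ω s 0‖ = 1 := by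
  have h0 : Complex.exp ⟨s, 0⟩ = (Real.exp s : ℂ) := by
    rw [Complex.ofReal_exp]; congr 1
  have h1 : ‖Complex.I - Real.exp s‖ = ‖Complex.I + Real.exp s‖ := by
    have : ‖Complex.I - Real.exp s‖ ^ 2 = ‖Complex.I + Real.exp s‖ ^ 2 := by
      rw [Complex.sq_norm, Complex.sq_norm, Complex.normSq_apply, Complex.normSq_apply]
      simp
    exact (pow_left_inj₀ (norm_nonneg _) (norm_nonneg _) two_ne_zero).1 this
  have h2 : 0 < ‖Complex.I + (Real.exp s : ℂ)‖ := norm_pos_iff.2 (I_add_ne_zero (by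
    rw [Complex.ofReal_im]))
  rw [arcPoint, cayley, h0, norm_div, norm_mul, hω, h1, one_mul, div_self h2.ne']

theorem DiskChart.exists_accessible_near (h : DiskChart U ψ φ) {ζ : ℂ} (hζ : ‖ζ‖ = 1) {ρ : ℝ}
    (hρ : 0 < ρ) : ∃ ω ∈ ball ζ ρ, ‖ω‖ = 1 ∧ Accessible U ψ ω := by
  obtain ⟨r, hr, hacc⟩ := h.exists_arc_accessible hζ (r₁ := ρ / 4) (r₂ := ρ / 2) (by linarith)
    (by linarith)
  have hr0 : 0 < r := by linarith [hr.1]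
  have hn := norm_arcPoint_zero hζ (Real.log r)
  have h1 := norm_arcPoint_sub (ω := ζ) (s := Real.log r) (θ := 0) ⟨le_rfl, Real.pi_pos.le⟩
  rw [Real.exp_log hr0] at h1
  refine ⟨_, ?_, hn, hacc _ hn h1⟩
  rw [mem_ball, dist_eq_norm, h1]
  have : ‖arcPoint ζ (Real.log r) 0 + ζ‖ ≤ 2 := (norm_add_le _ _).trans (by rw [hn, hζ]; norm_num)
  nlinarith [hr.2]

theorem DiskChart.tendsto_conj (h : DiskChart U ψ φ) {k : ℂ ≃ₜ ℂ} (hk : ∀ x ∉ U, k x = x) {ζ : ℂ}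
    (hζ : ‖ζ‖ = 1) : Tendsto (fun z => ψ (k (φ z))) (𝓝[ball 0 1] ζ) (𝓝 ζ) := by
  have := nhdsWithin_ball_neBot hζ
  set f : ℂ → ℂ := fun z => ψ (k (φ z)) with hf
  have hfb : ∀ᶠ z in 𝓝[ball 0 1] ζ, f z ∈ closedBall (0 : ℂ) 1 :=
    eventually_of_mem self_mem_nhdsWithin fun z hz => ball_subset_closedBall (h.conj_mem_ball hk hz)
  refine (isCompact_closedBall (0 : ℂ) 1).tendsto_nhds_of_unique_mapClusterPt hfb
    fun ω _ hω => ?_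
  by_contra hne
  have hω1 : ‖ω‖ = 1 := by
    obtain ⟨l, hl, hlt⟩ := mapClusterPt_iff_ultrafilter.1 hω
    exact h.norm_conj_lim hk hζ hl hlt
  set d := ‖ζ - ω‖ / 4 with hd
  have hd0 : 0 < d := by
    have := norm_pos_iff.2 (sub_ne_zero.2 (Ne.symm hne))
    positivity
  obtain ⟨r, hr, hacc⟩ := h.exists_arc_accessible hω1 (half_pos hd0) (half_lt_self hd0)
  have hr0 : 0 < r := (half_pos hd0).trans hr.1
  have hζr : r * ‖ζ + ω‖ < ‖ζ - ω‖ := by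
    have : ‖ζ + ω‖ ≤ 2 := (norm_add_le _ _).trans (by rw [hζ, hω1]; norm_num)
    nlinarith [hr.2]
  have hO : IsOpen {w : ℂ | r * ‖w + ω‖ < ‖w - ω‖} := isOpen_lt (by fun_prop) (by fun_prop)
  obtain ⟨η, hη, hηs⟩ := Metric.isOpen_iff.1 hO ζ hζr
  have hfr : ∃ᶠ z in 𝓝[ball 0 1] ζ, ‖f z - ω‖ = r * ‖f z + ω‖ := by
    rw [Filter.frequently_iff]
    intro s hs
    obtain ⟨ρ, hρ, hρs⟩ := Metric.mem_nhdsWithin_iff.1 hs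
    have hC : Convex ℝ (ball ζ ρ ∩ ball (0 : ℂ) 1) := (convex_ball _ _).inter (convex_ball _ _)
    have hmem : ball ζ ρ ∩ ball (0 : ℂ) 1 ∈ 𝓝[ball 0 1] ζ :=
      inter_mem (mem_nhdsWithin_of_mem_nhds (ball_mem_nhds _ hρ)) self_mem_nhdsWithin
    obtain ⟨x, hx1, hx⟩ := ((mapClusterPt_iff_frequently.1 hω _
      (mem_nhds_small_arc hω1 hr0)).and_eventually hmem).exists
    obtain ⟨ξ, hξ, hξ1, hξa⟩ := h.exists_accessible_near hζ (lt_min hρ hη)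
    have := nhdsWithin_ball_neBot hξ1
    have hev : ∀ᶠ z in 𝓝[ball 0 1] ξ, z ∈ ball (0 : ℂ) 1 ∧ z ∈ ball ζ ρ ∧
        f z ∈ {w : ℂ | r * ‖w + ω‖ < ‖w - ω‖} :=
      eventually_mem_nhdsWithin.and ((eventually_of_mem (mem_nhdsWithin_of_mem_nhds
        (isOpen_ball.mem_nhds (ball_subset_ball (min_le_left _ _) hξ))) fun _ hz => hz).and
        ((h.tendsto_conj_of_accessible hk hξa).eventually (hO.mem_nhds
          (hηs (ball_subset_ball (min_le_right _ _) hξ)))))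
    obtain ⟨y, hyB, hyρ, hy⟩ := hev.exists
    obtain ⟨t, ht, htr⟩ := exists_mem_arc_of_isPreconnected hC.isPreconnected
      ((h.continuousOn_conj hk).mono inter_subset_right) hx ⟨hyρ, hyB⟩ (le_of_lt hx1) (le_of_lt hy)
    exact ⟨t, hρs ht, htr⟩
  have hneb : (𝓝[ball 0 1] ζ ⊓ 𝓟 {z | ‖f z - ω‖ = r * ‖f z + ω‖}).NeBot :=
    frequently_mem_iff_neBot.1 hfr
  obtain ⟨l, hl⟩ := Ultrafilter.exists_le (𝓝[ball 0 1] ζ ⊓ 𝓟 {z | ‖f z - ω‖ = r * ‖f z + ω‖})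
  have hl1 : (l : Filter ℂ) ≤ 𝓝[ball 0 1] ζ := hl.trans inf_le_left
  have hl2 : ∀ᶠ z in (l : Filter ℂ), ‖f z - ω‖ = r * ‖f z + ω‖ :=
    le_principal_iff.1 (hl.trans inf_le_right)
  obtain ⟨ω', -, hω'⟩ := (isCompact_closedBall (0 : ℂ) 1).ultrafilter_le_nhds (l.map f)
    (le_principal_iff.2 (hl1 hfb))
  have hω't : Tendsto f l (𝓝 ω') := hω'
  have hω'1 : ‖ω'‖ = 1 := h.norm_conj_lim hk hζ hl1 hω't
  have hω'r : ‖ω' - ω‖ = r * ‖ω' + ω‖ :=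
    tendsto_nhds_unique_of_eventuallyEq (hω't.sub_const ω).norm
      ((hω't.add_const ω).norm.const_mul r) hl2
  have hB : ∀ᶠ z in (l : Filter ℂ), z ∈ ball (0 : ℂ) 1 := hl1 self_mem_nhdsWithin
  have h1 := (h.tendsto_conj_of_accessible (symm_fix_compl hk) (hacc ω' hω'1 hω'r)).comp
    (tendsto_nhdsWithin_iff.2 ⟨hω't, hB.mono fun z hz => h.conj_mem_ball hk hz⟩)
  have h2 : Tendsto (fun z => z) l (𝓝 ω') := h1.congr' (hB.mono fun z hz => h.conj_symm_conj hk hz)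
  have h3 : ω' = ζ := tendsto_nhds_unique h2 (hl1.trans nhdsWithin_le_nhds)
  rw [h3] at hω'r
  exact hζr.ne hω'r.symm

open Classical in
/-- The map `ψ ∘ k ∘ φ` of the unit disk, extended by the identity. -/
noncomputable def diskExt (ψ φ : ℂ → ℂ) (k : ℂ → ℂ) (z : ℂ) : ℂ :=
  if z ∈ ball (0 : ℂ) 1 then ψ (k (φ z)) else z

theorem diskExt_of_mem {k : ℂ → ℂ} {z : ℂ} (hz : z ∈ ball (0 : ℂ) 1) :
    diskExt ψ φ k z = ψ (k (φ z)) := if_pos hz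

theorem diskExt_of_notMem {k : ℂ → ℂ} {z : ℂ} (hz : z ∉ ball (0 : ℂ) 1) :
    diskExt ψ φ k z = z := if_neg hz

theorem DiskChart.diskExt_mem (h : DiskChart U ψ φ) {k : ℂ ≃ₜ ℂ} (hk : ∀ x ∉ U, k x = x) {z : ℂ}
    (hz : z ∈ ball (0 : ℂ) 1) : diskExt ψ φ k z ∈ ball (0 : ℂ) 1 := by
  rw [diskExt_of_mem hz]; exact h.conj_mem_ball hk hz

theorem DiskChart.diskExt_symm_diskExt (h : DiskChart U ψ φ) {k : ℂ ≃ₜ ℂ} (hk : ∀ x ∉ U, k x = x)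
    (z : ℂ) : diskExt ψ φ k.symm (diskExt ψ φ k z) = z := by
  by_cases hz : z ∈ ball (0 : ℂ) 1
  · rw [diskExt_of_mem (h.diskExt_mem hk hz), diskExt_of_mem hz, h.conj_symm_conj hk hz]
  · rw [diskExt_of_notMem hz, diskExt_of_notMem hz]

theorem DiskChart.continuous_diskExt (h : DiskChart U ψ φ) {k : ℂ ≃ₜ ℂ} (hk : ∀ x ∉ U, k x = x) :
    Continuous (diskExt ψ φ k) := by
  rw [continuous_iff_continuousAt]
  intro z
  by_cases hz : z ∈ ball (0 : ℂ) 1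
  · refine ((h.continuousOn_conj hk).continuousAt (isOpen_ball.mem_nhds hz)).congr ?_
    filter_upwards [isOpen_ball.mem_nhds hz] with w hw
    rw [diskExt_of_mem hw]
  · rw [ContinuousAt, diskExt_of_notMem hz]
    have hsup : 𝓝 z = 𝓝[ball 0 1] z ⊔ 𝓝[(ball 0 1)ᶜ] z := by
      rw [← nhdsWithin_union, union_compl_self, nhdsWithin_univ]
    suffices Tendsto (diskExt ψ φ k) (𝓝[ball 0 1] z ⊔ 𝓝[(ball 0 1)ᶜ] z) (𝓝 z) by
      rwa [← hsup] at this
    rw [tendsto_sup]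
    constructor
    · have hev : (fun w => ψ (k (φ w))) =ᶠ[𝓝[ball 0 1] z] diskExt ψ φ k :=
        eventually_of_mem self_mem_nhdsWithin fun w hw => (diskExt_of_mem hw).symm
      refine Tendsto.congr' hev ?_
      by_cases h1 : ‖z‖ = 1
      · exact h.tendsto_conj hk h1
      · have : 𝓝[ball 0 1] z = ⊥ := by
          by_contra hb
          have : (𝓝[ball 0 1] z).NeBot := ⟨hb⟩
          rw [← mem_closure_iff_nhdsWithin_neBot, closure_ball _ one_ne_zero,
            mem_closedBall_zero_iff] at this
          exact hz (mem_ball_zero_iff.2 (lt_of_le_of_ne this h1))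
        rw [this]; exact tendsto_bot
    · have hev : (fun w => w) =ᶠ[𝓝[(ball 0 1)ᶜ] z] diskExt ψ φ k :=
        eventually_of_mem self_mem_nhdsWithin fun w hw => (diskExt_of_notMem hw).symm
      exact Tendsto.congr' hev nhdsWithin_le_nhds

end LineAlexander

namespace LineAlexander
open Set Filter Topology Metric

/-- The projection of the real line onto the unit interval. -/
noncomputable def clamp (t : ℝ) : ℝ := max 0 (min 1 t)

theorem continuous_clamp : Continuous clamp := by unfold clamp; fun_prop

theorem clamp_mem (t : ℝ) : clamp t ∈ Icc (0 : ℝ) 1 :=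
  ⟨le_max_left _ _, max_le zero_le_one (min_le_left _ _)⟩

theorem clamp_of_mem {t : ℝ} (ht : t ∈ Icc (0 : ℝ) 1) : clamp t = t := by
  rw [clamp, min_eq_right ht.2, max_eq_right ht.1]

/-- Alexander's isotopy from the identity to a map which is the identity off the unit disk. -/
noncomputable def alex (g : ℂ → ℂ) (t : ℝ) (z : ℂ) : ℂ :=
  z + (clamp t : ℂ) * (g ((clamp t : ℂ)⁻¹ * z) - (clamp t : ℂ)⁻¹ * z)

theorem alex_of_eq_zero {g : ℂ → ℂ} {t : ℝ} (ht : clamp t = 0) (z : ℂ) : alex g t z = z := by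
  simp [alex, ht]

theorem alex_of_pos {g : ℂ → ℂ} {t : ℝ} (ht : 0 < clamp t) (z : ℂ) :
    alex g t z = clamp t * g ((clamp t : ℂ)⁻¹ * z) := by
  have : (clamp t : ℂ) ≠ 0 := by exact_mod_cast ht.ne'
  rw [alex]; field_simp; ring

theorem alex_zero {g : ℂ → ℂ} (z : ℂ) : alex g 0 z = z :=
  alex_of_eq_zero (clamp_of_mem ⟨le_rfl, zero_le_one⟩) z

theorem alex_one {g : ℂ → ℂ} (z : ℂ) : alex g 1 z = g z := by
  have h1 : clamp 1 = 1 := clamp_of_mem ⟨zero_le_one, le_rfl⟩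
  rw [alex_of_pos (by rw [h1]; exact one_pos), h1]
  simp

theorem alex_of_notMem {g : ℂ → ℂ} (hg : ∀ z ∉ ball (0 : ℂ) 1, g z = z)
    {t : ℝ} {z : ℂ} (hz : z ∉ ball (0 : ℂ) 1) : alex g t z = z := by
  rcases (clamp_mem t).1.eq_or_lt with h0 | h0
  · exact alex_of_eq_zero h0.symm z
  · rw [alex, hg]
    · simp
    · rw [mem_ball_zero_iff, not_lt] at hz ⊢
      rw [norm_mul, norm_inv, Complex.norm_real, Real.norm_of_nonneg h0.le]
      calc 1 ≤ (clamp t)⁻¹ := (one_le_inv₀ h0).2 (clamp_mem t).2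
        _ ≤ _ := le_mul_of_one_le_right (by positivity) hz

theorem alex_mem {g : ℂ → ℂ} (hg : ∀ z ∉ ball (0 : ℂ) 1, g z = z)
    {t : ℝ} {z : ℂ} (hgb : ∀ z ∈ ball (0 : ℂ) 1, g z ∈ ball (0 : ℂ) 1)
    (hz : z ∈ ball (0 : ℂ) 1) : alex g t z ∈ ball (0 : ℂ) 1 := by
  rcases (clamp_mem t).1.eq_or_lt with h0 | h0
  · rwa [alex_of_eq_zero h0.symm z]
  · by_cases h1 : (clamp t : ℂ)⁻¹ * z ∈ ball (0 : ℂ) 1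
    · rw [alex_of_pos h0, mem_ball_zero_iff, norm_mul, Complex.norm_real,
        Real.norm_of_nonneg h0.le]
      have := mem_ball_zero_iff.1 (hgb _ h1)
      have h2 := (clamp_mem t).2
      nlinarith [norm_nonneg (g ((clamp t : ℂ)⁻¹ * z))]
    · rw [alex, hg _ h1]; simpa using hz

theorem continuous_alex {g : ℂ → ℂ} (hg : ∀ z ∉ ball (0 : ℂ) 1, g z = z)
    (hc : Continuous g)
    (hgb : ∀ z ∈ ball (0 : ℂ) 1, g z ∈ ball (0 : ℂ) 1) :
    Continuous fun p : ℝ × ℂ => alex g p.1 p.2 := by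
  have hbd : ∀ w, ‖g w - w‖ ≤ 2 := by
    intro w
    by_cases hw : w ∈ ball (0 : ℂ) 1
    · have h1 := mem_ball_zero_iff.1 hw
      have h2 := mem_ball_zero_iff.1 (hgb w hw)
      exact (norm_sub_le _ _).trans (by linarith)
    · rw [hg w hw]; simp
  have hcl : Continuous fun p : ℝ × ℂ => (clamp p.1 : ℂ) :=
    Complex.continuous_ofReal.comp (continuous_clamp.comp continuous_fst)
  refine continuous_snd.add (continuous_iff_continuousAt.2 fun p => ?_)
  by_cases h0 : clamp p.1 = 0
  · rw [ContinuousAt, h0, Complex.ofReal_zero, zero_mul]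
    refine squeeze_zero_norm (a := fun q : ℝ × ℂ => ‖(clamp q.1 : ℂ)‖ * 2) (fun q => ?_) ?_
    · rw [norm_mul]
      exact mul_le_mul_of_nonneg_left (hbd _) (norm_nonneg _)
    · have : Continuous fun q : ℝ × ℂ => ‖(clamp q.1 : ℂ)‖ * 2 := hcl.norm.mul continuous_const
      simpa [h0] using this.tendsto p
  · have h1 : ContinuousAt (fun q : ℝ × ℂ => (clamp q.1 : ℂ)⁻¹ * q.2) p :=
      (hcl.continuousAt.inv₀ (by exact_mod_cast h0)).mul continuous_snd.continuousAt
    exact hcl.continuousAt.mul ((hc.continuousAt.comp h1).sub h1)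

theorem alex_leftInverse {g g' : ℂ → ℂ} (h : ∀ z, g' (g z) = z) (t : ℝ) (z : ℂ) :
    alex g' t (alex g t z) = z := by
  rcases (clamp_mem t).1.eq_or_lt with h0 | h0
  · rw [alex_of_eq_zero h0.symm, alex_of_eq_zero h0.symm]
  · have : (clamp t : ℂ) ≠ 0 := by exact_mod_cast h0.ne'
    rw [alex_of_pos h0, alex_of_pos h0, inv_mul_cancel_left₀ this, h, mul_inv_cancel_left₀ this]

variable {U : Set ℂ} {ψ φ : ℂ → ℂ}

open Classical in
/-- Alexander's isotopy transported to `U`. -/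
noncomputable def regionAlex (U : Set ℂ) (ψ φ k : ℂ → ℂ) (p : ℝ × ℂ) : ℂ :=
  if p.2 ∈ U then φ (alex (diskExt ψ φ k) p.1 (ψ p.2)) else p.2

theorem regionAlex_of_mem {k : ℂ → ℂ} {t : ℝ} {x : ℂ} (hx : x ∈ U) :
    regionAlex U ψ φ k (t, x) = φ (alex (diskExt ψ φ k) t (ψ x)) := if_pos hx

theorem regionAlex_of_notMem {k : ℂ → ℂ} {t : ℝ} {x : ℂ} (hx : x ∉ U) :
    regionAlex U ψ φ k (t, x) = x := if_neg hx

theorem DiskChart.alex_mem (h : DiskChart U ψ φ) {k : ℂ ≃ₜ ℂ} (hk : ∀ x ∉ U, k x = x) {t : ℝ} {z : ℂ}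
    (hz : z ∈ ball (0 : ℂ) 1) : alex (diskExt ψ φ k) t z ∈ ball (0 : ℂ) 1 :=
  _root_.LineAlexander.alex_mem (fun _ => diskExt_of_notMem) (fun _ => h.diskExt_mem hk) hz

theorem DiskChart.continuous_regionAlex (h : DiskChart U ψ φ) {k : ℂ ≃ₜ ℂ}
    (hk : ∀ x ∉ U, k x = x) : Continuous (regionAlex U ψ φ k) := by
  have hA : Continuous fun p : ℝ × ℂ => alex (diskExt ψ φ k) p.1 p.2 :=
    continuous_alex (fun _ => diskExt_of_notMem) (h.continuous_diskExt hk)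
      fun _ => h.diskExt_mem hk
  rw [continuous_iff_continuousAt]
  rintro ⟨t, x⟩
  have hUo : IsOpen (Prod.snd ⁻¹' U : Set (ℝ × ℂ)) := h.isOpen.preimage continuous_snd
  by_cases hx : x ∈ U
  · have h1 : ContinuousAt (fun p : ℝ × ℂ => φ (alex (diskExt ψ φ k) p.1 (ψ p.2))) (t, x) := by
      have h2 : ContinuousAt (fun p : ℝ × ℂ => (p.1, ψ p.2)) (t, x) :=
        continuousAt_fst.prodMk ((h.continuousAt_ψ hx).comp_of_eq continuousAt_snd rfl)
      have h3 := hA.continuousAt.comp h2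
      exact (h.continuousAt_φ (mem_ball_zero_iff.1 (h.alex_mem hk (h.mapsψ hx)))).comp_of_eq h3 rfl
    refine h1.congr ?_
    filter_upwards [hUo.mem_nhds hx] with p hp
    exact (regionAlex_of_mem hp).symm
  · rw [ContinuousAt, regionAlex_of_notMem hx]
    have hsup : 𝓝 (t, x) = 𝓝[Prod.snd ⁻¹' U] (t, x) ⊔ 𝓝[(Prod.snd ⁻¹' U)ᶜ] (t, x) := by
      rw [← nhdsWithin_union, union_compl_self, nhdsWithin_univ]
    suffices Tendsto (regionAlex U ψ φ k)
        (𝓝[Prod.snd ⁻¹' U] (t, x) ⊔ 𝓝[(Prod.snd ⁻¹' U)ᶜ] (t, x)) (𝓝 x) by rwa [← hsup] at this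
    rw [tendsto_sup]
    have hsnd : Tendsto Prod.snd (𝓝[Prod.snd ⁻¹' U] (t, x)) (𝓝[U] x) :=
      tendsto_nhdsWithin_iff.2 ⟨continuousAt_snd.tendsto.mono_left nhdsWithin_le_nhds,
        eventually_mem_nhdsWithin⟩
    constructor
    · have hev : (fun p : ℝ × ℂ => φ (alex (diskExt ψ φ k) p.1 (ψ p.2)))
          =ᶠ[𝓝[Prod.snd ⁻¹' U] (t, x)] regionAlex U ψ φ k :=
        eventually_of_mem self_mem_nhdsWithin fun p hp => (regionAlex_of_mem hp).symm
      refine Tendsto.congr' hev ?_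
      by_cases hcl : x ∈ closure U
      · have hxf : x ∈ frontier U := by rw [h.isOpen.frontier_eq]; exact ⟨hcl, hx⟩
        obtain ⟨ζ, hζ, hψ⟩ := h.exists_tendsto hxf
        refine (h.tendsto_φ hxf hψ).comp (tendsto_nhdsWithin_iff.2 ⟨?_, ?_⟩)
        · have h2 : Tendsto (fun p : ℝ × ℂ => (p.1, ψ p.2)) (𝓝[Prod.snd ⁻¹' U] (t, x)) (𝓝 (t, ζ)) :=
            (continuousAt_fst.tendsto.mono_left nhdsWithin_le_nhds).prodMk_nhds (hψ.comp hsnd)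
          have h3 := (hA.tendsto (t, ζ)).comp h2
          have h4 : alex (diskExt ψ φ k) t ζ = ζ :=
            alex_of_notMem (fun _ => diskExt_of_notMem) (by simp [hζ])
          simp only [h4] at h3
          exact h3
        · exact eventually_of_mem self_mem_nhdsWithin fun p hp => h.alex_mem hk (h.mapsψ hp)
      · have hb : 𝓝[U] x = ⊥ := by
          by_contra hb
          exact hcl (mem_closure_iff_nhdsWithin_neBot.2 ⟨hb⟩)
        rw [hb] at hsnd
        have : 𝓝[Prod.snd ⁻¹' U] (t, x) = ⊥ := by
          rw [← empty_mem_iff_bot]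
          exact hsnd (show (∅ : Set ℂ) ∈ (⊥ : Filter ℂ) from mem_bot)
        rw [this]; exact tendsto_bot
    · have hev : Prod.snd =ᶠ[𝓝[(Prod.snd ⁻¹' U)ᶜ] (t, x)] regionAlex U ψ φ k :=
        eventually_of_mem self_mem_nhdsWithin fun p hp => (regionAlex_of_notMem hp).symm
      exact (continuousAt_snd.tendsto.mono_left nhdsWithin_le_nhds).congr' hev

theorem DiskChart.regionAlex_symm (h : DiskChart U ψ φ) {k : ℂ ≃ₜ ℂ} (hk : ∀ x ∉ U, k x = x)
    (t : ℝ) (x : ℂ) : regionAlex U ψ φ k.symm (t, regionAlex U ψ φ k (t, x)) = x := by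
  by_cases hx : x ∈ U
  · have hb := h.alex_mem hk (t := t) (h.mapsψ hx)
    rw [regionAlex_of_mem hx, regionAlex_of_mem (h.mapsφ hb), h.right _ hb,
      alex_leftInverse (h.diskExt_symm_diskExt hk), h.left x hx]
  · rw [regionAlex_of_notMem hx, regionAlex_of_notMem hx]

theorem DiskChart.isoRel (h : DiskChart U ψ φ) {k : ℂ ≃ₜ ℂ} (hk : ∀ x ∉ U, k x = x) :
    IsoRel k Uᶜ := by
  refine ⟨regionAlex U ψ φ k, h.continuous_regionAlex hk, fun t _ => ?_, fun x => ?_, fun x => ?_,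
    fun t _ x hx => regionAlex_of_notMem hx⟩
  · exact ⟨{  toFun := fun x => regionAlex U ψ φ k (t, x)
              invFun := fun x => regionAlex U ψ φ k.symm (t, x)
              left_inv := h.regionAlex_symm hk t
              right_inv := h.regionAlex_symm (k := k.symm) (symm_fix_compl hk) t
              continuous_toFun := (h.continuous_regionAlex hk).comp (by fun_prop)
              continuous_invFun :=
                (h.continuous_regionAlex (symm_fix_compl hk)).comp (by fun_prop) },
      fun x => rfl⟩
  · by_cases hx : x ∈ U
    · rw [regionAlex_of_mem hx, alex_zero, h.left x hx]
    · exact regionAlex_of_notMem hx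
  · by_cases hx : x ∈ U
    · rw [regionAlex_of_mem hx, alex_one, diskExt_of_mem (h.mapsψ hx), h.left x hx,
        h.left _ (mem_of_fix_compl hk hx)]
    · rw [regionAlex_of_notMem hx, hk x hx]

theorem IsoRel.comp {k k' : ℂ → ℂ} {O O' : Set ℂ} (h : IsoRel k O) (h' : IsoRel k' O') :
    IsoRel (k ∘ k') (O ∩ O') := by
  obtain ⟨H, hH, he, h0, h1, hO⟩ := h
  obtain ⟨H', hH', he', h0', h1', hO'⟩ := h'
  refine ⟨fun p => H (p.1, H' p), hH.comp (continuous_fst.prodMk hH'), fun t ht => ?_, fun x => ?_,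
    fun x => ?_, fun t ht x hx => ?_⟩
  · obtain ⟨e, he⟩ := he t ht
    obtain ⟨e', he'⟩ := he' t ht
    exact ⟨e'.trans e, fun x => by simp [he, he']⟩
  · simp [h0, h0']
  · simp [h1, h1']
  · simp only [hO' t ht x hx.2, hO t ht x hx.1]

theorem isoRel_id (O : Set ℂ) : IsoRel (fun x => x) O :=
  ⟨Prod.snd, continuous_snd, fun _ _ => ⟨Homeomorph.refl ℂ, fun _ => rfl⟩, fun _ => rfl,
    fun _ => rfl, fun _ _ _ _ => rfl⟩

open Classical in
/-- A homeomorphism preserving `U` and fixing its frontier, cut off outside of `U`. -/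
noncomputable def cutOff (U : Set ℂ) (k : ℂ ≃ₜ ℂ) (h : ∀ x, k x ∈ U ↔ x ∈ U)
    (hf : ∀ x ∈ frontier U, k x = x) : ℂ ≃ₜ ℂ where
  toFun x := if x ∈ U then k x else x
  invFun x := if x ∈ U then k.symm x else x
  left_inv x := by by_cases hx : x ∈ U <;> simp [hx, h]
  right_inv x := by
    by_cases hx : x ∈ U
    · have : k.symm x ∈ U := by rwa [← h, k.apply_symm_apply]
      simp [hx, this]
    · simp [hx]
  continuous_toFun := Continuous.if (fun x hx => hf x hx) k.continuous continuous_id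
  continuous_invFun := Continuous.if
    (fun x hx => by rw [Homeomorph.symm_apply_eq]; exact (hf x hx).symm) k.symm.continuous
    continuous_id

theorem isoRel_of_charts (S : Finset (Set ℂ)) (hS : ∀ U ∈ S, ∃ ψ φ, DiskChart U ψ φ)
    (hdisj : (S : Set (Set ℂ)).Pairwise Disjoint) (k : ℂ ≃ₜ ℂ)
    (hk : ∀ x, (∀ U ∈ S, x ∉ U) → k x = x) (hkU : ∀ U ∈ S, ∀ x ∈ U, k x ∈ U) :
    IsoRel k {x | ∀ U ∈ S, x ∉ U} := by
  classical
  induction S using Finset.induction_on generalizing k with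
  | empty =>
    have : (k : ℂ → ℂ) = fun x => x := funext fun x => hk x (by simp)
    rw [this]; exact isoRel_id _
  | insert U S hU ih =>
    obtain ⟨ψ, φ, hc⟩ := hS U (Finset.mem_insert_self _ _)
    have hdU : ∀ V ∈ S, Disjoint U V := fun V hV =>
      hdisj (by simp) (by simp [hV]) fun e => hU (e ▸ hV)
    have hVo : ∀ V ∈ S, IsOpen V := fun V hV => by
      obtain ⟨_, _, h⟩ := hS V (Finset.mem_insert_of_mem hV); exact h.isOpen
    have hiff : ∀ x, k x ∈ U ↔ x ∈ U := by
      refine fun x => ⟨fun hx => ?_, hkU U (Finset.mem_insert_self _ _) x⟩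
      by_contra hxU
      by_cases hV : ∃ V ∈ S, x ∈ V
      · obtain ⟨V, hV, hxV⟩ := hV
        exact disjoint_left.1 (hdU V hV) hx (hkU V (Finset.mem_insert_of_mem hV) x hxV)
      · push Not at hV
        refine hxU ?_
        rwa [hk x (by simpa [hxU] using hV)] at hx
    have hf : ∀ x ∈ frontier U, k x = x := by
      intro x hx
      refine hk x fun V hV => ?_
      rcases Finset.mem_insert.1 hV with rfl | hV
      · exact hc.notMem_of_mem_frontier hx
      · exact fun hxV => disjoint_left.1 ((hdU V hV).closure_left (hVo V hV))
          (frontier_subset_closure hx) hxV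
    set e := cutOff U k hiff hf with he
    have he1 : ∀ x ∈ U, e x = k x := fun x hx => if_pos hx
    have he2 : ∀ x ∉ U, e x = x := fun x hx => if_neg hx
    have hs1 : ∀ x ∈ U, e.symm x = k.symm x := fun x hx => if_pos hx
    have hs2 : ∀ x ∉ U, e.symm x = x := fun x hx => if_neg hx
    have h1 : IsoRel e Uᶜ := hc.isoRel he2
    have h2 := ih (fun V hV => hS V (Finset.mem_insert_of_mem hV))
      (hdisj.mono (by simp)) (e.symm.trans k) (by
        intro x hx
        by_cases hxU : x ∈ U
        · simp [hs1 x hxU]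
        · simpa [hs2 x hxU] using hk x (by simpa [hxU] using hx)) (by
        intro V hV x hx
        have hxU : x ∉ U := fun hxU => disjoint_left.1 (hdU V hV) hxU hx
        simpa [hs2 x hxU] using hkU V (Finset.mem_insert_of_mem hV) x hx)
    have h3 := h2.comp h1
    have h4 : (e.symm.trans k : ℂ ≃ₜ ℂ) ∘ e = k := by ext x; simp
    rw [h4] at h3
    convert h3 using 1
    ext x
    simp [and_comm]

theorem IsLineFamily.isoRel {𝓛 : Set (Set ℂ)} (h : IsLineFamily 𝓛) (hne : 𝓛.Nonempty)
    {k : ℂ ≃ₜ ℂ} (hk : HasPairLog k) (hkF : ∀ z ∈ ⋃₀ 𝓛, k z = z) : IsoRel k (⋃₀ 𝓛) := by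
  have hfin := h.finite_components
  have hmem : ∀ x, x ∉ ⋃₀ 𝓛 ↔ ∃ U ∈ hfin.toFinset, x ∈ U := by
    intro x
    simp only [Finite.mem_toFinset]
    constructor
    · exact fun hx => ⟨_, ⟨x, hx, rfl⟩, _root_.mem_connectedComponentIn hx⟩
    · rintro ⟨_, ⟨p, -, rfl⟩, hx⟩
      exact connectedComponentIn_subset _ _ hx
  have hset : {x | ∀ U ∈ hfin.toFinset, x ∉ U} = ⋃₀ 𝓛 := by
    ext x
    rw [mem_ofPred_eq, ← not_iff_not, hmem x]
    push Not
    rfl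
  rw [← hset]
  refine isoRel_of_charts _ ?_ ?_ k ?_ ?_
  · intro U hU
    rw [Finite.mem_toFinset] at hU
    obtain ⟨p, hp, rfl⟩ := hU
    obtain ⟨L, hL⟩ := hne
    have hne' : connectedComponentIn (⋃₀ 𝓛)ᶜ p ≠ univ := by
      intro e
      obtain ⟨f, hf, rfl⟩ := h.isLine L hL
      have : f 0 ∈ connectedComponentIn (⋃₀ 𝓛)ᶜ p := e ▸ mem_univ _
      exact connectedComponentIn_subset _ _ this ⟨_, hL, mem_range_self 0⟩
    have ho : IsOpen (connectedComponentIn (⋃₀ 𝓛)ᶜ p) :=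
      h.isClosed.isOpen_compl.connectedComponentIn
    obtain ⟨ψ, φ, h1, h2, h3, h4, h5, h6⟩ := exists_riemann_map ho
      (isConnected_connectedComponentIn_iff.2 hp) hne' (h.connectedToInfinity_compl ⟨L, hL⟩ p)
    exact ⟨ψ, φ, ho, hne', h.locConnAtFrontier p, h1, h2, h3, h4, h5, h6⟩
  · intro U hU V hV hUV
    rw [Finset.mem_coe, Finite.mem_toFinset] at hU hV
    obtain ⟨p, hp, rfl⟩ := hU
    obtain ⟨q, hq, rfl⟩ := hV
    rw [disjoint_left]
    intro x hx hx'
    exact hUV ((connectedComponentIn_eq hx).trans (connectedComponentIn_eq hx').symm)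
  · intro x hx
    refine hkF x ?_
    rw [← hset]; exact hx
  · intro U hU x hx
    rw [Finite.mem_toFinset] at hU
    obtain ⟨p, hp, rfl⟩ := hU
    have := h.map_mem_connectedComponentIn hk hkF (connectedComponentIn_subset _ _ hx)
    rwa [← connectedComponentIn_eq hx] at this

end LineAlexander

namespace LineAlexander
open Set Filter Topology

/-- The identification of the plane with the complex numbers. -/
noncomputable def toComplex : Plane ≃ₜ ℂ := Complex.equivRealProdCLM.symm.toHomeomorph

/-- A homeomorphism of the plane, read in the complex numbers. -/
noncomputable def complexify (h : Plane ≃ₜ Plane) : ℂ ≃ₜ ℂ :=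
  toComplex.symm.trans (h.trans toComplex)

theorem complexify_apply (h : Plane ≃ₜ Plane) (z : ℂ) :
    complexify h z = toComplex (h (toComplex.symm z)) := rfl

theorem hasPairLog_complexify {h : Plane ≃ₜ Plane} (hh : OrientationPreserving h) :
    HasPairLog (complexify h) := by
  obtain ⟨F, hF, he, h0, h1, -⟩ := hh
  refine IsoRel.hasPairLog (O := ∅) ⟨fun p => toComplex (F (p.1, toComplex.symm p.2)), ?_,
    fun t ht => ?_, fun x => ?_, fun x => ?_, fun _ _ x hx => absurd hx (notMem_empty x)⟩
  · exact toComplex.continuous.comp (hF.comp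
      (continuous_fst.prodMk (toComplex.symm.continuous.comp continuous_snd)))
  · obtain ⟨e, he⟩ := he t ht
    exact ⟨complexify e, fun x => by rw [complexify_apply, he]⟩
  · simp [h0]
  · simp [h1, complexify_apply]

theorem isLine_image {L : Set Plane} (hL : IsTopLine L) (e : Plane ≃ₜ ℂ) : IsLine (e '' L) := by
  obtain ⟨f, hc, hi, hp, rfl⟩ := hL
  refine ⟨e ∘ f, ⟨e.continuous.comp hc, e.injective.comp hi, ?_⟩, range_comp e f⟩
  exact (isProperMap_iff_tendsto_cocompact.1 (e.isProperMap.comp hp)).2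

theorem isLineFamily_image {ℱ : Set (Set Plane)} (hfin : ℱ.Finite) (hline : ∀ L ∈ ℱ, IsTopLine L)
    (hdisj : ℱ.Pairwise Disjoint) (e : Plane ≃ₜ ℂ) : IsLineFamily ((fun L => e '' L) '' ℱ) where
  finite := hfin.image _
  isLine := by
    rintro _ ⟨L, hL, rfl⟩
    exact isLine_image (hline L hL) e
  disjoint := by
    rintro _ ⟨L, hL, rfl⟩ _ ⟨L', hL', rfl⟩ hne
    exact (disjoint_image_iff e.injective).2 (hdisj hL hL' fun h => hne (by rw [h]))

theorem isotopicRel_empty {h h' : Plane ≃ₜ Plane} (hOP : OrientationPreserving h)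
    (hOP' : OrientationPreserving h') : IsotopicRel h h' ∅ := by
  obtain ⟨F, hF, he, h0, h1, -⟩ := hOP
  obtain ⟨F', hF', he', h0', h1', -⟩ := hOP'
  refine ⟨fun p => F' (p.1, F (1 - p.1, p.2)), ?_, fun t ht => ?_, fun x => ?_, fun x => ?_,
    fun _ _ x hx => absurd hx (notMem_empty x)⟩
  · exact hF'.comp (continuous_fst.prodMk (hF.comp (by fun_prop)))
  · obtain ⟨e, he⟩ := he (1 - t) ⟨by linarith [ht.2], by linarith [ht.1]⟩
    obtain ⟨e', he'⟩ := he' t ht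
    exact ⟨e.trans e', fun x => by simp [he, he']⟩
  · simp [h0', h1]
  · simp [h0, h1']

theorem isotopicRel_sUnion {ℱ : Set (Set Plane)} (hfin : ℱ.Finite)
    (hline : ∀ L ∈ ℱ, IsTopLine L) (hdisj : ℱ.Pairwise Disjoint) {h h' : Plane ≃ₜ Plane}
    (hOP : OrientationPreserving h) (hOP' : OrientationPreserving h')
    (hagree : ∀ x ∈ ⋃₀ ℱ, h x = h' x) (hne : ℱ.Nonempty) : IsotopicRel h h' (⋃₀ ℱ) := by
  set e : Plane ≃ₜ ℂ := h.trans toComplex with he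
  have hfam := isLineFamily_image hfin hline hdisj e
  set k : ℂ ≃ₜ ℂ := (complexify h).symm.trans (complexify h') with hk
  have hke : ∀ x, k (e x) = toComplex (h' x) := fun x => by
    simp [hk, he, complexify]
  have hmem : ∀ z ∈ ⋃₀ ((fun L => e '' L) '' ℱ), ∃ x ∈ ⋃₀ ℱ, e x = z := by
    rintro z ⟨_, ⟨L, hL, rfl⟩, x, hx, rfl⟩
    exact ⟨x, ⟨L, hL, hx⟩, rfl⟩
  obtain ⟨K, hK, hKe, hK0, hK1, hKF⟩ := hfam.isoRel (hne.image _) (k := k)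
    ((hasPairLog_complexify hOP).comp_symm (hasPairLog_complexify hOP')) (by
      intro z hz
      obtain ⟨x, hx, rfl⟩ := hmem z hz
      rw [hke, ← hagree x hx]; rfl)
  refine ⟨fun p => toComplex.symm (K (p.1, e p.2)), ?_, fun t ht => ?_, fun x => ?_, fun x => ?_,
    fun t ht x hx => ?_⟩
  · exact toComplex.symm.continuous.comp (hK.comp
      (continuous_fst.prodMk (e.continuous.comp continuous_snd)))
  · obtain ⟨g, hg⟩ := hKe t ht
    exact ⟨e.trans (g.trans toComplex.symm), fun x => by simp [hg]⟩
  · simp [hK0, he]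
  · simp [hK1, hke]
  · obtain ⟨L, hL, hxL⟩ := hx
    simp only []
    rw [hKF t ht (e x) ⟨_, ⟨L, hL, rfl⟩, x, hxL, rfl⟩]
    simp [he]

end LineAlexander

/-- Alexander's trick for complements of lines: two
orientation preserving homeomorphisms of the plane coinciding on a finite union
of pairwise disjoint topological lines are isotopic relative to that union. -/
theorem alexander_trick
    (ℱ : Set (Set Plane)) (hfin : ℱ.Finite)
    (hline : ∀ L ∈ ℱ, IsTopLine L)
    (hdisj : ℱ.Pairwise Disjoint)
    (h h' : Plane ≃ₜ Plane)
    (hOP : OrientationPreserving h) (hOP' : OrientationPreserving h')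
    (hagree : ∀ x ∈ ⋃₀ ℱ, h x = h' x) :
    IsotopicRel (⇑h) (⇑h') (⋃₀ ℱ) := by
  rcases ℱ.eq_empty_or_nonempty with rfl | hne
  · rw [Set.sUnion_empty]
    exact LineAlexander.isotopicRel_empty hOP hOP'
  · exact LineAlexander.isotopicRel_sUnion hfin hline hdisj hOP hOP' hagree hne
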